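/- arXiv:1305.2520 — 2 statements merged into one kernel-verified Lean document; each statement's English description precedes it below -/
import Mathlib

section
/- Let x > 1, T ≥ 2, and let n_x be a nearest integer to x. Then for every ε > 0, ∑_{0<γ≤T} x^ρ = −(Λ(n_x)/(2π))·(e^{iT·log(x/n_x)} − 1)/(i·log(x/n_x)) + O_ε( x^{1+ε}·log(2x) + x^{1+ε}·log T + min(T·log T, (log T)/log x) ), where the sum runs over the nontrivial zeros ρ = β + iγ of the Riemann zeta function with 0 < γ ≤ T, counted with multiplicity, and in the main term the quotient (e^{iT·log(x/n_x)}−1)/(i·log(x/n_x)) is interpreted as T when x = n_x. -/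
open Complex
open scoped Classical

/-- The multiplicity (order of vanishing) of `f` at `ρ`. -/
noncomputable def zeroMult (f : ℂ → ℂ) (ρ : ℂ) : ℕ :=
  sSup {n : ℕ | ∃ g : ℂ → ℂ, AnalyticAt ℂ g ρ ∧ ∀ᶠ z in nhds ρ, f z = (z - ρ) ^ n * g z}

/-- `ρ` lies in the box of nontrivial zeros with `0 < Im ρ ≤ T`. -/
def inZeroBox (ρ : ℂ) (T : ℝ) : Prop :=
  0 < ρ.re ∧ ρ.re < 1 ∧ 0 < ρ.im ∧ ρ.im ≤ T

/-- `∑_{0<γ≤T} x^ρ`, the sum over nontrivial zeros `ρ = β + iγ` of `ζ` with `0 < γ ≤ T`,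
counted with multiplicity. -/
noncomputable def zetaZeroPowerSum (x T : ℝ) : ℂ :=
  ∑' ρ : ℂ, if inZeroBox ρ T then (zeroMult riemannZeta ρ : ℂ) * (x : ℂ) ^ ρ else 0

/-- The factor `(e^{iT log(x/n_x)} - 1)/(i log(x/n_x))`, interpreted as `T` when `x = n_x`. -/
noncomputable def landauFactor (x T : ℝ) (nx : ℕ) : ℂ :=
  if x = (nx : ℝ) then (T : ℂ)
  else (Complex.exp (Complex.I * T * Real.log (x / nx)) - 1) / (Complex.I * Real.log (x / nx))

theorem zeroMult_eq_analyticOrderNatAt {f : ℂ → ℂ} {ρ : ℂ} (hf : AnalyticAt ℂ f ρ)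
    (h : analyticOrderAt f ρ ≠ ⊤) : zeroMult f ρ = analyticOrderNatAt f ρ := by
  have hset : {n : ℕ | ∃ g : ℂ → ℂ, AnalyticAt ℂ g ρ ∧ ∀ᶠ z in nhds ρ, f z = (z - ρ) ^ n * g z} =
      Set.Iic (analyticOrderNatAt f ρ) := by
    ext n
    have := natCast_le_analyticOrderAt hf (n := n)
    rw [← Nat.cast_analyticOrderNatAt h, Nat.cast_le] at this
    simpa [smul_eq_mul] using this.symm
  rw [zeroMult, hset, csSup_Iic]

theorem analyticAt_riemannZeta {s : ℂ} (hs : s ≠ 1) : AnalyticAt ℂ riemannZeta s :=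
  (DifferentiableOn.analyticOnNhd (s := {1}ᶜ)
    (fun _ hz => (differentiableAt_riemannZeta hz).differentiableWithinAt)
    isOpen_compl_singleton) s hs

theorem analyticOrderAt_riemannZeta_ne_top {s : ℂ} (hs : s ≠ 1) :
    analyticOrderAt riemannZeta s ≠ ⊤ := by
  have han : AnalyticOnNhd ℂ riemannZeta {1}ᶜ := fun z hz => analyticAt_riemannZeta hz
  refine han.analyticOrderAt_ne_top_of_isPreconnected (x := 2) ?_ (by simp) hs ?_
  · exact (isConnected_compl_singleton_of_one_lt_rank (by simp) 1).isPreconnected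
  · rw [((analyticAt_riemannZeta (by simp)).analyticOrderAt_eq_zero).2
      (riemannZeta_ne_zero_of_one_le_re (by simp))]
    simp

theorem re_lt_one_of_riemannZeta_eq_zero {s : ℂ} (h : riemannZeta s = 0) : s.re < 1 := by
  by_contra! hs
  exact riemannZeta_ne_zero_of_one_le_re hs h

theorem cos_ne_zero_of_im_ne_zero {z : ℂ} (hz : z.im ≠ 0) : Complex.cos z ≠ 0 := by
  intro h
  obtain ⟨k, hk⟩ := Complex.cos_eq_zero_iff.1 h
  apply hz
  rw [hk, show ((2 * (k : ℂ) + 1) * Real.pi / 2) = (((2 * (k : ℝ) + 1) * Real.pi / 2 : ℝ) : ℂ) by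
    push_cast; ring]
  exact Complex.ofReal_im _

theorem re_pos_of_riemannZeta_eq_zero {s : ℂ} (h : riemannZeta s = 0) (him : s.im ≠ 0) :
    0 < s.re := by
  by_contra! hs
  have h0 : ∀ n : ℕ, 1 - s ≠ -n := by
    intro n hn
    apply him
    have := congrArg Complex.im hn
    simpa using this
  have h1 : 1 - s ≠ 1 := by
    intro hn
    apply him
    have := congrArg Complex.im hn
    simpa using this
  have := riemannZeta_one_sub h0 h1
  rw [sub_sub_cancel, h] at this
  have hG : Complex.Gamma (1 - s) ≠ 0 := Complex.Gamma_ne_zero h0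
  have hz : riemannZeta (1 - s) ≠ 0 := riemannZeta_ne_zero_of_one_le_re (by simpa using hs)
  have hc : Complex.cos (Real.pi * (1 - s) / 2) ≠ 0 := by
    apply cos_ne_zero_of_im_ne_zero
    rw [show (Real.pi * (1 - s) / 2 : ℂ) = ((Real.pi / 2 : ℝ) : ℂ) * (1 - s) by push_cast; ring,
      Complex.im_ofReal_mul]
    simpa [Real.pi_ne_zero] using him
  exact absurd this.symm (by simp [hG, hz, hc])

theorem exists_divide_zero {f : ℂ → ℂ} {U : Set ℂ} {ρ : ℂ} (hf : AnalyticOnNhd ℂ f U)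
    (hρ : ρ ∈ U) (ho : analyticOrderAt f ρ ≠ ⊤) :
    ∃ h : ℂ → ℂ, AnalyticOnNhd ℂ h U ∧ h ρ ≠ 0 ∧
      ∀ z, f z = (z - ρ) ^ analyticOrderNatAt f ρ * h z := by
  obtain ⟨g, hg, hg0, hfg⟩ := ((hf ρ hρ).analyticOrderAt_ne_top).1 ho
  set n := analyticOrderNatAt f ρ
  refine ⟨fun z => if z = ρ then g ρ else f z / (z - ρ) ^ n, ?_, by simpa using hg0, ?_⟩
  · intro z hz
    by_cases hzρ : z = ρ
    · subst hzρ
      refine hg.congr ?_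
      filter_upwards [hfg] with w hw
      split_ifs with h
      · rw [h]
      · rw [hw, smul_eq_mul, mul_div_cancel_left₀ _ (pow_ne_zero _ (sub_ne_zero.2 h))]
    · refine AnalyticAt.congr ((hf z hz).div ((analyticAt_id.sub analyticAt_const).pow n)
        (pow_ne_zero _ (sub_ne_zero.2 hzρ))) ?_
      filter_upwards [isOpen_ne.mem_nhds hzρ] with w hw
      simp only [if_neg (show w ≠ ρ from hw)]
      rfl
  · intro z
    by_cases hzρ : z = ρ
    · subst hzρ
      have := hfg.self_of_nhds
      simpa using this
    · simp only [if_neg hzρ]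
      rw [mul_div_cancel₀ _ (pow_ne_zero _ (sub_ne_zero.2 hzρ))]

/-- The zeros in a finite set can be divided out of an analytic function. -/
theorem exists_eq_prod_mul {U : Set ℂ} (Z : Finset ℂ) :
    ∀ {f : ℂ → ℂ}, AnalyticOnNhd ℂ f U → (∀ ρ ∈ Z, ρ ∈ U) →
      (∀ ρ ∈ Z, analyticOrderAt f ρ ≠ ⊤) →
    ∃ h : ℂ → ℂ, AnalyticOnNhd ℂ h U ∧ (∀ ρ ∈ Z, h ρ ≠ 0) ∧
      ∀ z, f z = (∏ ρ ∈ Z, (z - ρ) ^ analyticOrderNatAt f ρ) * h z := by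
  induction Z using Finset.induction_on with
  | empty => intro f hf _ _; exact ⟨f, hf, by simp, by simp⟩
  | insert a Z ha ih =>
    intro f hf hZ ho
    obtain ⟨g, hg, hga, hfg⟩ := exists_divide_zero hf (hZ a (by simp)) (ho a (by simp))
    have hord : ∀ ρ ∈ U, ρ ≠ a → analyticOrderAt g ρ = analyticOrderAt f ρ := by
      intro ρ hρU hρ
      have hfe : f = (fun z => (z - a) ^ analyticOrderNatAt f a) * g := funext hfg
      have hp : AnalyticAt ℂ (fun z : ℂ => (z - a) ^ analyticOrderNatAt f a) ρ :=
        (analyticAt_id.sub analyticAt_const).pow _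
      conv_rhs => rw [hfe]
      rw [analyticOrderAt_mul hp (hg ρ hρU), hp.analyticOrderAt_eq_zero.2
        (pow_ne_zero _ (sub_ne_zero.2 hρ)), zero_add]
    have hne : ∀ ρ ∈ Z, ρ ≠ a := fun ρ hρ h => ha (h ▸ hρ)
    obtain ⟨h, hh, hh0, hgh⟩ := ih hg (fun ρ hρ => hZ ρ (by simp [hρ])) (fun ρ hρ => by
      rw [hord ρ (hZ ρ (by simp [hρ])) (hne ρ hρ)]
      exact ho ρ (by simp [hρ]))
    refine ⟨h, hh, ?_, ?_⟩
    · intro ρ hρ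
      rcases Finset.mem_insert.1 hρ with rfl | hρ
      · intro h0
        apply hga
        rw [hgh, h0, mul_zero]
      · exact hh0 ρ hρ
    · intro z
      rw [hfg z, hgh z, Finset.prod_insert ha, mul_assoc]
      congr 2
      refine Finset.prod_congr rfl fun ρ hρ => ?_
      rw [analyticOrderNatAt, analyticOrderNatAt, hord ρ (hZ ρ (by simp [hρ])) (hne ρ hρ)]

/-- Logarithmic derivative of a product of linear factors times a zero-free cofactor. -/
theorem deriv_div_of_eq_prod_mul {f h : ℂ → ℂ} {Z : Finset ℂ} {m : ℂ → ℕ} {z : ℂ}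
    (hfh : ∀ z, f z = (∏ ρ ∈ Z, (z - ρ) ^ m ρ) * h z) (hd : DifferentiableAt ℂ h z)
    (hz : ∀ ρ ∈ Z, z ≠ ρ) (hh : h z ≠ 0) :
    deriv f z / f z = ∑ ρ ∈ Z, (m ρ : ℂ) / (z - ρ) + deriv h z / h z := by
  have hfe : f = fun z => (∏ ρ ∈ Z, (z - ρ) ^ m ρ) * h z := funext hfh
  have hpd : DifferentiableAt ℂ (fun z => ∏ ρ ∈ Z, (z - ρ) ^ m ρ) z := by fun_prop
  have hp0 : ∏ ρ ∈ Z, (z - ρ) ^ m ρ ≠ 0 :=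
    Finset.prod_ne_zero_iff.2 fun ρ hρ => pow_ne_zero _ (sub_ne_zero.2 (hz ρ hρ))
  have := logDeriv_mul (f := fun z => ∏ ρ ∈ Z, (z - ρ) ^ m ρ) (g := h) z hp0 hh hpd hd
  rw [← logDeriv_apply, ← logDeriv_apply, hfe, this, logDeriv_prod]
  · congr 1
    refine Finset.sum_congr rfl fun ρ hρ => ?_
    have hl := logDeriv_fun_pow (f := fun z : ℂ => z - ρ) (x := z) (by fun_prop) (m ρ)
    rw [hl, logDeriv_apply]
    simp [div_eq_mul_inv]
  · exact fun ρ hρ => pow_ne_zero _ (sub_ne_zero.2 (hz ρ hρ))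
  · intro ρ _; fun_prop

open Metric in
theorem sum_analyticOrderNatAt_le {f : ℂ → ℂ} {c : ℂ} {r R M : ℝ} (hr : 0 < r) (hrR : r < R)
    (hM : 1 ≤ M) (hf : AnalyticOnNhd ℂ f (closedBall c R)) (hfc : f c ≠ 0)
    (hfM : ∀ z ∈ closedBall c R, ‖f z‖ ≤ M) {Z : Finset ℂ} (hZ : ∀ ρ ∈ Z, ρ ∈ closedBall c r) :
    (∑ ρ ∈ Z, (analyticOrderNatAt f ρ : ℝ)) ≤ Real.log (M / ‖f c‖) / Real.log (R / r) := by
  have hR : 0 < R := hr.trans hrR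
  have habs : |R| = R := abs_of_pos hR
  have habr : |r| = r := abs_of_pos hr
  have key := AnalyticOnNhd.sum_divisor_le (f := f) (c := c) (r := r) (R := R) (M := M)
    (by rwa [habr]) (by rwa [habs, habr]) hM (by rwa [habs]) hfc
    (fun z hz => hfM z (by rw [habs] at hz; exact sphere_subset_closedBall hz))
  refine le_trans ?_ key
  rw [habr]
  have hf' : AnalyticOnNhd ℂ f (closedBall c r) := hf.mono (closedBall_subset_closedBall hrR.le)
  have hfin := (MeromorphicOn.divisor f (closedBall c r)).finiteSupport (isCompact_closedBall _ _)
  have h1 : (∑ ρ ∈ Z, (analyticOrderNatAt f ρ : ℤ)) =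
      ∑ ρ ∈ Z, MeromorphicOn.divisor f (closedBall c r) ρ := by
    refine Finset.sum_congr rfl fun ρ hρ => ?_
    rw [MeromorphicOn.AnalyticOnNhd.divisor_apply hf' (hZ ρ hρ), analyticOrderNatAt]
    cases analyticOrderAt f ρ <;> rfl
  have h2 : ∑ ρ ∈ Z, MeromorphicOn.divisor f (closedBall c r) ρ ≤
      ∑ᶠ ρ, MeromorphicOn.divisor f (closedBall c r) ρ := by
    rw [finsum_eq_sum_of_support_subset (s := Z ∪ hfin.toFinset) _ (by
      intro x hx
      simpa using Or.inr hx)]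
    exact Finset.sum_le_sum_of_subset_of_nonneg Finset.subset_union_left
      (fun ρ _ _ => MeromorphicOn.AnalyticOnNhd.divisor_nonneg hf' ρ)
  rw [← h1] at h2
  exact_mod_cast h2

open Metric in
theorem norm_logDeriv_le_of_norm_le {h : ℂ → ℂ} {c : ℂ} {r r₁ K : ℝ} (hr : 0 < r) (hr₁ : r < r₁)
    (hK : 0 < K) (hh : DifferentiableOn ℂ h (ball c r₁)) (hh0 : ∀ z ∈ ball c r₁, h z ≠ 0)
    (hhK : ∀ z ∈ ball c r₁, ‖h z‖ ≤ Real.exp K * ‖h c‖) {z : ℂ} (hz : z ∈ closedBall c r) :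
    ‖deriv h z / h z‖ ≤ 8 * K * r₁ / (r₁ - r) ^ 2 := by
  have hr₁0 : 0 < r₁ := hr.trans hr₁
  have hc : c ∈ ball c r₁ := mem_ball_self hr₁0
  have hlog : DifferentiableOn ℂ (fun z => deriv h z / h z) (ball c r₁) :=
    (hh.deriv isOpen_ball).div hh hh0
  obtain ⟨G, hGc, hG⟩ := hlog.isExactOn_ball.with_val_at c 0
  have hGd : DifferentiableOn ℂ G (ball c r₁) :=
    fun w hw => (hG w hw).differentiableAt.differentiableWithinAt
  have hexp : ∀ w ∈ ball c r₁, h w = h c * Complex.exp (G w) := by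
    have hconst : ∀ w ∈ ball c r₁, h w * Complex.exp (-G w) = h c * Complex.exp (-G c) := by
      intro w hw
      refine (convex_ball c r₁).is_const_of_fderivWithin_eq_zero (𝕜 := ℂ)
        (f := fun w => h w * Complex.exp (-G w)) (hh.mul hGd.neg.cexp) ?_ hw hc
      intro v hv
      have hhv := (hh.differentiableAt (isOpen_ball.mem_nhds hv)).hasDerivAt
      have hd : HasDerivAt (fun w => h w * Complex.exp (-G w)) 0 v := by
        refine (hhv.mul (hG v hv).neg.cexp).congr_deriv ?_
        have := hh0 v hv
        field_simp
        ring
      rw [fderivWithin_of_isOpen isOpen_ball hv]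
      have := hd.hasFDerivAt.fderiv
      rw [this]
      ext; simp
    intro w hw
    have := hconst w hw
    rw [hGc, neg_zero, Complex.exp_zero, mul_one] at this
    rw [← this, mul_assoc, ← Complex.exp_add, neg_add_cancel, Complex.exp_zero, mul_one]
  have hre : ∀ w ∈ ball c r₁, (G w).re ≤ K := by
    intro w hw
    have h1 := hhK w hw
    rw [hexp w hw, norm_mul, mul_comm, Complex.norm_exp] at h1
    exact Real.exp_le_exp.1 (le_of_mul_le_mul_right h1 (norm_pos_iff.2 (hh0 c hc)))
  have hBC : ∀ w ∈ ball c r₁, ‖G w‖ ≤ 2 * K * ‖w - c‖ / (r₁ - ‖w - c‖) := by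
    intro w hw
    have hadd : ∀ u ∈ ball (0:ℂ) r₁, u + c ∈ ball c r₁ := by
      intro u hu; simpa [dist_eq_norm] using hu
    have := Complex.borelCaratheodory_zero (f := fun u => G (u + c)) (M := K) (R := r₁)
      (z := w - c) hK
      (hGd.comp (by fun_prop) (fun u hu => hadd u hu))
      (fun u hu => hre _ (hadd u hu)) hr₁0 (by simpa [dist_eq_norm] using hw) (by simpa using hGc)
    simpa using this
  set d := (r₁ - r) / 2 with hd
  have hd0 : 0 < d := by rw [hd]; linarith
  have hzr : ‖z - c‖ ≤ r := by simpa [dist_eq_norm] using hz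
  have hsub : closedBall z d ⊆ ball c r₁ := by
    intro w hw
    rw [mem_closedBall, dist_eq_norm] at hw
    rw [mem_ball, dist_eq_norm]
    calc ‖w - c‖ = ‖(w - z) + (z - c)‖ := by ring_nf
      _ ≤ ‖w - z‖ + ‖z - c‖ := norm_add_le _ _
      _ < r₁ := by linarith
  have hzb : z ∈ ball c r₁ := hsub (mem_closedBall_self hd0.le)
  rw [← (hG z hzb).deriv]
  have hcau := Complex.norm_deriv_le_of_forall_mem_sphere_norm_le (f := G) (c := z) (R := d)
    (C := 2 * K * r₁ / d) hd0 ((hGd.mono hsub).diffContOnCl_ball subset_rfl) (by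
      intro w hw
      have hwb := hsub (sphere_subset_closedBall hw)
      refine (hBC w hwb).trans ?_
      have hw1 : ‖w - c‖ ≤ r₁ - d := by
        rw [mem_sphere, dist_eq_norm] at hw
        calc ‖w - c‖ = ‖(w - z) + (z - c)‖ := by ring_nf
          _ ≤ ‖w - z‖ + ‖z - c‖ := norm_add_le _ _
          _ ≤ r₁ - d := by linarith
      gcongr <;> linarith)
  refine hcau.trans (le_of_eq ?_)
  rw [hd]
  have : r₁ - r ≠ 0 := by linarith
  field_simp
  ring

open Metric in
theorem exists_norm_logDeriv_sub_sum_le {r r₁ R : ℝ} (hr : 0 < r) (hr₁ : r < r₁) (hR : r₁ < R) :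
    ∃ C : ℝ, 0 < C ∧ ∀ (f : ℂ → ℂ) (c : ℂ) (M : ℝ), 1 ≤ M → AnalyticOnNhd ℂ f (closedBall c R) →
      f c ≠ 0 → (∀ z ∈ closedBall c R, ‖f z‖ ≤ M) →
      ∀ Z : Finset ℂ, (∀ ρ, ρ ∈ Z ↔ ρ ∈ closedBall c r₁ ∧ f ρ = 0) →
      (∑ ρ ∈ Z, (analyticOrderNatAt f ρ : ℝ)) ≤ C * (Real.log (M / ‖f c‖) + 1) ∧
      ∃ H : ℂ → ℂ, ContinuousOn H (closedBall c r) ∧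
      ∀ z ∈ closedBall c r, ‖H z‖ ≤ C * (Real.log (M / ‖f c‖) + 1) ∧
        (f z ≠ 0 →
        deriv f z / f z = ∑ ρ ∈ Z, (analyticOrderNatAt f ρ : ℂ) / (z - ρ) + H z) := by
  have hr₁0 : 0 < r₁ := hr.trans hr₁
  have hR0 : 0 < R := hr₁0.trans hR
  set A := 1 / Real.log (R / r₁) with hA
  have hA0 : 0 < A := one_div_pos.2 (Real.log_pos ((one_lt_div hr₁0).2 hR))
  set B := |Real.log (r₁ / (R - r₁))| with hB
  have hB0 : 0 ≤ B := abs_nonneg _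
  set D := 8 * r₁ / (r₁ - r) ^ 2 with hD
  have hD0 : 0 < D := by have : 0 < r₁ - r := by linarith
                         positivity
  refine ⟨A + D * (1 + A * B), by positivity, ?_⟩
  intro f c M hM hf hfc hfM Z hZ
  have hcR : c ∈ closedBall c R := mem_closedBall_self hR0.le
  have hfc0 : 0 < ‖f c‖ := norm_pos_iff.2 hfc
  set L := Real.log (M / ‖f c‖) with hL
  have hL0 : 0 ≤ L := Real.log_nonneg ((one_le_div hfc0).2 (hfM c hcR))
  set N := ∑ ρ ∈ Z, analyticOrderNatAt f ρ with hN
  have hNle : (N : ℝ) ≤ A * L := by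
    have := sum_analyticOrderNatAt_le hr₁0 hR hM hf hfc hfM (Z := Z) (fun ρ hρ => ((hZ ρ).1 hρ).1)
    rw [hN]; push_cast
    refine this.trans (le_of_eq ?_)
    rw [hA]; ring
  constructor
  · have : (N : ℝ) = ∑ ρ ∈ Z, (analyticOrderNatAt f ρ : ℝ) := by rw [hN]; push_cast; rfl
    rw [← this]
    calc (N : ℝ) ≤ A * L := hNle
      _ ≤ A * (L + 1) := by gcongr; linarith
      _ ≤ _ := by gcongr; nlinarith [mul_nonneg hD0.le (mul_nonneg hA0.le hB0)]
  have htop : ∀ ρ ∈ closedBall c R, analyticOrderAt f ρ ≠ ⊤ := by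
    intro ρ hρ
    refine hf.analyticOrderAt_ne_top_of_isPreconnected (convex_closedBall c R).isPreconnected
      hcR hρ ?_
    rw [(hf c hcR).analyticOrderAt_eq_zero.2 hfc]; simp
  have hZR : ∀ ρ ∈ Z, ρ ∈ closedBall c R :=
    fun ρ hρ => closedBall_subset_closedBall hR.le ((hZ ρ).1 hρ).1
  obtain ⟨h, hh, hhZ, hfh⟩ := exists_eq_prod_mul Z hf hZR (fun ρ hρ => htop ρ (hZR ρ hρ))
  have hh0 : ∀ z ∈ closedBall c r₁, h z ≠ 0 := by
    intro z hz hhz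
    by_cases hzZ : z ∈ Z
    · exact hhZ z hzZ hhz
    · apply hzZ
      rw [hZ]
      exact ⟨hz, by rw [hfh, hhz, mul_zero]⟩
  have hhd : DifferentiableOn ℂ h (closedBall c R) := hh.differentiableOn
  have hRr : 0 < R - r₁ := by linarith
  -- bound on the cofactor
  have hbd : ∀ z ∈ closedBall c R, ‖h z‖ ≤ M / (R - r₁) ^ N := by
    intro z hz
    refine Complex.norm_le_of_forall_mem_frontier_norm_le (U := ball c R) isBounded_ball
      (hhd.diffContOnCl_ball subset_rfl) ?_ (by rwa [closure_ball _ hR0.ne'])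
    intro w hw
    rw [frontier_ball _ hR0.ne'] at hw
    have hwf := hfM w (sphere_subset_closedBall hw)
    rw [hfh, norm_mul] at hwf
    rw [le_div_iff₀ (by positivity)]
    refine le_trans ?_ hwf
    rw [mul_comm]
    gcongr
    rw [norm_prod, hN, ← Finset.prod_pow_eq_pow_sum]
    refine Finset.prod_le_prod (fun _ _ => by positivity) fun ρ hρ => ?_
    rw [norm_pow]
    gcongr
    have h1 := ((hZ ρ).1 hρ).1
    rw [mem_closedBall, dist_eq_norm] at h1
    rw [mem_sphere, dist_eq_norm] at hw
    calc R - r₁ ≤ ‖w - c‖ - ‖ρ - c‖ := by linarith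
      _ ≤ ‖(w - c) - (ρ - c)‖ := norm_sub_norm_le _ _
      _ = ‖w - ρ‖ := by ring_nf
  have hcen : ‖f c‖ ≤ r₁ ^ N * ‖h c‖ := by
    rw [hfh, norm_mul]
    gcongr
    rw [norm_prod, hN, ← Finset.prod_pow_eq_pow_sum]
    refine Finset.prod_le_prod (fun _ _ => by positivity) fun ρ hρ => ?_
    rw [norm_pow]
    gcongr
    have h1 := ((hZ ρ).1 hρ).1
    rwa [mem_closedBall, dist_comm, dist_eq_norm] at h1
  set K := (L + 1) * (1 + A * B) with hK
  have hK0 : 0 < K := by positivity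
  have hratio : ∀ z ∈ closedBall c R, ‖h z‖ ≤ Real.exp K * ‖h c‖ := by
    intro z hz
    have e1 : M = Real.exp L * ‖f c‖ := by
      rw [hL, Real.exp_log (by positivity)]; field_simp
    have e2 : (r₁ / (R - r₁)) ^ N ≤ Real.exp (A * L * B) := by
      calc (r₁ / (R - r₁)) ^ N = Real.exp (N * Real.log (r₁ / (R - r₁))) := by
            rw [mul_comm, Real.exp_mul, Real.exp_log (by positivity), Real.rpow_natCast]
        _ ≤ Real.exp (A * L * B) := by
            refine Real.exp_le_exp.2 ?_
            calc (N : ℝ) * Real.log (r₁ / (R - r₁)) ≤ N * B := by gcongr; exact le_abs_self _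
              _ ≤ _ := by gcongr
    calc ‖h z‖ ≤ M / (R - r₁) ^ N := hbd z hz
      _ = Real.exp L * ‖f c‖ / (R - r₁) ^ N := by rw [e1]
      _ ≤ Real.exp L * (r₁ ^ N * ‖h c‖) / (R - r₁) ^ N := by gcongr
      _ = Real.exp L * (r₁ / (R - r₁)) ^ N * ‖h c‖ := by rw [div_pow]; ring
      _ ≤ Real.exp L * Real.exp (A * L * B) * ‖h c‖ := by gcongr
      _ ≤ Real.exp K * ‖h c‖ := by
          rw [← Real.exp_add]; gcongr; rw [hK]
          nlinarith [mul_nonneg hA0.le hB0]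
  have hsub1 : ball c r₁ ⊆ closedBall c R :=
    ball_subset_closedBall.trans (closedBall_subset_closedBall hR.le)
  have hsub2 : closedBall c r ⊆ closedBall c r₁ := closedBall_subset_closedBall hr₁.le
  refine ⟨fun z => deriv h z / h z, ?_, ?_⟩
  · intro z hz
    have hza := hh z (closedBall_subset_closedBall hR.le (hsub2 hz))
    exact (hza.deriv.continuousAt.div hza.continuousAt (hh0 z (hsub2 hz))).continuousWithinAt
  intro z hz
  constructor
  · have := norm_logDeriv_le_of_norm_le hr hr₁ hK0 (hhd.mono hsub1)
      (fun z hz => hh0 z (ball_subset_closedBall hz)) (fun z hz => hratio z (hsub1 hz)) hz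
    refine this.trans ?_
    calc 8 * K * r₁ / (r₁ - r) ^ 2 = D * (1 + A * B) * (L + 1) := by rw [hK, hD]; ring
      _ ≤ _ := by gcongr; linarith
  · intro hfz
    refine deriv_div_of_eq_prod_mul hfh
      (hh z (closedBall_subset_closedBall hR.le (hsub2 hz))).differentiableAt ?_ (hh0 z (hsub2 hz))
    rintro ρ hρ rfl
    exact hfz ((hZ z).1 hρ).2

theorem integral_div_affine_eq_log_sub {p k : ℂ} {u v : ℝ} (huv : u ≤ v)
    (h : ∀ t ∈ Set.Icc u v, p + t * k ∈ slitPlane) :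
    ∫ t in u..v, k / (p + t * k) = Complex.log (p + v * k) - Complex.log (p + u * k) := by
  rw [← Set.uIcc_of_le huv] at h
  refine intervalIntegral.integral_eq_sub_of_hasDerivAt (f := fun t : ℝ => Complex.log (p + t * k))
    (fun t ht => ?_) ?_
  · have h1 : HasDerivAt (fun t : ℝ => p + (t : ℂ) * k) k t := by
      simpa using ((hasDerivAt_id t).ofReal_comp.mul_const k).const_add p
    exact h1.clog_real (h t ht)
  · refine ContinuousOn.intervalIntegrable ?_
    refine continuousOn_const.div (by fun_prop) fun t ht => slitPlane_ne_zero (h t ht)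

/-- The boundary integral over the rectangle with sides `re = a`, `re = b`, `im = u`, `im = v`. -/
noncomputable def rectIntegral (F : ℂ → ℂ) (a b u v : ℝ) : ℂ :=
  (∫ x : ℝ in a..b, F (x + u * I)) - (∫ x : ℝ in a..b, F (x + v * I)) +
    I * (∫ y : ℝ in u..v, F (b + y * I)) - I * (∫ y : ℝ in u..v, F (a + y * I))

/-- The boundary of a rectangle. -/
def rectBoundary (a b u v : ℝ) : Set ℂ :=
  {s | s.re ∈ Set.Icc a b ∧ s.im ∈ Set.Icc u v ∧ (s.re = a ∨ s.re = b ∨ s.im = u ∨ s.im = v)}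

theorem log_sub_log_neg_of_im_pos {z : ℂ} (hz : 0 < z.im) :
    Complex.log z - Complex.log (-z) = Real.pi * I := by
  rw [Complex.log, Complex.log, norm_neg, arg_neg_eq_arg_sub_pi_of_im_pos hz]
  push_cast; ring

theorem log_sub_log_neg_of_im_neg {z : ℂ} (hz : z.im < 0) :
    Complex.log z - Complex.log (-z) = -(Real.pi * I) := by
  rw [Complex.log, Complex.log, norm_neg, arg_neg_eq_arg_add_pi_of_im_neg hz]
  push_cast; ring

theorem rectIntegral_inv_sub {a b u v : ℝ} {ρ : ℂ} (ha : a < ρ.re) (hb : ρ.re < b)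
    (hu : u < ρ.im) (hv : ρ.im < v) :
    rectIntegral (fun s => 1 / (s - ρ)) a b u v = 2 * Real.pi * I := by
  have hab : a ≤ b := (ha.trans hb).le
  have huv : u ≤ v := (hu.trans hv).le
  have bot := integral_div_affine_eq_log_sub (p := u * I - ρ) (k := 1) hab (by
    intro t _; right; simp; linarith)
  have top := integral_div_affine_eq_log_sub (p := v * I - ρ) (k := 1) hab (by
    intro t _; right; simp; linarith)
  have right := integral_div_affine_eq_log_sub (p := b - ρ) (k := I) huv (by
    intro t _; left; simp; linarith)
  have left := integral_div_affine_eq_log_sub (p := ρ - a) (k := -I) huv (by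
    intro t _; left; simp; linarith)
  have e1 : ∫ x : ℝ in a..b, 1 / ((x : ℂ) + u * I - ρ) =
      ∫ t in a..b, 1 / (u * I - ρ + (t : ℂ) * 1) := by
    congr 1; ext x; congr 1; ring
  have e2 : ∫ x : ℝ in a..b, 1 / ((x : ℂ) + v * I - ρ) =
      ∫ t in a..b, 1 / (v * I - ρ + (t : ℂ) * 1) := by
    congr 1; ext x; congr 1; ring
  have e3 : I * ∫ y : ℝ in u..v, 1 / ((b : ℂ) + y * I - ρ) =
      ∫ t in u..v, I / (b - ρ + (t : ℂ) * I) := by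
    rw [← intervalIntegral.integral_const_mul]
    congr 1; ext x; rw [mul_one_div]; congr 1; ring
  have e4 : I * ∫ y : ℝ in u..v, 1 / ((a : ℂ) + y * I - ρ) =
      ∫ t in u..v, -I / (ρ - a + (t : ℂ) * -I) := by
    rw [← intervalIntegral.integral_const_mul]
    congr 1; ext x
    rw [mul_one_div, show ρ - a + (x : ℂ) * -I = -(a + x * I - ρ) by ring, neg_div_neg_eq]
  rw [rectIntegral, e1, e2, e3, e4, bot, top, right, left]
  have c1 := log_sub_log_neg_of_im_pos (z := a + v * I - ρ) (by simp; linarith)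
  have c2 := log_sub_log_neg_of_im_neg (z := a + u * I - ρ) (by simp; linarith)
  have r1 : -((a : ℂ) + v * I - ρ) = ρ - a + v * -I := by ring
  have r2 : -((a : ℂ) + u * I - ρ) = ρ - a + u * -I := by ring
  rw [r1] at c1
  rw [r2] at c2
  have s1 : (u : ℂ) * I - ρ + b * 1 = b - ρ + u * I := by ring
  have s2 : (v : ℂ) * I - ρ + b * 1 = b - ρ + v * I := by ring
  have s3 : (u : ℂ) * I - ρ + a * 1 = a + u * I - ρ := by ring
  have s4 : (v : ℂ) * I - ρ + a * 1 = a + v * I - ρ := by ring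
  rw [s1, s2, s3, s4]
  linear_combination c1 - c2

section rectangle

variable {a b u v : ℝ} {F G : ℂ → ℂ}

theorem bottom_mem_rectBoundary (hab : a ≤ b) (huv : u ≤ v) {x : ℝ} (hx : x ∈ Set.uIcc a b) :
    (x + u * I : ℂ) ∈ rectBoundary a b u v := by
  rw [Set.uIcc_of_le hab] at hx
  simp only [rectBoundary, Set.mem_ofPred_eq]
  simp [hx.1, hx.2, huv]

theorem top_mem_rectBoundary (hab : a ≤ b) (huv : u ≤ v) {x : ℝ} (hx : x ∈ Set.uIcc a b) :
    (x + v * I : ℂ) ∈ rectBoundary a b u v := by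
  rw [Set.uIcc_of_le hab] at hx
  simp only [rectBoundary, Set.mem_ofPred_eq]
  simp [hx.1, hx.2, huv]

theorem right_mem_rectBoundary (hab : a ≤ b) (huv : u ≤ v) {y : ℝ} (hy : y ∈ Set.uIcc u v) :
    (b + y * I : ℂ) ∈ rectBoundary a b u v := by
  rw [Set.uIcc_of_le huv] at hy
  simp only [rectBoundary, Set.mem_ofPred_eq]
  simp [hy.1, hy.2, hab]

theorem left_mem_rectBoundary (hab : a ≤ b) (huv : u ≤ v) {y : ℝ} (hy : y ∈ Set.uIcc u v) :
    (a + y * I : ℂ) ∈ rectBoundary a b u v := by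
  rw [Set.uIcc_of_le huv] at hy
  simp only [rectBoundary, Set.mem_ofPred_eq]
  simp [hy.1, hy.2, hab]

theorem rectIntegral_congr (hab : a ≤ b) (huv : u ≤ v)
    (h : ∀ s ∈ rectBoundary a b u v, F s = G s) :
    rectIntegral F a b u v = rectIntegral G a b u v := by
  unfold rectIntegral
  rw [intervalIntegral.integral_congr fun x hx => h _ (bottom_mem_rectBoundary hab huv hx),
    intervalIntegral.integral_congr fun x hx => h _ (top_mem_rectBoundary hab huv hx),
    intervalIntegral.integral_congr fun x hx => h _ (right_mem_rectBoundary hab huv hx),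
    intervalIntegral.integral_congr fun x hx => h _ (left_mem_rectBoundary hab huv hx)]

theorem rectIntegral_add (hab : a ≤ b) (huv : u ≤ v) (hF : ContinuousOn F (rectBoundary a b u v))
    (hG : ContinuousOn G (rectBoundary a b u v)) :
    rectIntegral (fun s => F s + G s) a b u v =
      rectIntegral F a b u v + rectIntegral G a b u v := by
  unfold rectIntegral
  have key : ∀ {H : ℂ → ℂ}, ContinuousOn H (rectBoundary a b u v) →
      IntervalIntegrable (fun x : ℝ => H (x + u * I)) MeasureTheory.volume a b ∧
      IntervalIntegrable (fun x : ℝ => H (x + v * I)) MeasureTheory.volume a b ∧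
      IntervalIntegrable (fun y : ℝ => H (b + y * I)) MeasureTheory.volume u v ∧
      IntervalIntegrable (fun y : ℝ => H (a + y * I)) MeasureTheory.volume u v := by
    intro H hH
    refine ⟨?_, ?_, ?_, ?_⟩ <;> refine ContinuousOn.intervalIntegrable ?_
    · exact hH.comp (by fun_prop) fun x hx => bottom_mem_rectBoundary hab huv hx
    · exact hH.comp (by fun_prop) fun x hx => top_mem_rectBoundary hab huv hx
    · exact hH.comp (by fun_prop) fun x hx => right_mem_rectBoundary hab huv hx
    · exact hH.comp (by fun_prop) fun x hx => left_mem_rectBoundary hab huv hx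
  obtain ⟨f1, f2, f3, f4⟩ := key hF
  obtain ⟨g1, g2, g3, g4⟩ := key hG
  rw [intervalIntegral.integral_add f1 g1, intervalIntegral.integral_add f2 g2,
    intervalIntegral.integral_add f3 g3, intervalIntegral.integral_add f4 g4]
  ring

theorem rectIntegral_const_mul (c : ℂ) :
    rectIntegral (fun s => c * F s) a b u v = c * rectIntegral F a b u v := by
  unfold rectIntegral
  simp only [intervalIntegral.integral_const_mul]
  ring

theorem rectIntegral_sum (hab : a ≤ b) (huv : u ≤ v) {ι : Type*} (Z : Finset ι) (f : ι → ℂ → ℂ)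
    (h : ∀ i ∈ Z, ContinuousOn (f i) (rectBoundary a b u v)) :
    rectIntegral (fun s => ∑ i ∈ Z, f i s) a b u v = ∑ i ∈ Z, rectIntegral (f i) a b u v := by
  induction Z using Finset.induction_on with
  | empty => simp [rectIntegral]
  | insert i Z hi ih =>
    simp only [Finset.sum_insert hi]
    rw [rectIntegral_add hab huv (h i (by simp))
      (continuousOn_finsetSum _ fun j hj => h j (by simp [hj])), ih fun j hj => h j (by simp [hj])]

/-- Weighted argument principle on a rectangle. -/
theorem rectIntegral_mul_logDeriv (hab : a < b) (huv : u < v) {f g : ℂ → ℂ}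
    (hg : Differentiable ℂ g)
    (hf : AnalyticOnNhd ℂ f (Set.Icc a b ×ℂ Set.Icc u v)) {Z : Finset ℂ}
    (hZ : ∀ ρ, ρ ∈ Z ↔ ρ ∈ Set.Icc a b ×ℂ Set.Icc u v ∧ f ρ = 0)
    (hZi : ∀ ρ ∈ Z, (a < ρ.re ∧ ρ.re < b) ∧ u < ρ.im ∧ ρ.im < v)
    (htop : ∀ ρ ∈ Z, analyticOrderAt f ρ ≠ ⊤) :
    rectIntegral (fun s => g s * (deriv f s / f s)) a b u v =
      2 * Real.pi * I * ∑ ρ ∈ Z, (analyticOrderNatAt f ρ : ℂ) * g ρ := by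
  set K := Set.Icc a b ×ℂ Set.Icc u v with hK
  obtain ⟨h, hh, hhZ, hfh⟩ := exists_eq_prod_mul Z hf (fun ρ hρ => ((hZ ρ).1 hρ).1) htop
  have hh0 : ∀ z ∈ K, h z ≠ 0 := by
    intro z hz hhz
    by_cases hzZ : z ∈ Z
    · exact hhZ z hzZ hhz
    · apply hzZ
      rw [hZ]
      exact ⟨hz, by rw [hfh, hhz, mul_zero]⟩
  have hbK : rectBoundary a b u v ⊆ K := fun s hs => ⟨hs.1, hs.2.1⟩
  have hbZ : ∀ s ∈ rectBoundary a b u v, ∀ ρ ∈ Z, s ≠ ρ := by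
    rintro s hs ρ hρ rfl
    obtain ⟨⟨h1, h2⟩, h3, h4⟩ := hZi s hρ
    rcases hs.2.2 with h | h | h | h <;> linarith
  set Φ : ℂ → ℂ := fun s => g s * (deriv h s / h s) +
    ∑ ρ ∈ Z, (analyticOrderNatAt f ρ : ℂ) * dslope g ρ s with hΦ
  have hds : ∀ ρ, Differentiable ℂ (dslope g ρ) := fun ρ =>
    differentiableOn_univ.1 ((Complex.differentiableOn_dslope Filter.univ_mem).2
      hg.differentiableOn)
  have hΦd : DifferentiableOn ℂ Φ K := by
    intro s hs
    have h1 : DifferentiableAt ℂ (deriv h) s := (hh s hs).deriv.differentiableAt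
    have h2 : DifferentiableAt ℂ h s := (hh s hs).differentiableAt
    refine DifferentiableAt.differentiableWithinAt ?_
    refine ((hg s).mul (h1.div h2 (hh0 s hs))).add ?_
    exact DifferentiableAt.fun_sum fun ρ _ => (hds ρ s).const_mul _
  have heq : ∀ s ∈ rectBoundary a b u v, g s * (deriv f s / f s) =
      Φ s + ∑ ρ ∈ Z, ((analyticOrderNatAt f ρ : ℂ) * g ρ) * (1 / (s - ρ)) := by
    intro s hs
    rw [deriv_div_of_eq_prod_mul hfh (hh s (hbK hs)).differentiableAt (hbZ s hs)
      (hh0 s (hbK hs)), hΦ]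
    simp only
    rw [add_assoc, ← Finset.sum_add_distrib, mul_add, add_comm, Finset.mul_sum]
    congr 1
    refine Finset.sum_congr rfl fun ρ hρ => ?_
    have hne := hbZ s hs ρ hρ
    have hne' := sub_ne_zero.2 hne
    rw [dslope_of_ne _ hne, slope_def_field]
    field_simp
    ring
  have hcont : ∀ ρ ∈ Z, ContinuousOn
      (fun s => ((analyticOrderNatAt f ρ : ℂ) * g ρ) * (1 / (s - ρ))) (rectBoundary a b u v) := by
    intro ρ hρ
    refine continuousOn_const.mul (continuousOn_const.div (by fun_prop) fun s hs => ?_)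
    exact sub_ne_zero.2 (hbZ s hs ρ hρ)
  rw [rectIntegral_congr hab.le huv.le heq, rectIntegral_add hab.le huv.le
    (hΦd.continuousOn.mono hbK) (continuousOn_finsetSum _ hcont),
    rectIntegral_sum hab.le huv.le _ _ hcont]
  have hΦ0 : rectIntegral Φ a b u v = 0 := by
    have := Complex.integral_boundary_rect_eq_zero_of_differentiableOn Φ (a + u * I) (b + v * I) (by
      simpa [Set.uIcc_of_le hab.le, Set.uIcc_of_le huv.le] using hΦd)
    simpa [rectIntegral] using this
  rw [hΦ0, zero_add, Finset.mul_sum]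
  refine Finset.sum_congr rfl fun ρ hρ => ?_
  obtain ⟨⟨h1, h2⟩, h3, h4⟩ := hZi ρ hρ
  rw [rectIntegral_const_mul, rectIntegral_inv_sub h1 h2 h3 h4]
  ring

end rectangle

/-- The error of the trapezoidal rule for `u ↦ u ^ (-s)` on `[n + 1, n + 2]`. -/
noncomputable def zetaTrapezoidError (n : ℕ) (s : ℂ) : ℂ :=
  (((n + 1 : ℝ) : ℂ) ^ (-s) + ((n + 2 : ℝ) : ℂ) ^ (-s)) / 2 -
    (((n + 2 : ℝ) : ℂ) ^ (1 - s) - ((n + 1 : ℝ) : ℂ) ^ (1 - s)) / (1 - s)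

theorem hasDerivAt_ofReal_add_cpow {a v : ℝ} (h : 0 < a + v) (r : ℂ) :
    HasDerivAt (fun v : ℝ => ((a + v : ℝ) : ℂ) ^ r) (r * ((a + v : ℝ) : ℂ) ^ (r - 1)) v := by
  have h1 : HasDerivAt (fun z : ℂ => z ^ r) (r * ((a + v : ℝ) : ℂ) ^ (r - 1)) ((a + v : ℝ) : ℂ) := by
    simpa using (hasDerivAt_id ((a + v : ℝ) : ℂ)).cpow_const (c := r)
      (Or.inl (by simpa using h))
  have h2 : HasDerivAt (fun v : ℝ => ((a + v : ℝ) : ℂ)) 1 v := by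
    have := ((hasDerivAt_id v).const_add a).ofReal_comp
    simpa using this
  have := h1.comp v h2
  rw [mul_one] at this
  exact this

theorem norm_zetaTrapezoidError_le (n : ℕ) {s : ℂ} (hs : s ≠ 1) (hre : -2 ≤ s.re) :
    ‖zetaTrapezoidError n s‖ ≤ ‖s‖ * ‖s + 1‖ * (n + 1 : ℝ) ^ (-s.re - 2) := by
  have hs' : 1 - s ≠ 0 := sub_ne_zero.2 hs.symm
  set a : ℝ := n + 1 with ha
  have ha0 : 0 < a := by positivity
  set f : ℝ → ℂ := fun v => ((a + v : ℝ) : ℂ) ^ (-s) with hf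
  set f' : ℝ → ℂ := fun v => (-s) * ((a + v : ℝ) : ℂ) ^ (-s - 1) with hf'
  set f'' : ℝ → ℂ := fun v => (-s) * ((-s - 1) * ((a + v : ℝ) : ℂ) ^ (-s - 1 - 1)) with hf''
  set P : ℝ → ℂ := fun v => ((a + v : ℝ) : ℂ) ^ (1 - s) / (1 - s) with hP
  have hpos : ∀ v ∈ Set.Icc (0 : ℝ) 1, 0 < a + v := fun v hv => by linarith [hv.1]
  have d1 : ∀ v ∈ Set.Icc (0 : ℝ) 1, HasDerivAt f (f' v) v := fun v hv =>
    hasDerivAt_ofReal_add_cpow (hpos v hv) _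
  have d2 : ∀ v ∈ Set.Icc (0 : ℝ) 1, HasDerivAt f' (f'' v) v := fun v hv =>
    (hasDerivAt_ofReal_add_cpow (hpos v hv) _).const_mul _
  have d3 : ∀ v ∈ Set.Icc (0 : ℝ) 1, HasDerivAt P (f v) v := fun v hv => by
    have := (hasDerivAt_ofReal_add_cpow (hpos v hv) (1 - s)).div_const (1 - s)
    rw [mul_div_cancel_left₀ _ hs', show 1 - s - 1 = -s by ring] at this
    exact this
  set M : ℝ := ‖s‖ * ‖s + 1‖ * a ^ (-s.re - 2) with hM
  have hM0 : 0 ≤ M := by positivity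
  have b2 : ∀ v ∈ Set.Icc (0 : ℝ) 1, ‖f'' v‖ ≤ M := fun v hv => by
    have : ‖((a + v : ℝ) : ℂ) ^ (-s - 1 - 1)‖ ≤ a ^ (-s.re - 2) := by
      rw [norm_cpow_eq_rpow_re_of_pos (hpos v hv)]
      rw [show (-s - 1 - 1).re = -s.re - 2 by simp; ring]
      exact Real.rpow_le_rpow_of_nonpos ha0 (by linarith [hv.1]) (by linarith)
    rw [hf'']
    simp only [norm_mul, norm_neg]
    rw [show -s - 1 = -(s + 1) by ring, norm_neg, ← mul_assoc, hM]
    rw [show -(s + 1) - 1 = -s - 1 - 1 by ring]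
    gcongr
  set E' : ℝ → ℂ := fun v => (f 0 + f v) / 2 + v * f' v / 2 - f v with hE'
  set E : ℝ → ℂ := fun v => v * (f 0 + f v) / 2 - (P v - P 0) with hE
  have dE' : ∀ v ∈ Set.Icc (0 : ℝ) 1, HasDerivAt E' (v * f'' v / 2) v := fun v hv => by
    have hv' := (hasDerivAt_id v).ofReal_comp
    have := ((((d1 v hv).const_add (f 0)).div_const 2).add
      ((hv'.mul (d2 v hv)).div_const 2)).sub (d1 v hv)
    refine this.congr_deriv ?_
    simp only [id, ofReal_one]
    ring
  have dE : ∀ v ∈ Set.Icc (0 : ℝ) 1, HasDerivAt E (E' v) v := fun v hv => by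
    have hv' := (hasDerivAt_id v).ofReal_comp
    have := ((hv'.mul ((d1 v hv).const_add (f 0))).div_const 2).sub ((d3 v hv).sub_const (P 0))
    refine this.congr_deriv ?_
    simp only [hE', id, ofReal_one]
    ring
  have bE' : ∀ v ∈ Set.Icc (0 : ℝ) 1, ‖E' v‖ ≤ M := fun v hv => by
    have key := norm_image_sub_le_of_norm_deriv_le_segment' (f := E') (f' := fun v => v * f'' v / 2)
      (a := 0) (b := 1) (C := M) (fun x hx => (dE' x hx).hasDerivWithinAt)
      (fun x hx => by
        rw [norm_div, norm_mul, norm_real, Real.norm_of_nonneg hx.1]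
        have := b2 x ⟨hx.1, hx.2.le⟩
        have h2 : x * ‖f'' x‖ ≤ 1 * M := by
          apply mul_le_mul hx.2.le this (norm_nonneg _) zero_le_one
        norm_num
        linarith) v hv
    have h0 : E' 0 = 0 := by simp [hE']
    rw [h0, sub_zero, sub_zero] at key
    exact key.trans (mul_le_of_le_one_right hM0 hv.2)
  have bE := norm_image_sub_le_of_norm_deriv_le_segment' (f := E) (f' := E')
      (a := 0) (b := 1) (C := M) (fun x hx => (dE x hx).hasDerivWithinAt)
      (fun x hx => bE' x ⟨hx.1, hx.2.le⟩) 1 (by simp)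
  have h0 : E 0 = 0 := by simp [hE]
  rw [h0, sub_zero] at bE
  have h1 : E 1 = zetaTrapezoidError n s := by
    simp only [hE, hf, hP, zetaTrapezoidError, ha]
    have : ((n : ℝ) + 1 + 1) = n + 2 := by ring
    rw [this]
    simp only [add_zero, ofReal_one, one_mul]
    ring
  rw [h1] at bE
  simpa using bE

theorem summable_nat_add_one_rpow {p : ℝ} (hp : p < -1) :
    Summable (fun n : ℕ => (n + 1 : ℝ) ^ p) := by
  have := (summable_nat_add_iff 1).2 (Real.summable_nat_rpow.2 hp)
  simpa using this

theorem differentiableAt_zetaTrapezoidError (n : ℕ) {s : ℂ} (hs : s ≠ 1) :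
    DifferentiableAt ℂ (zetaTrapezoidError n) s := by
  have hs' : 1 - s ≠ 0 := sub_ne_zero.2 hs.symm
  have h1 : ((n + 1 : ℝ) : ℂ) ≠ 0 := ofReal_ne_zero.2 (by positivity)
  have h2 : ((n + 2 : ℝ) : ℂ) ≠ 0 := ofReal_ne_zero.2 (by positivity)
  unfold zetaTrapezoidError
  have d : DifferentiableAt ℂ (fun s : ℂ => 1 - s) s := by fun_prop
  have d' : DifferentiableAt ℂ (fun s : ℂ => -s) s := by fun_prop
  exact (((d'.const_cpow (Or.inl h1)).add (d'.const_cpow (Or.inl h2))).div_const 2).sub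
    (((d.const_cpow (Or.inl h2)).sub (d.const_cpow (Or.inl h1))).div d hs')

theorem riemannZeta_eq_tsum_zetaTrapezoidError_of_one_lt_re {s : ℂ} (hs : 1 < s.re) :
    riemannZeta s = 1 / 2 + 1 / (s - 1) + ∑' n, zetaTrapezoidError n s := by
  have hs1 : s ≠ 1 := by rintro rfl; simp at hs
  have hs' : 1 - s ≠ 0 := sub_ne_zero.2 hs1.symm
  have hs'' : s - 1 ≠ 0 := sub_ne_zero.2 hs1
  have hsum : Summable (fun n => zetaTrapezoidError n s) :=
    Summable.of_norm_bounded ((summable_nat_add_one_rpow (by linarith)).mul_left _)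
      (fun n => norm_zetaTrapezoidError_le n hs1 (by linarith))
  have hz : HasSum (fun n : ℕ => ((n + 1 : ℝ) : ℂ) ^ (-s)) (riemannZeta s) := by
    rw [zeta_eq_tsum_one_div_nat_add_one_cpow hs]
    have : Summable (fun n : ℕ => 1 / ((n : ℂ) + 1) ^ s) := by
      have := (summable_nat_add_iff 1).2 (Complex.summable_one_div_nat_cpow.2 hs)
      simpa using this
    convert this.hasSum using 2 with n
    rw [cpow_neg]; simp
  have hz2 : HasSum (fun n : ℕ => ((n + 2 : ℝ) : ℂ) ^ (-s)) (riemannZeta s - 1) := by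
    have := (hasSum_nat_add_iff' 1).2 hz
    simp only [Finset.range_one, Finset.sum_singleton, Nat.cast_zero, zero_add, ofReal_one,
      one_cpow] at this
    convert this using 3 with n
    congr 1
    push_cast; ring
  have lim1 : Filter.Tendsto (fun N : ℕ => ((N + 1 : ℝ) : ℂ) ^ (1 - s)) Filter.atTop (nhds 0) := by
    rw [tendsto_zero_iff_norm_tendsto_zero]
    have h : ∀ N : ℕ, ‖((N + 1 : ℝ) : ℂ) ^ (1 - s)‖ = (N + 1 : ℝ) ^ (-(s.re - 1)) := fun N => by
      rw [norm_cpow_eq_rpow_re_of_pos (by positivity)]; congr 1; simp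
    simp_rw [h]
    have := (tendsto_rpow_neg_atTop (sub_pos.2 hs)).comp
      (Filter.tendsto_atTop_add_const_right _ (1 : ℝ) tendsto_natCast_atTop_atTop)
    exact this
  have hps : ∀ N : ℕ, ∑ n ∈ Finset.range N, zetaTrapezoidError n s =
      (∑ n ∈ Finset.range N, ((n + 1 : ℝ) : ℂ) ^ (-s) +
        ∑ n ∈ Finset.range N, ((n + 2 : ℝ) : ℂ) ^ (-s)) / 2 -
        (((N + 1 : ℝ) : ℂ) ^ (1 - s) - 1) / (1 - s) := fun N => by
    simp only [zetaTrapezoidError]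
    rw [Finset.sum_sub_distrib, ← Finset.sum_div, ← Finset.sum_div, Finset.sum_add_distrib]
    congr 2
    have := Finset.sum_range_sub (fun n : ℕ => ((n + 1 : ℝ) : ℂ) ^ (1 - s)) N
    simp only [Nat.cast_zero, zero_add, ofReal_one, one_cpow] at this
    rw [← this]
    refine Finset.sum_congr rfl fun n _ => ?_
    simp only [Nat.cast_add, Nat.cast_one]
    rw [show (n : ℝ) + 1 + 1 = n + 2 by ring]
  have l1 := hsum.hasSum.tendsto_sum_nat
  simp_rw [hps] at l1
  have l2 := ((hz.tendsto_sum_nat.add hz2.tendsto_sum_nat).div_const 2).sub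
    ((lim1.sub_const 1).div_const (1 - s))
  rw [tendsto_nhds_unique l1 l2]
  field_simp
  ring

theorem riemannZeta_eq_tsum_zetaTrapezoidError {s : ℂ} (hs : -1 / 2 ≤ s.re) (him : 0 < s.im) :
    riemannZeta s = 1 / 2 + 1 / (s - 1) + ∑' n, zetaTrapezoidError n s := by
  set U : Set ℂ := {z | -3 / 4 < z.re} ∩ {z | 0 < z.im} with hU
  have hUo : IsOpen U :=
    (isOpen_lt continuous_const continuous_re).inter (isOpen_lt continuous_const continuous_im)
  have hUc : Convex ℝ U := (convex_halfSpace_re_gt _).inter (convex_halfSpace_im_gt _)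
  have hne : ∀ z ∈ U, z ≠ 1 := by
    rintro z ⟨_, hz⟩ rfl
    simp at hz
  have hdiff : ∀ z ∈ U, DifferentiableAt ℂ (fun s => ∑' n, zetaTrapezoidError n s) z := by
    intro z hz
    set V := U ∩ Metric.ball 0 (‖z‖ + 1) with hV
    have hVo : IsOpen V := hUo.inter Metric.isOpen_ball
    have hzV : z ∈ V := ⟨hz, by simp⟩
    have := differentiableOn_tsum_of_summable_norm (F := fun n s => zetaTrapezoidError n s)
      (u := fun n : ℕ => ((‖z‖ + 1) * (‖z‖ + 2)) * (n + 1 : ℝ) ^ (-5 / 4 : ℝ)) (U := V)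
      ((summable_nat_add_one_rpow (by norm_num)).mul_left _)
      (fun n w hw => (differentiableAt_zetaTrapezoidError n (hne w hw.1)).differentiableWithinAt)
      hVo (fun n w hw => by
        have h1 : -3 / 4 < w.re := hw.1.1
        have h2 : ‖w‖ < ‖z‖ + 1 := by simpa using hw.2
        have h3 : ‖w + 1‖ ≤ ‖z‖ + 2 := by
          have := norm_add_le w 1
          simp at this; linarith
        refine (norm_zetaTrapezoidError_le n (hne w hw.1) (by linarith)).trans ?_
        have h4 : (n + 1 : ℝ) ^ (-w.re - 2) ≤ (n + 1 : ℝ) ^ (-5 / 4 : ℝ) :=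
          Real.rpow_le_rpow_of_exponent_le (by linarith [n.cast_nonneg (α := ℝ)]) (by linarith)
        gcongr)
    exact this.differentiableAt (hVo.mem_nhds hzV)
  have hA : AnalyticOnNhd ℂ riemannZeta U := fun z hz => analyticAt_riemannZeta (hne z hz)
  have hB : AnalyticOnNhd ℂ
      (fun s => 1 / 2 + 1 / (s - 1) + ∑' n, zetaTrapezoidError n s) U := by
    refine DifferentiableOn.analyticOnNhd (fun z hz => ?_) hUo
    refine DifferentiableAt.differentiableWithinAt ?_
    refine DifferentiableAt.add (DifferentiableAt.const_add _ ?_) (hdiff z hz)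
    exact (differentiableAt_const _).div (by fun_prop) (sub_ne_zero.2 (hne z hz))
  have h0 : (2 + I : ℂ) ∈ U := by
    constructor <;> norm_num
  refine hA.eqOn_of_preconnected_of_eventuallyEq hB hUc.isPreconnected h0 ?_
    (show s ∈ U from ⟨show -3 / 4 < s.re by linarith, him⟩)
  have : {z : ℂ | 1 < z.re} ∈ nhds (2 + I : ℂ) :=
    (isOpen_lt continuous_const continuous_re).mem_nhds (by simp)
  filter_upwards [this] with z hz
  exact riemannZeta_eq_tsum_zetaTrapezoidError_of_one_lt_re hz

/-- A polynomial bound for `ζ` in the half-plane `Re s ≥ -1/2`. -/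
theorem exists_norm_riemannZeta_le :
    ∃ C : ℝ, 0 < C ∧ ∀ s : ℂ, -1 / 2 ≤ s.re → 1 ≤ s.im → ‖riemannZeta s‖ ≤ C * ‖s‖ ^ 2 := by
  have hsum := summable_nat_add_one_rpow (p := -3 / 2) (by norm_num)
  set S := ∑' n : ℕ, (n + 1 : ℝ) ^ (-3 / 2 : ℝ) with hS
  have hS0 : 0 ≤ S := tsum_nonneg fun n => by positivity
  refine ⟨2 + 2 * S, by positivity, fun s hs him => ?_⟩
  have hs1 : s ≠ 1 := by rintro rfl; simp at him; linarith
  have hn : 1 ≤ ‖s‖ := him.trans ((le_abs_self _).trans (abs_im_le_norm s))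
  have hn1 : 1 ≤ ‖s - 1‖ := by
    have := abs_im_le_norm (s - 1)
    simp at this
    exact him.trans ((le_abs_self _).trans this)
  rw [riemannZeta_eq_tsum_zetaTrapezoidError hs (by linarith)]
  have hb : ∀ n : ℕ, ‖zetaTrapezoidError n s‖ ≤ ‖s‖ * ‖s + 1‖ * (n + 1 : ℝ) ^ (-3 / 2 : ℝ) :=
    fun n => by
      refine (norm_zetaTrapezoidError_le n hs1 (by linarith)).trans ?_
      have h4 : (n + 1 : ℝ) ^ (-s.re - 2) ≤ (n + 1 : ℝ) ^ (-3 / 2 : ℝ) :=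
        Real.rpow_le_rpow_of_exponent_le (by linarith [n.cast_nonneg (α := ℝ)]) (by linarith)
      gcongr
  have h1 : ‖∑' n, zetaTrapezoidError n s‖ ≤ ‖s‖ * ‖s + 1‖ * S := by
    rw [hS, ← tsum_mul_left]
    exact tsum_of_norm_bounded (hsum.mul_left _).hasSum hb
  have h2 : ‖s + 1‖ ≤ 2 * ‖s‖ := by
    have := norm_add_le s 1
    simp at this; linarith
  have h3 : ‖1 / (s - 1)‖ ≤ 1 := by
    rw [norm_div, norm_one]; exact (div_le_one (by linarith)).2 hn1
  have h4 : ‖(1 / 2 : ℂ)‖ = 1 / 2 := by norm_num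
  calc _ ≤ ‖(1 / 2 : ℂ)‖ + ‖1 / (s - 1)‖ + ‖∑' n, zetaTrapezoidError n s‖ := norm_add₃_le
    _ ≤ 1 / 2 + 1 + ‖s‖ * (2 * ‖s‖) * S := by
        rw [h4]; refine add_le_add (add_le_add le_rfl h3) (h1.trans ?_); gcongr
    _ ≤ _ := by nlinarith

theorem one_third_le_norm_riemannZeta {s : ℂ} (hs : s.re = 2) : 1 / 3 ≤ ‖riemannZeta s‖ := by
  have h1 : 1 < s.re := by linarith
  have hs2 : Summable (fun n : ℕ => 1 / ((n : ℂ) + 1) ^ s) := by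
    have := (summable_nat_add_iff 1).2 (Complex.summable_one_div_nat_cpow.2 h1)
    simpa using this
  have e1 : riemannZeta s - 1 = ∑' n : ℕ, 1 / ((n : ℂ) + 1 + 1) ^ s := by
    rw [zeta_eq_tsum_one_div_nat_add_one_cpow h1, hs2.tsum_eq_zero_add]
    simp
  have h2 : HasSum (fun n : ℕ => 1 / ((n : ℝ) + 1 + 1) ^ 2) (Real.pi ^ 2 / 6 - 1) := by
    have := (hasSum_nat_add_iff' 2).2 hasSum_zeta_two
    simp only [Finset.sum_range_succ, Finset.sum_range_zero] at this
    norm_num at this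
    simpa [add_assoc, one_add_one_eq_two] using this
  have h3 : ‖riemannZeta s - 1‖ ≤ Real.pi ^ 2 / 6 - 1 := by
    rw [e1]
    refine tsum_of_norm_bounded h2 fun n => ?_
    have : ((n : ℂ) + 1 + 1) = ((n + 1 + 1 : ℝ) : ℂ) := by push_cast; ring
    rw [norm_div, norm_one, this, norm_cpow_eq_rpow_re_of_pos (by positivity), hs]
    norm_cast
  have h4 : Real.pi ^ 2 / 6 - 1 ≤ 2 / 3 := by nlinarith [Real.pi_lt_d2, Real.pi_pos]
  have h5 : ‖(1 : ℂ)‖ ≤ ‖riemannZeta s‖ + ‖riemannZeta s - 1‖ := by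
    have := norm_sub_le (riemannZeta s) (riemannZeta s - 1)
    simpa using this
  simp at h5
  linarith

/-- Local partial fraction decomposition of `ζ'/ζ` near height `T`. -/
theorem exists_logDeriv_riemannZeta_decomposition :
    ∃ C : ℝ, 0 < C ∧ ∀ T : ℝ, 5 ≤ T → ∃ Z : Finset ℂ,
      (∀ ρ, ρ ∈ Z ↔ ρ ∈ Metric.closedBall (2 + T * I) 2.2 ∧ riemannZeta ρ = 0) ∧
      (∑ ρ ∈ Z, (analyticOrderNatAt riemannZeta ρ : ℝ)) ≤ C * Real.log T ∧
      ∃ H : ℂ → ℂ, ContinuousOn H (Metric.closedBall (2 + T * I) 2.1) ∧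
        ∀ z ∈ Metric.closedBall (2 + T * I : ℂ) 2.1, ‖H z‖ ≤ C * Real.log T ∧
          (riemannZeta z ≠ 0 → deriv riemannZeta z / riemannZeta z =
            ∑ ρ ∈ Z, (analyticOrderNatAt riemannZeta ρ : ℂ) / (z - ρ) + H z) := by
  obtain ⟨C₁, hC₁, h1⟩ := exists_norm_logDeriv_sub_sum_le (r := 2.1) (r₁ := 2.2) (R := 2.4)
    (by norm_num) (by norm_num) (by norm_num)
  obtain ⟨C₂, hC₂, h2⟩ := exists_norm_riemannZeta_le
  set K := max 1 (Real.log (C₂ * 12)) + 1 with hK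
  have hK1 : 1 ≤ max 1 (Real.log (C₂ * 12)) := le_max_left _ _
  refine ⟨C₁ * (K + 3), by positivity, fun T hT => ?_⟩
  have hlogT : 1 ≤ Real.log T := by
    rw [Real.le_log_iff_exp_le (by linarith)]
    linarith [Real.exp_one_lt_d9]
  set c : ℂ := 2 + T * I with hc
  have hball : ∀ z ∈ Metric.closedBall c 2.4, -0.4 ≤ z.re ∧ 1 ≤ z.im ∧ ‖z‖ ≤ 2 * T := by
    intro z hz
    rw [Metric.mem_closedBall, dist_eq] at hz
    have hre := (abs_re_le_norm (z - c)).trans hz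
    have him := (abs_im_le_norm (z - c)).trans hz
    simp [hc, abs_le] at hre him
    refine ⟨by linarith, by linarith, ?_⟩
    have e : z = (z - c) + c := by ring
    have hcn : ‖c‖ ≤ 2 + T := by
      have := norm_add_le (2 : ℂ) (T * I)
      simpa [abs_of_pos (show 0 < T by linarith)] using this
    have := norm_add_le (z - c) c
    rw [← e] at this
    linarith
  have hne1 : ∀ z ∈ Metric.closedBall c 2.4, z ≠ 1 := by
    rintro z hz rfl
    have := (hball _ hz).2.1
    simp at this
    linarith
  have hcn : 1 / 3 ≤ ‖riemannZeta c‖ := one_third_le_norm_riemannZeta (by simp [hc])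
  have hc0 : riemannZeta c ≠ 0 := by
    intro h; rw [h] at hcn; norm_num at hcn
  set M := max 1 (C₂ * (2 * T) ^ 2) with hM
  have hZfin : (Metric.closedBall c 2.2 ∩ riemannZetaZeros).Finite :=
    (isCompact_closedBall c 2.2).inter_riemannZetaZeros_finite
  have hZ : ∀ ρ, ρ ∈ hZfin.toFinset ↔ ρ ∈ Metric.closedBall c 2.2 ∧ riemannZeta ρ = 0 := by
    intro ρ; simp [mem_riemannZetaZeros]
  have hlog : Real.log (M / ‖riemannZeta c‖) + 1 ≤ (K + 3) * Real.log T := by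
    have hM0 : 0 < M := lt_of_lt_of_le one_pos (le_max_left _ _)
    have : M / ‖riemannZeta c‖ ≤ M * 3 := by
      rw [div_le_iff₀ (by linarith)]
      nlinarith
    have h3 : Real.log (M / ‖riemannZeta c‖) ≤ Real.log (M * 3) :=
      Real.log_le_log (by positivity) this
    have h4 : Real.log (M * 3) ≤ max 1 (Real.log (C₂ * 12)) + 2 * Real.log T := by
      rcases max_choice 1 (C₂ * (2 * T) ^ 2) with h | h
      · rw [hM, h]
        have : Real.log (1 * 3) ≤ 2 := by
          have := Real.log_le_sub_one_of_pos (show (0 : ℝ) < 3 by norm_num)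
          norm_num at this ⊢
          linarith
        linarith
      · rw [hM, h, show C₂ * (2 * T) ^ 2 * 3 = (C₂ * 12) * T ^ 2 by ring,
          Real.log_mul (by positivity) (by positivity), Real.log_pow]
        have := le_max_right 1 (Real.log (C₂ * 12))
        push_cast
        linarith
    nlinarith
  obtain ⟨hA, H, hH, hHz⟩ := h1 riemannZeta c M (le_max_left _ _)
    (fun z hz => analyticAt_riemannZeta (hne1 z hz)) hc0
    (fun z hz => by
      obtain ⟨ha, hb, hd⟩ := hball z hz
      refine (h2 z (by linarith) hb).trans (le_trans ?_ (le_max_right _ _))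
      gcongr) hZfin.toFinset hZ
  have hlog' : C₁ * (Real.log (M / ‖riemannZeta c‖) + 1) ≤ C₁ * (K + 3) * Real.log T := by
    rw [mul_assoc]; gcongr
  exact ⟨hZfin.toFinset, hZ, hA.trans hlog', H, hH,
    fun z hz => ⟨(hHz z hz).1.trans hlog', (hHz z hz).2⟩⟩

theorem norm_ofReal_cpow_sub_cpow_div_le {x b : ℝ} (hx : 1 < x) {z ρ : ℂ} (hz : z.re ≤ b)
    (hρ : ρ.re ≤ b) : ‖((x : ℂ) ^ z - (x : ℂ) ^ ρ) / (z - ρ)‖ ≤ Real.log x * x ^ b := by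
  have hx0 : 0 < x := by linarith
  have hxc : (x : ℂ) ≠ 0 := ofReal_ne_zero.2 hx0.ne'
  have hl : 0 ≤ Real.log x := Real.log_nonneg hx.le
  have key := (convex_halfSpace_re_le b).norm_image_sub_le_of_norm_hasDerivWithin_le
    (𝕜 := ℂ) (f := fun z : ℂ => (x : ℂ) ^ z) (f' := fun z : ℂ => (x : ℂ) ^ z * Complex.log x)
    (C := Real.log x * x ^ b) (x := ρ) (y := z)
    (fun w _ => by
      have := (hasDerivAt_id w).const_cpow (c := (x : ℂ)) (Or.inl hxc)
      simpa using this.hasDerivWithinAt)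
    (fun w hw => by
      rw [norm_mul, norm_cpow_eq_rpow_re_of_pos hx0, ← ofReal_log hx0.le, norm_real,
        Real.norm_of_nonneg hl, mul_comm]
      gcongr
      · exact hx.le
      · exact hw) hρ hz
  rw [norm_div]
  exact div_le_of_le_mul₀ (norm_nonneg _) (by positivity) key

theorem norm_log_sub_log_le {z w : ℂ} {d D : ℝ} (hd : 0 < d) (hz : d ≤ ‖z‖) (hzD : ‖z‖ ≤ D)
    (hw : d ≤ ‖w‖) (hwD : ‖w‖ ≤ D) :
    ‖Complex.log z - Complex.log w‖ ≤ |Real.log d| + |Real.log D| + 2 * Real.pi := by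
  have hb : ∀ z : ℂ, d ≤ ‖z‖ → ‖z‖ ≤ D → Real.log d ≤ Real.log ‖z‖ ∧ Real.log ‖z‖ ≤ Real.log D :=
    fun z h1 h2 => ⟨Real.log_le_log hd h1, Real.log_le_log (by linarith) h2⟩
  obtain ⟨a1, a2⟩ := hb z hz hzD
  obtain ⟨b1, b2⟩ := hb w hw hwD
  refine (norm_le_abs_re_add_abs_im _).trans ?_
  simp only [sub_re, sub_im, log_re, log_im]
  have e1 : |Real.log ‖z‖ - Real.log ‖w‖| ≤ |Real.log d| + |Real.log D| := by
    rw [abs_le]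
    constructor <;> linarith [neg_abs_le (Real.log d), le_abs_self (Real.log d),
      neg_abs_le (Real.log D), le_abs_self (Real.log D)]
  have e2 : |arg z - arg w| ≤ 2 * Real.pi := by
    have := abs_arg_le_pi z
    have := abs_arg_le_pi w
    have := abs_sub (arg z) (arg w)
    linarith
  linarith

theorem log_le_rpow_div_delta {x δ : ℝ} (hx : 1 < x) (hδ : 0 < δ) :
    Real.log x * x ^ (1 + δ) ≤ x ^ (1 + 2 * δ) / δ := by
  have h := Real.log_le_rpow_div (x := x) (by linarith) hδ
  calc Real.log x * x ^ (1 + δ) ≤ x ^ δ / δ * x ^ (1 + δ) := by gcongr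
    _ = _ := by
      rw [div_mul_eq_mul_div, ← Real.rpow_add (by linarith)]; congr 2; ring

theorem exists_norm_integral_horizontal_le {δ : ℝ} (hδ : 0 < δ) (hδ' : δ ≤ 1 / 10) :
    ∃ C : ℝ, 0 < C ∧ ∀ x T : ℝ, 1 < x → 5 ≤ T → (∀ ρ, riemannZeta ρ = 0 → ρ.im ≠ T) →
      ‖∫ σ : ℝ in (-δ)..(1 + δ), (x : ℂ) ^ (σ + T * I : ℂ) *
        (deriv riemannZeta (σ + T * I) / riemannZeta (σ + T * I))‖ ≤
        C * (x ^ (1 + 2 * δ) * Real.log T) := by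
  obtain ⟨C, hC, h⟩ := exists_logDeriv_riemannZeta_decomposition
  set K := |Real.log δ| + |Real.log 5| + 2 * Real.pi with hK
  have hK0 : 0 < K := by have := Real.pi_pos; positivity
  refine ⟨C * (2 / δ + K) + 2 * C, by positivity, fun x T hx hT hT0 => ?_⟩
  obtain ⟨Z, hZ, hZs, H, hH, hHz⟩ := h T hT
  have hx0 : 0 < x := by linarith
  have hxc : (x : ℂ) ≠ 0 := ofReal_ne_zero.2 hx0.ne'
  have hlogT : 0 ≤ Real.log T := Real.log_nonneg (by linarith)
  have hab : -δ ≤ 1 + δ := by linarith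
  have hmem : ∀ σ ∈ Set.Icc (-δ) (1 + δ), (σ + T * I : ℂ) ∈ Metric.closedBall (2 + T * I : ℂ) 2.1 := by
    intro σ hσ
    rw [Metric.mem_closedBall, dist_eq, show (σ + T * I : ℂ) - (2 + T * I) = ((σ - 2 : ℝ) : ℂ) by
      push_cast; ring, norm_real, Real.norm_eq_abs, abs_le]
    constructor <;> linarith [hσ.1, hσ.2]
  have hρ : ∀ ρ ∈ Z, 0 < ρ.re ∧ ρ.re < 1 ∧ |ρ.im - T| ≤ 2.2 ∧ ρ.im ≠ T := by
    intro ρ hρ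
    obtain ⟨h1, h2⟩ := (hZ ρ).1 hρ
    rw [Metric.mem_closedBall, dist_eq] at h1
    have him := (abs_im_le_norm _).trans h1
    simp at him
    have : ρ.im ≠ 0 := by
      intro h0; rw [h0, abs_le] at him; norm_num at him; linarith
    exact ⟨re_pos_of_riemannZeta_eq_zero h2 this, re_lt_one_of_riemannZeta_eq_zero h2, him, hT0 ρ h2⟩
  have hne : ∀ ρ ∈ Z, ∀ σ : ℝ, (σ + T * I : ℂ) - ρ ≠ 0 := by
    intro ρ hρZ σ h0
    have := congrArg Complex.im h0
    simp at this
    exact (hρ ρ hρZ).2.2.2 (by linarith)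
  have hζ : ∀ σ : ℝ, riemannZeta (σ + T * I) ≠ 0 := by
    intro σ h0
    exact hT0 _ h0 (by simp)
  have cs : Continuous (fun σ : ℝ => (σ + T * I : ℂ)) := by fun_prop
  have cx : Continuous (fun σ : ℝ => (x : ℂ) ^ (σ + T * I : ℂ)) := cs.const_cpow (Or.inl hxc)
  set q : ℂ → ℝ → ℂ := fun ρ σ => ((x : ℂ) ^ (σ + T * I : ℂ) - (x : ℂ) ^ ρ) / (σ + T * I - ρ) with hq
  set w : ℂ → ℝ → ℂ := fun ρ σ => (x : ℂ) ^ ρ * (1 / (σ + T * I - ρ)) with hw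
  have cq : ∀ ρ ∈ Z, Continuous (q ρ) := fun ρ hρZ =>
    (cx.sub continuous_const).div (cs.sub continuous_const) (hne ρ hρZ)
  have cw : ∀ ρ ∈ Z, Continuous (w ρ) := fun ρ hρZ =>
    continuous_const.mul (continuous_const.div (cs.sub continuous_const) (hne ρ hρZ))
  have cH : ContinuousOn (fun σ : ℝ => (x : ℂ) ^ (σ + T * I : ℂ) * H (σ + T * I))
      (Set.uIcc (-δ) (1 + δ)) := by
    rw [Set.uIcc_of_le hab]
    exact cx.continuousOn.mul (hH.comp cs.continuousOn hmem)
  have e1 : ∫ σ : ℝ in (-δ)..(1 + δ), (x : ℂ) ^ (σ + T * I : ℂ) *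
        (deriv riemannZeta (σ + T * I) / riemannZeta (σ + T * I)) =
      ∑ ρ ∈ Z, (analyticOrderNatAt riemannZeta ρ : ℂ) * ((∫ σ in (-δ)..(1 + δ), q ρ σ) +
        ∫ σ in (-δ)..(1 + δ), w ρ σ) +
        ∫ σ : ℝ in (-δ)..(1 + δ), (x : ℂ) ^ (σ + T * I : ℂ) * H (σ + T * I) := by
    have e2 : ∀ ρ ∈ Z, (analyticOrderNatAt riemannZeta ρ : ℂ) * ((∫ σ in (-δ)..(1 + δ), q ρ σ) +
        ∫ σ in (-δ)..(1 + δ), w ρ σ) = ∫ σ in (-δ)..(1 + δ),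
          (analyticOrderNatAt riemannZeta ρ : ℂ) * (q ρ σ + w ρ σ) := fun ρ hρZ => by
      rw [← intervalIntegral.integral_add
        ((cq ρ hρZ).intervalIntegrable _ _) ((cw ρ hρZ).intervalIntegrable _ _)]
      exact (intervalIntegral.integral_const_mul _ _).symm
    have ci : ∀ ρ ∈ Z, IntervalIntegrable (fun σ => (analyticOrderNatAt riemannZeta ρ : ℂ) *
        (q ρ σ + w ρ σ)) MeasureTheory.volume (-δ) (1 + δ) := fun ρ hρZ =>
      (continuous_const.mul ((cq ρ hρZ).add (cw ρ hρZ))).intervalIntegrable _ _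
    rw [Finset.sum_congr rfl e2, ← intervalIntegral.integral_finsetSum ci,
      ← intervalIntegral.integral_add]
    · refine intervalIntegral.integral_congr fun σ hσ => ?_
      rw [Set.uIcc_of_le hab] at hσ
      rw [((hHz _ (hmem σ hσ)).2 (hζ σ)), mul_add, Finset.mul_sum]
      congr 1
      refine Finset.sum_congr rfl fun ρ hρZ => ?_
      have := hne ρ hρZ σ
      simp only [hq, hw]
      field_simp
      ring
    · exact (continuous_finsetSum _ fun ρ hρZ =>
        (continuous_const.mul ((cq ρ hρZ).add (cw ρ hρZ)))).intervalIntegrable _ _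
    · exact cH.intervalIntegrable
  have hlen : |1 + δ - -δ| ≤ 2 := by rw [abs_le]; constructor <;> linarith
  have bq : ∀ ρ ∈ Z, ‖∫ σ in (-δ)..(1 + δ), q ρ σ‖ ≤ x ^ (1 + 2 * δ) / δ * 2 := by
    intro ρ hρZ
    refine (intervalIntegral.norm_integral_le_of_norm_le_const (C := x ^ (1 + 2 * δ) / δ)
      fun σ hσ => ?_).trans (by gcongr)
    rw [Set.uIoc_of_le hab] at hσ
    refine le_trans ?_ (log_le_rpow_div_delta hx hδ)
    exact norm_ofReal_cpow_sub_cpow_div_le hx (by simpa using hσ.2) (by linarith [(hρ ρ hρZ).2.1])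
  have hx1 : x ≤ x ^ (1 + 2 * δ) := by
    conv_lhs => rw [← Real.rpow_one x]
    exact Real.rpow_le_rpow_of_exponent_le hx.le (by linarith)
  have bw : ∀ ρ ∈ Z, ‖∫ σ in (-δ)..(1 + δ), w ρ σ‖ ≤ x ^ (1 + 2 * δ) * K := by
    intro ρ hρZ
    obtain ⟨r0, r1, r2, r3⟩ := hρ ρ hρZ
    rw [intervalIntegral.integral_const_mul, norm_mul]
    refine mul_le_mul ?_ ?_ (norm_nonneg _) (by positivity)
    · rw [norm_cpow_eq_rpow_re_of_pos hx0]
      exact Real.rpow_le_rpow_of_exponent_le hx.le (by linarith)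
    · have := integral_div_affine_eq_log_sub (p := T * I - ρ) (k := 1) hab (by
        intro t _; right; simpa using sub_ne_zero.2 r3.symm)
      rw [intervalIntegral.integral_congr (g := fun t : ℝ => 1 / (T * I - ρ + t * 1))
        (fun t _ => by simp only; congr 1; ring), this]
      have up : ∀ σ ∈ Set.Icc (-δ) (1 + δ), ‖T * I - ρ + (σ : ℂ) * 1‖ ≤ 5 := by
        intro σ hσ
        refine (norm_le_abs_re_add_abs_im _).trans ?_
        have a1 : |(T * I - ρ + (σ : ℂ) * 1).re| ≤ 2 := by
          simp [abs_le]; constructor <;> linarith [hσ.1, hσ.2]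
        have a2 : |(T * I - ρ + (σ : ℂ) * 1).im| ≤ 2.2 := by
          simpa [abs_sub_comm] using r2
        linarith
      refine norm_log_sub_log_le hδ ?_ (up _ ⟨by linarith, le_rfl⟩) ?_ (up _ ⟨le_rfl, by linarith⟩)
      · refine le_trans ?_ (abs_re_le_norm _)
        simp
        exact le_trans (by linarith) (le_abs_self _)
      · refine le_trans ?_ (abs_re_le_norm _)
        simp
        exact le_trans (by linarith) (neg_le_abs _)
  have bH : ‖∫ σ : ℝ in (-δ)..(1 + δ), (x : ℂ) ^ (σ + T * I : ℂ) * H (σ + T * I)‖ ≤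
      x ^ (1 + 2 * δ) * (C * Real.log T) * 2 := by
    refine (intervalIntegral.norm_integral_le_of_norm_le_const
      (C := x ^ (1 + 2 * δ) * (C * Real.log T)) fun σ hσ => ?_).trans (by gcongr)
    rw [Set.uIoc_of_le hab] at hσ
    rw [norm_mul]
    refine mul_le_mul ?_ (hHz _ (hmem σ ⟨hσ.1.le, hσ.2⟩)).1 (norm_nonneg _) (by positivity)
    rw [norm_cpow_eq_rpow_re_of_pos hx0]
    exact Real.rpow_le_rpow_of_exponent_le hx.le (by simp; linarith [hσ.2])
  rw [e1]
  refine (norm_add_le _ _).trans ?_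
  have bS : ‖∑ ρ ∈ Z, (analyticOrderNatAt riemannZeta ρ : ℂ) * ((∫ σ in (-δ)..(1 + δ), q ρ σ) +
        ∫ σ in (-δ)..(1 + δ), w ρ σ)‖ ≤
      (C * Real.log T) * (x ^ (1 + 2 * δ) * (2 / δ + K)) := by
    refine (norm_sum_le _ _).trans ?_
    refine le_trans ?_ (mul_le_mul_of_nonneg_right hZs (by positivity))
    rw [Finset.sum_mul]
    refine Finset.sum_le_sum fun ρ hρZ => ?_
    rw [norm_mul, Complex.norm_natCast]
    gcongr
    refine (norm_add_le _ _).trans ((add_le_add (bq ρ hρZ) (bw ρ hρZ)).trans (le_of_eq ?_))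
    ring
  refine (add_le_add bS bH).trans (le_of_eq ?_)
  ring

theorem norm_GammaSeq_le {s : ℂ} (hs : 0 < s.re) {n : ℕ} (hn : n ≠ 0) :
    ‖GammaSeq s n‖ ≤ Real.Gamma s.re := by
  rw [GammaSeq_eq_approx_Gamma_integral hs hn, Real.Gamma_eq_integral hs]
  have hn0 : (0 : ℝ) ≤ n := n.cast_nonneg
  have hint := Real.GammaIntegral_convergent hs
  rw [intervalIntegral.integral_of_le hn0]
  refine (MeasureTheory.norm_integral_le_of_norm_le (hint.mono_set Set.Ioc_subset_Ioi_self)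
    ?_).trans (MeasureTheory.setIntegral_mono_set hint ?_
      (Filter.Eventually.of_forall fun x hx => Set.Ioc_subset_Ioi_self hx))
  · refine (MeasureTheory.ae_restrict_iff' measurableSet_Ioc).2 (Filter.Eventually.of_forall ?_)
    intro x hx
    have h1 : 0 ≤ 1 - x / n := by
      rw [sub_nonneg]; exact div_le_one_of_le₀ hx.2 hn0
    rw [norm_mul, norm_cpow_eq_rpow_re_of_pos hx.1, norm_real,
      Real.norm_of_nonneg (pow_nonneg h1 _)]
    simp only [sub_re, one_re]
    exact mul_le_mul_of_nonneg_right (Real.one_sub_div_pow_le_exp_neg hx.2)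
      (Real.rpow_nonneg hx.1.le _)
  · refine (MeasureTheory.ae_restrict_iff' measurableSet_Ioi).2 (Filter.Eventually.of_forall ?_)
    intro x hx
    exact mul_nonneg (Real.exp_pos _).le (Real.rpow_nonneg (le_of_lt hx) _)

theorem isOpen_re_pos : IsOpen {s : ℂ | 0 < s.re} := isOpen_lt continuous_const continuous_re

theorem add_natCast_ne_zero_of_re_pos {s : ℂ} (hs : 0 < s.re) (j : ℕ) : s + j ≠ 0 := by
  intro h
  have := congrArg Complex.re h
  simp at this
  linarith [j.cast_nonneg (α := ℝ)]

theorem ne_neg_natCast_of_re_pos {s : ℂ} (hs : 0 < s.re) (j : ℕ) : s ≠ -j := fun h =>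
  add_natCast_ne_zero_of_re_pos hs j (by rw [h]; ring)

theorem differentiableAt_GammaSeq {s : ℂ} (hs : 0 < s.re) {n : ℕ} (hn : n ≠ 0) :
    DifferentiableAt ℂ (fun s => GammaSeq s n) s := by
  unfold GammaSeq
  refine DifferentiableAt.div ?_ ?_ ?_
  · exact (differentiableAt_id.const_cpow (Or.inl (Nat.cast_ne_zero.2 hn))).mul_const _
  · fun_prop
  · exact Finset.prod_ne_zero_iff.2 fun j _ => add_natCast_ne_zero_of_re_pos hs j

theorem tendsto_deriv_GammaSeq {s : ℂ} (hs : 0 < s.re) :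
    Filter.Tendsto (fun n => deriv (fun s => GammaSeq s n) s) Filter.atTop
      (nhds (deriv Gamma s)) := by
  set r := s.re / 2 with hr
  have hr0 : 0 < r := by positivity
  have hball : Metric.closedBall s r ⊆ {s : ℂ | 0 < s.re} := by
    intro z hz
    rw [Metric.mem_closedBall, dist_eq] at hz
    have := (abs_re_le_norm _).trans hz
    rw [sub_re, abs_le] at this
    show 0 < z.re
    linarith
  have e1 : cderiv r Gamma s = deriv Gamma s := cderiv_eq_deriv isOpen_re_pos
    (fun z hz => (differentiableAt_Gamma z (ne_neg_natCast_of_re_pos hz)).differentiableWithinAt)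
    hr0 hball
  have e2 : ∀ n : ℕ, n ≠ 0 → cderiv r (fun s => GammaSeq s n) s =
      deriv (fun s => GammaSeq s n) s := fun n hn => cderiv_eq_deriv isOpen_re_pos
    (fun z hz => (differentiableAt_GammaSeq hz hn).differentiableWithinAt) hr0 hball
  rw [← e1]
  have hev : (fun n => cderiv r (fun s => GammaSeq s n) s) =ᶠ[Filter.atTop]
      (fun n => deriv (fun s => GammaSeq s n) s) := by
    filter_upwards [Filter.eventually_ne_atTop 0] with n hn using e2 n hn
  refine Filter.Tendsto.congr' hev ?_
  unfold cderiv circleIntegral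
  refine Filter.Tendsto.const_smul ?_ _
  have hcm : ∀ θ, circleMap s r θ ∈ {s : ℂ | 0 < s.re} := fun θ =>
    hball (Metric.sphere_subset_closedBall (circleMap_mem_sphere s hr0.le θ))
  have hne : ∀ θ, circleMap s r θ - s ≠ 0 := fun θ =>
    sub_ne_zero.2 (circleMap_ne_center hr0.ne')
  have cc : Continuous (fun θ => circleMap s r θ) := continuous_circleMap s r
  have cd : Continuous (fun θ => deriv (circleMap s r) θ) := by
    simp only [deriv_circleMap]; fun_prop
  have ci : Continuous (fun θ => ((circleMap s r θ - s) ^ 2)⁻¹) :=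
    ((cc.sub continuous_const).pow 2).inv₀ fun θ => pow_ne_zero 2 (hne θ)
  refine intervalIntegral.tendsto_integral_filter_of_dominated_convergence
    (fun θ => ‖deriv (circleMap s r) θ‖ * (‖((circleMap s r θ - s) ^ 2)⁻¹‖ *
      Real.Gamma (circleMap s r θ).re)) ?_ ?_ ?_ ?_
  · filter_upwards [Filter.eventually_ne_atTop 0] with n hn
    refine Continuous.aestronglyMeasurable ?_
    refine cd.smul (ci.smul ?_)
    exact continuous_iff_continuousAt.2 fun θ =>
      ContinuousAt.comp (f := fun θ => circleMap s r θ) (g := fun s => GammaSeq s n)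
      (differentiableAt_GammaSeq (hcm θ) hn).continuousAt cc.continuousAt
  · filter_upwards [Filter.eventually_ne_atTop 0] with n hn
    refine Filter.Eventually.of_forall fun θ _ => ?_
    rw [norm_smul, norm_smul]
    gcongr
    exact norm_GammaSeq_le (hcm θ) hn
  · refine Continuous.intervalIntegrable ?_ _ _
    refine cd.norm.mul (ci.norm.mul ?_)
    exact continuous_iff_continuousAt.2 fun θ =>
      ContinuousAt.comp (f := fun θ => (circleMap s r θ).re) (g := Real.Gamma)
      (Real.differentiableAt_Gamma fun m => by
        have : 0 < (circleMap s r θ).re := hcm θ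
        have := m.cast_nonneg (α := ℝ)
        intro h
        linarith).continuousAt
      (continuous_re.comp cc).continuousAt
  · refine Filter.Eventually.of_forall fun θ _ => ?_
    exact ((GammaSeq_tendsto_Gamma _).const_smul _).const_smul _

theorem logDeriv_GammaSeq {s : ℂ} (hs : 0 < s.re) {n : ℕ} (hn : n ≠ 0) :
    logDeriv (fun s => GammaSeq s n) s =
      Complex.log n - ∑ j ∈ Finset.range (n + 1), 1 / (s + j) := by
  have hnc : (n : ℂ) ≠ 0 := Nat.cast_ne_zero.2 hn
  have hj := add_natCast_ne_zero_of_re_pos hs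
  have hd : ∀ j ∈ Finset.range (n + 1), DifferentiableAt ℂ (fun s : ℂ => s + j) s :=
    fun j _ => by fun_prop
  have hp : HasDerivAt (fun s : ℂ => (n : ℂ) ^ s * n.factorial)
      ((n : ℂ) ^ s * Complex.log n * n.factorial) s := by
    have := ((hasDerivAt_id s).const_cpow (c := (n : ℂ)) (Or.inl hnc)).mul_const (n.factorial : ℂ)
    simpa using this
  have hf : (n.factorial : ℂ) ≠ 0 := Nat.cast_ne_zero.2 n.factorial_ne_zero
  have hnp : (n : ℂ) ^ s ≠ 0 := by simp [cpow_eq_zero_iff, hn]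
  unfold GammaSeq
  rw [logDeriv_div (f := fun s : ℂ => (n : ℂ) ^ s * n.factorial)
    (g := fun s : ℂ => ∏ j ∈ Finset.range (n + 1), (s + j)) s (mul_ne_zero hnp hf) (Finset.prod_ne_zero_iff.2 fun j _ => hj j)
    hp.differentiableAt (by fun_prop), logDeriv_prod (fun j _ => hj j) hd, logDeriv_apply, hp.deriv]
  congr 1
  · field_simp
  · refine Finset.sum_congr rfl fun j _ => ?_
    rw [logDeriv_apply]
    simp

theorem tendsto_digamma {s : ℂ} (hs : 0 < s.re) :
    Filter.Tendsto (fun n : ℕ => Complex.log n - ∑ j ∈ Finset.range (n + 1), 1 / (s + j))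
      Filter.atTop (nhds (digamma s)) := by
  have hG : Gamma s ≠ 0 := Gamma_ne_zero_of_re_pos hs
  have := (tendsto_deriv_GammaSeq hs).div (GammaSeq_tendsto_Gamma s) hG
  rw [digamma_def, logDeriv_apply]
  refine this.congr' ?_
  filter_upwards [Filter.eventually_ne_atTop 0] with n hn
  rw [← logDeriv_GammaSeq hs hn, logDeriv_apply]
  rfl

theorem sum_range_one_div_add_sq_le {t : ℝ} (ht : 1 < t) (N : ℕ) :
    ∑ j ∈ Finset.range N, 1 / ((t + j) ^ 2) ≤ 1 / (t - 1) - 1 / (t - 1 + N) := by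
  induction N with
  | zero => simp
  | succ N ih =>
    rw [Finset.sum_range_succ]
    have hN : (0 : ℝ) ≤ N := N.cast_nonneg
    have : 1 / (t + N) ^ 2 ≤ 1 / (t - 1 + N) - 1 / (t - 1 + (N + 1 : ℕ)) := by
      push_cast
      rw [div_sub_div _ _ (by linarith) (by linarith), div_le_div_iff₀ (by nlinarith) (by nlinarith)]
      nlinarith
    linarith

theorem norm_digamma_sub_le {s₁ s₂ : ℂ} (h₁ : 0 < s₁.re) (h₂ : 0 < s₂.re) {t : ℝ} (ht : 2 ≤ t)
    (hi₁ : t ≤ |s₁.im|) (hi₂ : t ≤ |s₂.im|) :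
    ‖digamma s₁ - digamma s₂‖ ≤ 4 / t * ‖s₁ - s₂‖ := by
  have hn : ∀ s : ℂ, 0 < s.re → t ≤ |s.im| → ∀ j : ℕ, (t + j) ^ 2 / 2 ≤ ‖s + j‖ ^ 2 := by
    intro s hs hi j
    have hj : (0 : ℝ) ≤ j := j.cast_nonneg
    rw [← normSq_eq_norm_sq, normSq_apply]
    simp only [add_re, natCast_re, add_im, natCast_im, add_zero]
    have : t ^ 2 ≤ s.im * s.im := by
      rw [← abs_mul_abs_self s.im]; nlinarith
    nlinarith [sq_nonneg (t - j)]
  have lim := ((tendsto_digamma h₁).sub (tendsto_digamma h₂)).norm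
  refine le_of_tendsto' lim fun n => ?_
  have e : Complex.log n - ∑ j ∈ Finset.range (n + 1), 1 / (s₁ + j) -
      (Complex.log n - ∑ j ∈ Finset.range (n + 1), 1 / (s₂ + j)) =
      ∑ j ∈ Finset.range (n + 1), (s₁ - s₂) / ((s₁ + j) * (s₂ + j)) := by
    rw [show ∀ a b c : ℂ, a - b - (a - c) = c - b by intros; ring, ← Finset.sum_sub_distrib]
    refine Finset.sum_congr rfl fun j _ => ?_
    have a1 := add_natCast_ne_zero_of_re_pos h₁ j
    have a2 := add_natCast_ne_zero_of_re_pos h₂ j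
    field_simp
    ring
  rw [e]
  refine (norm_sum_le _ _).trans ?_
  have hterm : ∀ j ∈ Finset.range (n + 1), ‖(s₁ - s₂) / ((s₁ + j) * (s₂ + j))‖ ≤
      2 * ‖s₁ - s₂‖ * (1 / (t + j) ^ 2) := by
    intro j _
    have hj : (0 : ℝ) ≤ j := j.cast_nonneg
    have hp : 0 < (t + j) ^ 2 := by positivity
    have b1 := hn s₁ h₁ hi₁ j
    have b2 := hn s₂ h₂ hi₂ j
    have hprod : (t + j) ^ 2 / 2 ≤ ‖s₁ + j‖ * ‖s₂ + j‖ := by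
      refine le_of_sq_le_sq ?_ (by positivity)
      rw [mul_pow, sq ((t + j) ^ 2 / 2)]
      exact mul_le_mul b1 b2 (by positivity) (by positivity)
    rw [norm_div, norm_mul]
    calc _ ≤ ‖s₁ - s₂‖ / ((t + j) ^ 2 / 2) := by gcongr
      _ = _ := by field_simp
  refine (Finset.sum_le_sum hterm).trans ?_
  rw [← Finset.mul_sum]
  have h3 := sum_range_one_div_add_sq_le (t := t) (by linarith) (n + 1)
  have h4 : 0 ≤ 1 / (t - 1 + (n + 1 : ℕ)) := by
    have : (0 : ℝ) ≤ (n + 1 : ℕ) := Nat.cast_nonneg _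
    apply div_nonneg <;> linarith
  have h5 : 1 / (t - 1) ≤ 2 / t := by
    rw [div_le_div_iff₀ (by linarith) (by linarith)]; linarith
  calc _ ≤ 2 * ‖s₁ - s₂‖ * (2 / t) := by gcongr; linarith
    _ = _ := by ring

/-- The archimedean part of the logarithmic derivative of the functional equation of `ζ`. -/
noncomputable def zetaReflectionLogDeriv (z : ℂ) : ℂ :=
  Real.log (2 * Real.pi) - digamma (1 - z) +
    Real.pi / 2 * Complex.tan (Real.pi * (1 - z) / 2)

theorem im_pi_mul_one_sub_div_two (z : ℂ) :
    (Real.pi * (1 - z) / 2 : ℂ).im = -(Real.pi * z.im / 2) := by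
  have : (Real.pi * (1 - z) / 2 : ℂ) = ((Real.pi / 2 : ℝ) : ℂ) * (1 - z) := by push_cast; ring
  rw [this, im_ofReal_mul]
  simp
  ring

theorem abs_im_le_norm_cos (z : ℂ) : |z.im| ≤ ‖Complex.cos z‖ := by
  have h1 : |z.im| ≤ |Real.sinh z.im| := by
    rcases le_total 0 z.im with h | h
    · rw [abs_of_nonneg h, abs_of_nonneg (Real.sinh_nonneg_iff.2 h)]
      exact Real.self_le_sinh_iff.2 h
    · rw [abs_of_nonpos h, abs_of_nonpos (Real.sinh_nonpos_iff.2 h)]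
      exact neg_le_neg (Real.sinh_le_self_iff.2 h)
  refine h1.trans ?_
  rw [← Real.sqrt_sq_eq_abs, norm_def]
  refine Real.sqrt_le_sqrt ?_
  have e : Complex.cos z = ((Real.cos z.re * Real.cosh z.im : ℝ) : ℂ) +
      ((-(Real.sin z.re * Real.sinh z.im) : ℝ) : ℂ) * I := by
    rw [Complex.cos_eq]; push_cast; ring
  rw [e, normSq_add_mul_I]
  have h2 := Real.cosh_sq z.im
  have h3 := Real.sin_sq_add_cos_sq z.re
  have : (Real.cos z.re * Real.cosh z.im) ^ 2 + (-(Real.sin z.re * Real.sinh z.im)) ^ 2 =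
      Real.cos z.re ^ 2 + Real.sinh z.im ^ 2 := by
    calc _ = Real.cos z.re ^ 2 * Real.cosh z.im ^ 2 + Real.sin z.re ^ 2 * Real.sinh z.im ^ 2 := by
          ring
      _ = Real.cos z.re ^ 2 +
          (Real.sin z.re ^ 2 + Real.cos z.re ^ 2) * Real.sinh z.im ^ 2 := by rw [h2]; ring
      _ = _ := by rw [h3]; ring
  rw [this]
  nlinarith [sq_nonneg (Real.cos z.re)]

theorem logDeriv_riemannZeta_eq_reflection {z : ℂ} (hz : z.re < 0) (him : z.im ≠ 0) :
    deriv riemannZeta z / riemannZeta z = zetaReflectionLogDeriv z -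
      deriv riemannZeta (1 - z) / riemannZeta (1 - z) := by
  set s := 1 - z with hs
  have hsre : 1 < s.re := by simp [hs]; linarith
  have hsim : s.im ≠ 0 := by simpa [hs] using him
  have h2pi : (2 * Real.pi : ℂ) ≠ 0 := by
    have := Real.pi_ne_zero; simp [this]
  set F : ℂ → ℂ := fun s => (2 * (2 * Real.pi : ℂ) ^ (-s)) * Gamma s *
    Complex.cos (Real.pi * s / 2) * riemannZeta s with hF
  have hs1 : s ≠ 1 := by intro h; rw [h] at hsre; simp at hsre
  have hev : (fun w => riemannZeta (1 - w)) =ᶠ[nhds s] F := by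
    have : {w : ℂ | 1 < w.re} ∈ nhds s :=
      (isOpen_lt continuous_const continuous_re).mem_nhds hsre
    filter_upwards [this] with w hw
    have hw' : 1 < w.re := hw
    exact riemannZeta_one_sub (fun n => ne_neg_natCast_of_re_pos (by linarith) n)
      (by rintro rfl; simp at hw')
  have hcos : Complex.cos (Real.pi * s / 2) ≠ 0 := by
    apply cos_ne_zero_of_im_ne_zero
    rw [hs, im_pi_mul_one_sub_div_two]
    have := Real.pi_ne_zero
    simp [this, him]
  have hG : Gamma s ≠ 0 := Gamma_ne_zero_of_re_pos (by linarith)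
  have hζ : riemannZeta s ≠ 0 := riemannZeta_ne_zero_of_one_le_re hsre.le
  have hp : HasDerivAt (fun s : ℂ => 2 * (2 * Real.pi : ℂ) ^ (-s))
      (2 * ((2 * Real.pi : ℂ) ^ (-s) * Complex.log (2 * Real.pi) * -1)) s :=
    ((hasDerivAt_neg s).const_cpow (Or.inl h2pi)).const_mul 2
  have hpow : (2 : ℂ) * (2 * Real.pi : ℂ) ^ (-s) ≠ 0 :=
    mul_ne_zero two_ne_zero (by simp [cpow_eq_zero_iff, Real.pi_ne_zero])
  have hc : HasDerivAt (fun s : ℂ => Complex.cos (Real.pi * s / 2))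
      (-Complex.sin (Real.pi * s / 2) * (Real.pi / 2)) s := by
    have h1 : HasDerivAt (fun s : ℂ => (Real.pi * s / 2 : ℂ)) (Real.pi / 2) s := by
      simpa using ((hasDerivAt_id s).const_mul (Real.pi : ℂ)).div_const 2
    exact (Complex.hasDerivAt_cos _).comp s h1
  have hGd : DifferentiableAt ℂ Gamma s :=
    differentiableAt_Gamma s (ne_neg_natCast_of_re_pos (by linarith))
  have hζd : DifferentiableAt ℂ riemannZeta s := differentiableAt_riemannZeta hs1
  have l1 : logDeriv F s = -Complex.log (2 * Real.pi) + digamma s -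
      Real.pi / 2 * Complex.tan (Real.pi * s / 2) + deriv riemannZeta s / riemannZeta s := by
    have e1 := logDeriv_mul (f := fun s => (2 * (2 * Real.pi : ℂ) ^ (-s)) * Gamma s *
      Complex.cos (Real.pi * s / 2)) (g := riemannZeta) s
      (mul_ne_zero (mul_ne_zero hpow hG) hcos) hζ
      ((hp.differentiableAt.mul hGd).mul hc.differentiableAt) hζd
    have e2 := logDeriv_mul (f := fun s => (2 * (2 * Real.pi : ℂ) ^ (-s)) * Gamma s)
      (g := fun s => Complex.cos (Real.pi * s / 2)) s (mul_ne_zero hpow hG) hcos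
      (hp.differentiableAt.mul hGd) hc.differentiableAt
    have e3 := logDeriv_mul (f := fun s => 2 * (2 * Real.pi : ℂ) ^ (-s)) (g := Gamma) s hpow hG
      hp.differentiableAt hGd
    rw [hF, e1, e2, e3, logDeriv_apply _ s, hp.deriv, logDeriv_apply (fun s => Complex.cos _),
      hc.deriv, logDeriv_apply riemannZeta, digamma_def, Complex.tan_eq_sin_div_cos]
    congr 1
    have e4 : 2 * ((2 * Real.pi : ℂ) ^ (-s) * Complex.log (2 * Real.pi) * -1) /
        (2 * (2 * Real.pi : ℂ) ^ (-s)) = -Complex.log (2 * Real.pi) := by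
      rw [div_eq_iff hpow]; ring
    rw [e4]
    ring
  have l2 : logDeriv (fun w => riemannZeta (1 - w)) s =
      -(deriv riemannZeta z / riemannZeta z) := by
    have hz1 : z ≠ 1 := by rintro rfl; simp at him
    have h1 : HasDerivAt (fun w => riemannZeta (1 - w)) (deriv riemannZeta z * -1) s := by
      have h2 : HasDerivAt riemannZeta (deriv riemannZeta z) (1 - s) := by
        rw [show 1 - s = z by simp [hs]]
        exact (differentiableAt_riemannZeta hz1).hasDerivAt
      exact h2.comp s ((hasDerivAt_id s).const_sub 1)
    rw [logDeriv_apply, h1.deriv, show 1 - s = z by simp [hs]]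
    ring
  have l3 : logDeriv (fun w => riemannZeta (1 - w)) s = logDeriv F s := by
    rw [logDeriv_apply, logDeriv_apply, hev.deriv_eq, hev.eq_of_nhds]
  have l4 : Complex.log (2 * Real.pi) = ((Real.log (2 * Real.pi) : ℝ) : ℂ) := by
    rw [ofReal_log (by positivity)]; push_cast; rfl
  rw [l1, l2, l4] at l3
  rw [zetaReflectionLogDeriv, ← hs]
  linear_combination -l3

theorem differentiableAt_digamma {s : ℂ} (hs : 0 < s.re) : DifferentiableAt ℂ digamma s := by
  have hA : AnalyticAt ℂ Gamma s := DifferentiableOn.analyticAt (s := {s : ℂ | 0 < s.re})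
    (fun z hz => (differentiableAt_Gamma z (ne_neg_natCast_of_re_pos hz)).differentiableWithinAt)
    (isOpen_re_pos.mem_nhds hs)
  rw [digamma_def]
  exact (hA.deriv.div hA (Gamma_ne_zero_of_re_pos hs)).differentiableAt

theorem norm_deriv_digamma_le {s : ℂ} (hs : 0 < s.re) (him : 4 ≤ |s.im|) :
    ‖deriv digamma s‖ ≤ 8 / |s.im| := by
  refine (differentiableAt_digamma hs).hasDerivAt.le_of_lip' (by positivity) ?_
  have h1 : {w : ℂ | 0 < w.re} ∈ nhds s := isOpen_re_pos.mem_nhds hs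
  have h2 : {w : ℂ | |s.im| / 2 < |w.im|} ∈ nhds s :=
    (isOpen_lt continuous_const continuous_im.abs).mem_nhds (show |s.im| / 2 < |s.im| by linarith)
  filter_upwards [h1, h2] with w hw1 hw2
  have hw2' : |s.im| / 2 < |w.im| := hw2
  have := norm_digamma_sub_le hw1 hs (t := |s.im| / 2) (by linarith) hw2'.le (by linarith)
  rwa [show 4 / (|s.im| / 2) = 8 / |s.im| by field_simp; norm_num] at this

theorem hasDerivAt_zetaReflectionLogDeriv {z : ℂ} (hz : z.re < 1) (him : z.im ≠ 0) :
    HasDerivAt zetaReflectionLogDeriv (deriv digamma (1 - z) -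
      (Real.pi / 2) ^ 2 / Complex.cos (Real.pi * (1 - z) / 2) ^ 2) z := by
  have hcos : Complex.cos (Real.pi * (1 - z) / 2) ≠ 0 := by
    apply cos_ne_zero_of_im_ne_zero
    rw [im_pi_mul_one_sub_div_two]
    have := Real.pi_ne_zero
    simp [this, him]
  have h0 : HasDerivAt (fun z : ℂ => 1 - z) (-1) z := (hasDerivAt_id z).const_sub 1
  have h1 : HasDerivAt (fun z => digamma (1 - z)) (deriv digamma (1 - z) * -1) z :=
    (differentiableAt_digamma (by simp; linarith)).hasDerivAt.comp z h0
  have h2 : HasDerivAt (fun z : ℂ => (Real.pi * (1 - z) / 2 : ℂ)) (Real.pi * -1 / 2) z :=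
    (h0.const_mul (Real.pi : ℂ)).div_const 2
  have h3 := ((Complex.hasDerivAt_tan hcos).comp z h2).const_mul (Real.pi / 2 : ℂ)
  refine ((h1.const_sub (Real.log (2 * Real.pi) : ℂ)).add h3).congr_deriv ?_
  field_simp
  ring

theorem norm_deriv_zetaReflectionLogDeriv_le {z : ℂ} (hz : z.re < 1) (him : 4 ≤ z.im) :
    ‖deriv zetaReflectionLogDeriv z‖ ≤ 9 / z.im := by
  have him0 : 0 < z.im := by linarith
  rw [(hasDerivAt_zetaReflectionLogDeriv hz him0.ne').deriv]
  have h1 : ‖deriv digamma (1 - z)‖ ≤ 8 / z.im := by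
    have := norm_deriv_digamma_le (s := 1 - z) (by simp; linarith)
      (by simp; exact him.trans (le_abs_self _))
    simpa [abs_of_pos him0] using this
  have h2 := abs_im_le_norm_cos (Real.pi * (1 - z) / 2)
  have hpi := Real.pi_pos
  rw [im_pi_mul_one_sub_div_two, abs_neg, abs_of_pos (by positivity)] at h2
  have h3 : ‖(Real.pi / 2 : ℂ) ^ 2 / Complex.cos (Real.pi * (1 - z) / 2) ^ 2‖ ≤ 1 / z.im := by
    rw [norm_div, norm_pow, norm_pow, show (Real.pi / 2 : ℂ) = ((Real.pi / 2 : ℝ) : ℂ) by simp,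
      norm_real, Real.norm_of_nonneg (by positivity)]
    calc _ ≤ (Real.pi / 2) ^ 2 / (Real.pi * z.im / 2) ^ 2 := by gcongr
      _ = 1 / z.im ^ 2 := by field_simp
      _ ≤ 1 / z.im := by
        apply one_div_le_one_div_of_le him0; nlinarith
  refine (norm_sub_le _ _).trans ((add_le_add h1 h3).trans (le_of_eq ?_))
  rw [← add_div]; norm_num

theorem norm_exp_I_mul_mul (ℓ t : ℝ) : ‖Complex.exp (I * ℓ * t)‖ = 1 := by
  rw [show I * ℓ * t = ((ℓ * t : ℝ) : ℂ) * I by push_cast; ring, norm_exp_ofReal_mul_I]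

theorem continuous_exp_I_mul_mul (ℓ : ℝ) : Continuous (fun t : ℝ => Complex.exp (I * ℓ * t)) := by
  fun_prop

theorem norm_integral_exp_I_mul_le {ℓ : ℝ} (hℓ : ℓ ≠ 0) (u v : ℝ) :
    ‖∫ t in u..v, Complex.exp (I * ℓ * t)‖ ≤ 2 / |ℓ| := by
  have hc : I * ℓ ≠ 0 := mul_ne_zero I_ne_zero (ofReal_ne_zero.2 hℓ)
  rw [integral_exp_mul_complex hc, norm_div, norm_mul, norm_I, one_mul, norm_real,
    Real.norm_eq_abs]
  gcongr
  refine (norm_sub_le _ _).trans ?_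
  rw [norm_exp_I_mul_mul, norm_exp_I_mul_mul]
  norm_num

theorem norm_integral_exp_I_mul_le_sub (ℓ : ℝ) {u v : ℝ} (huv : u ≤ v) :
    ‖∫ t in u..v, Complex.exp (I * ℓ * t)‖ ≤ v - u := by
  have := intervalIntegral.norm_integral_le_of_norm_le_const (a := u) (b := v) (C := 1)
    (f := fun t : ℝ => Complex.exp (I * ℓ * t)) fun t _ => (norm_exp_I_mul_mul ℓ t).le
  rwa [one_mul, abs_of_nonneg (sub_nonneg.2 huv)] at this

theorem cpow_add_ofReal_mul_I {x : ℝ} (hx : 0 < x) (a t : ℝ) :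
    (x : ℂ) ^ (a + t * I : ℂ) = ((x ^ a : ℝ) : ℂ) * Complex.exp (I * (Real.log x : ℝ) * t) := by
  have hxc : (x : ℂ) ≠ 0 := ofReal_ne_zero.2 hx.ne'
  rw [cpow_add _ _ hxc, ofReal_cpow hx.le, cpow_def_of_ne_zero hxc (t * I), ofReal_log hx.le]
  congr 2
  ring

/-- Bounds for an oscillatory integral whose amplitude has derivative `O(1 / t)`. -/
theorem norm_integral_exp_mul_le {g g' : ℝ → ℂ} {u v K A ℓ : ℝ} (hu : 1 ≤ u) (huv : u ≤ v)
    (hK : 0 ≤ K) (hℓ : 0 < ℓ) (hg : ∀ t ∈ Set.Icc u v, HasDerivAt g (g' t) t)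
    (hg' : ContinuousOn g' (Set.Icc u v)) (hb : ∀ t ∈ Set.Icc u v, ‖g' t‖ ≤ K / t)
    (hA : ‖g u‖ ≤ A) :
    ‖∫ t in u..v, Complex.exp (I * ℓ * t) * g t‖ ≤
      3 * min (v * (A + K * Real.log v)) ((A + K * Real.log v) / ℓ) := by
  have hA0 : 0 ≤ A := (norm_nonneg _).trans hA
  have hu0 : 0 < u := by linarith
  have hlv : 0 ≤ Real.log v := Real.log_nonneg (by linarith)
  have hu' : Set.uIcc u v = Set.Icc u v := Set.uIcc_of_le huv
  have hint : ∀ w ∈ Set.Icc u v, ‖∫ t in u..w, g' t‖ ≤ K * Real.log v ∧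
      ∫ t in u..w, ‖g' t‖ ≤ K * Real.log v := by
    intro w hw
    have hsub : Set.Icc u w ⊆ Set.Icc u v := Set.Icc_subset_Icc_right hw.2
    have huw : Set.uIcc u w = Set.Icc u w := Set.uIcc_of_le hw.1
    have i1 : IntervalIntegrable (fun t => ‖g' t‖) MeasureTheory.volume u w := by
      refine ContinuousOn.intervalIntegrable ?_
      rw [huw]; exact (hg'.mono hsub).norm
    have i2 : IntervalIntegrable (fun t => K / t) MeasureTheory.volume u w := by
      refine ContinuousOn.intervalIntegrable ?_
      rw [huw]
      exact continuousOn_const.div continuousOn_id fun t ht => by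
        have := ht.1; exact ne_of_gt (by linarith)
    have h1 : ∫ t in u..w, ‖g' t‖ ≤ ∫ t in u..w, K / t :=
      intervalIntegral.integral_mono_on hw.1 i1 i2 fun t ht => hb t (hsub ht)
    have h2 : ∫ t in u..w, K / t = K * Real.log (w / u) := by
      simp_rw [div_eq_mul_inv K]
      rw [intervalIntegral.integral_const_mul, integral_inv_of_pos hu0 (by linarith [hw.1])]
    have h3 : Real.log (w / u) ≤ Real.log v := by
      refine Real.log_le_log (div_pos (by linarith [hw.1]) hu0) ?_
      rw [div_le_iff₀ hu0]
      have := hw.2; have := hw.1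
      nlinarith
    have h4 : ∫ t in u..w, ‖g' t‖ ≤ K * Real.log v := by
      rw [h2] at h1
      exact h1.trans (by gcongr)
    exact ⟨(intervalIntegral.norm_integral_le_integral_norm hw.1).trans h4, h4⟩
  have ig' : IntervalIntegrable g' MeasureTheory.volume u v :=
    ContinuousOn.intervalIntegrable (by rwa [hu'])
  have hgB : ∀ w ∈ Set.Icc u v, ‖g w‖ ≤ A + K * Real.log v := by
    intro w hw
    have hsub : Set.uIcc u w ⊆ Set.Icc u v := by
      rw [Set.uIcc_of_le hw.1]; exact Set.Icc_subset_Icc_right hw.2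
    have := intervalIntegral.integral_eq_sub_of_hasDerivAt (fun t ht => hg t (hsub ht))
      ((hg'.mono hsub).intervalIntegrable)
    have e : g w = g u + ∫ t in u..w, g' t := by rw [this]; ring
    rw [e]
    exact (norm_add_le _ _).trans (add_le_add hA (hint w hw).1)
  set B := A + K * Real.log v with hB
  have hB0 : 0 ≤ B := by positivity
  rw [mul_min_of_nonneg _ _ (by norm_num : (0 : ℝ) ≤ 3)]
  refine le_min ?_ ?_
  · have := intervalIntegral.norm_integral_le_of_norm_le_const (a := u) (b := v) (C := B)
      (f := fun t : ℝ => Complex.exp (I * ℓ * t) * g t) fun t ht => by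
        rw [Set.uIoc_of_le huv] at ht
        rw [norm_mul, norm_exp_I_mul_mul, one_mul]
        exact hgB t ⟨ht.1.le, ht.2⟩
    rw [abs_of_nonneg (sub_nonneg.2 huv)] at this
    nlinarith
  · have hc : I * ℓ ≠ 0 := mul_ne_zero I_ne_zero (ofReal_ne_zero.2 hℓ.ne')
    have hE : ∀ t ∈ Set.uIcc u v, HasDerivAt (fun t : ℝ => Complex.exp (I * ℓ * t) / (I * ℓ))
        (Complex.exp (I * ℓ * t)) t := by
      intro t _
      have h1 : HasDerivAt (fun t : ℝ => I * ℓ * (t : ℂ)) (I * ℓ) t := by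
        simpa using (hasDerivAt_id t).ofReal_comp.const_mul (I * ℓ)
      have := (h1.cexp).div_const (I * ℓ)
      rwa [mul_div_cancel_right₀ _ hc] at this
    have parts := intervalIntegral.integral_deriv_mul_eq_sub hE (fun t ht => hg t (hu' ▸ ht))
      ((continuous_exp_I_mul_mul ℓ).intervalIntegrable _ _) ig'
    have iEg : IntervalIntegrable (fun t : ℝ => Complex.exp (I * ℓ * t) * g t)
        MeasureTheory.volume u v := by
      refine ContinuousOn.intervalIntegrable ?_
      rw [hu']
      exact (continuous_exp_I_mul_mul ℓ).continuousOn.mul fun t ht =>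
        (hg t ht).continuousAt.continuousWithinAt
    have iEg' : IntervalIntegrable (fun t : ℝ => Complex.exp (I * ℓ * t) / (I * ℓ) * g' t)
        MeasureTheory.volume u v := by
      refine ContinuousOn.intervalIntegrable ?_
      rw [hu']
      exact ((continuous_exp_I_mul_mul ℓ).div_const _).continuousOn.mul hg'
    rw [intervalIntegral.integral_add iEg iEg'] at parts
    have nE : ∀ t : ℝ, ‖Complex.exp (I * ℓ * t) / (I * ℓ)‖ = 1 / ℓ := by
      intro t
      rw [norm_div, norm_exp_I_mul_mul, norm_mul, norm_I, one_mul, norm_real,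
        Real.norm_of_nonneg hℓ.le]
    have b1 : ‖∫ t in u..v, Complex.exp (I * ℓ * t) / (I * ℓ) * g' t‖ ≤ 1 / ℓ * (K * Real.log v) := by
      refine (intervalIntegral.norm_integral_le_integral_norm huv).trans ?_
      simp_rw [norm_mul, nE]
      rw [intervalIntegral.integral_const_mul]
      gcongr
      exact (hint v ⟨huv, le_rfl⟩).2
    have b2 : ∀ t ∈ Set.Icc u v, ‖Complex.exp (I * ℓ * t) / (I * ℓ) * g t‖ ≤ 1 / ℓ * B := by
      intro t ht
      rw [norm_mul, nE]
      gcongr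
      exact hgB t ht
    have e : ∫ t in u..v, Complex.exp (I * ℓ * t) * g t =
        Complex.exp (I * ℓ * v) / (I * ℓ) * g v - Complex.exp (I * ℓ * u) / (I * ℓ) * g u -
        ∫ t in u..v, Complex.exp (I * ℓ * t) / (I * ℓ) * g' t := by
      rw [← parts]; ring
    rw [e]
    refine (norm_sub_le _ _).trans ((add_le_add ((norm_sub_le _ _).trans
      (add_le_add (b2 v ⟨huv, le_rfl⟩) (b2 u ⟨le_rfl, huv⟩))) b1).trans ?_)
    have : 1 / ℓ * (K * Real.log v) ≤ 1 / ℓ * B := by gcongr; linarith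
    rw [show 3 * (B / ℓ) = 1 / ℓ * B + 1 / ℓ * B + 1 / ℓ * B by ring]
    linarith

theorem hasSum_integral_exp {c : ℕ → ℂ} (hc : Summable fun n => ‖c n‖) (ℓ : ℕ → ℝ) (u v : ℝ) :
    HasSum (fun n => c n * ∫ t in u..v, Complex.exp (I * ℓ n * t))
      (∫ t in u..v, ∑' n, c n * Complex.exp (I * ℓ n * t)) := by
  have := intervalIntegral.hasSum_intervalIntegral_of_summable_norm (a := u) (b := v)
    (f := fun n => ⟨fun t : ℝ => c n * Complex.exp (I * ℓ n * t),
      (continuous_exp_I_mul_mul (ℓ n)).const_mul (c n)⟩) (by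
      refine Summable.of_nonneg_of_le (fun _ => norm_nonneg _) (fun n => ?_) hc
      refine (ContinuousMap.norm_le _ (norm_nonneg _)).2 fun t => ?_
      simp only [ContinuousMap.restrict_apply, ContinuousMap.coe_mk]
      rw [norm_mul, norm_exp_I_mul_mul, mul_one])
  simp only [ContinuousMap.coe_mk, intervalIntegral.integral_const_mul] at this
  exact this

theorem summable_vonMangoldt_div_rpow {b : ℝ} (hb : 1 < b) :
    Summable fun n : ℕ => ArithmeticFunction.vonMangoldt n / (n : ℝ) ^ b := by
  have := (ArithmeticFunction.LSeriesSummable_vonMangoldt (s := (b : ℂ)) (by simpa)).norm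
  refine this.congr fun n => ?_
  rcases eq_or_ne n 0 with rfl | hn
  · simp
  · rw [LSeries.term_of_ne_zero hn, norm_div, norm_real,
      Real.norm_of_nonneg ArithmeticFunction.vonMangoldt_nonneg, norm_natCast_cpow_of_pos (by omega),
      ofReal_re]

theorem logDeriv_riemannZeta_eq_neg_tsum {b : ℝ} (hb : 1 < b) (t : ℝ) :
    deriv riemannZeta (b + t * I) / riemannZeta (b + t * I) =
      -∑' n : ℕ, ((ArithmeticFunction.vonMangoldt n / (n : ℝ) ^ b : ℝ) : ℂ) *
        Complex.exp (I * (-Real.log n : ℝ) * t) := by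
  have h := ArithmeticFunction.LSeries_vonMangoldt_eq_deriv_riemannZeta_div (s := b + t * I)
    (by simpa)
  rw [neg_div] at h
  rw [← neg_eq_iff_eq_neg, ← h, LSeries]
  refine tsum_congr fun n => ?_
  rcases eq_or_ne n 0 with rfl | hn
  · simp
  · have hn' : (0 : ℝ) < n := by exact_mod_cast Nat.pos_of_ne_zero hn
    have e := cpow_add_ofReal_mul_I hn' b t
    rw [LSeries.term_of_ne_zero hn, ← ofReal_natCast n, e, ofReal_div, div_mul_eq_div_div,
      div_eq_mul_inv _ (Complex.exp _), ← Complex.exp_neg]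
    congr 2
    push_cast
    ring

theorem exists_norm_integral_left_le {δ t₀ : ℝ} (hδ : 0 < δ) (ht₀ : 5 ≤ t₀) :
    ∃ C, 0 < C ∧ ∀ x v : ℝ, 1 < x → t₀ ≤ v →
      ‖∫ t : ℝ in t₀..v, (x : ℂ) ^ ((-δ : ℝ) + t * I : ℂ) *
        (deriv riemannZeta ((-δ : ℝ) + t * I) / riemannZeta ((-δ : ℝ) + t * I))‖ ≤
      C * (min (v * Real.log v) (Real.log v / Real.log x) + 1) := by
  set g : ℝ → ℂ := fun t => zetaReflectionLogDeriv ((-δ : ℝ) + t * I) with hg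
  set S : ℝ := ∑' n : ℕ, ArithmeticFunction.vonMangoldt n / (n : ℝ) ^ (1 + δ) with hS
  have hSs := summable_vonMangoldt_div_rpow (b := 1 + δ) (by linarith)
  have hcnn : ∀ n : ℕ, 0 ≤ ArithmeticFunction.vonMangoldt n / (n : ℝ) ^ (1 + δ) := fun n =>
    div_nonneg ArithmeticFunction.vonMangoldt_nonneg (by positivity)
  have hS0 : 0 ≤ S := tsum_nonneg hcnn
  have hl2 : 0 < Real.log 2 := Real.log_pos (by norm_num)
  refine ⟨3 * (‖g t₀‖ + 9) + 2 / Real.log 2 * S, by positivity, fun x v hx hv => ?_⟩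
  have hx0 : 0 < x := by linarith
  have hlx : 0 < Real.log x := Real.log_pos hx
  have hlv : 1 ≤ Real.log v := by
    rw [Real.le_log_iff_exp_le (by linarith)]
    have := Real.exp_one_lt_d9
    linarith
  have hdg : ∀ t ∈ Set.Icc t₀ v, HasDerivAt g
      (deriv zetaReflectionLogDeriv ((-δ : ℝ) + t * I) * I) t := by
    intro t ht
    have h1 : HasDerivAt (fun t : ℝ => ((-δ : ℝ) : ℂ) + t * I) I t := by
      simpa using ((hasDerivAt_id t).ofReal_comp.mul_const I).const_add ((-δ : ℝ) : ℂ)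
    have h2 := (hasDerivAt_zetaReflectionLogDeriv (z := ((-δ : ℝ) : ℂ) + t * I)
      (by simp; linarith) (by simp; linarith [ht.1])).differentiableAt.hasDerivAt
    exact h2.comp t h1
  have hopen : IsOpen {z : ℂ | z.re < 1 ∧ 0 < z.im} :=
    (isOpen_lt continuous_re continuous_const).inter (isOpen_lt continuous_const continuous_im)
  have hdd : DifferentiableOn ℂ zetaReflectionLogDeriv {z : ℂ | z.re < 1 ∧ 0 < z.im} := fun z hz =>
    (hasDerivAt_zetaReflectionLogDeriv hz.1 hz.2.ne').differentiableAt.differentiableWithinAt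
  have hgc : ContinuousOn (fun t : ℝ => deriv zetaReflectionLogDeriv ((-δ : ℝ) + t * I) * I)
      (Set.Icc t₀ v) := by
    refine ContinuousOn.mul ?_ continuousOn_const
    refine (hdd.deriv hopen).continuousOn.comp (by fun_prop) fun t ht => ?_
    have := ht.1
    exact ⟨by simp; linarith, by simp; linarith⟩
  have hmain := norm_integral_exp_mul_le (g := g) (K := 9) (A := ‖g t₀‖) (by linarith) hv
    (by norm_num) hlx hdg hgc (fun t ht => by
      have := ht.1
      rw [norm_mul, norm_I, mul_one]
      have := norm_deriv_zetaReflectionLogDeriv_le (z := ((-δ : ℝ) : ℂ) + t * I)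
        (by simp; linarith) (by simp; linarith)
      simpa using this) le_rfl
  set c : ℕ → ℂ := fun n => ((ArithmeticFunction.vonMangoldt n / (n : ℝ) ^ (1 + δ) : ℝ) : ℂ)
    with hc
  have hcn : ∀ n, ‖c n‖ = ArithmeticFunction.vonMangoldt n / (n : ℝ) ^ (1 + δ) := fun n => by
    rw [hc]; simp only [norm_real]; rw [Real.norm_of_nonneg (hcnn n)]
  have hcs : Summable fun n => ‖c n‖ := by simp_rw [hcn]; exact hSs
  set ℓ : ℕ → ℝ := fun n => Real.log x + Real.log n with hℓ
  have hsum := hasSum_integral_exp hcs ℓ t₀ v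
  have hpt : ∀ t ∈ Set.uIcc t₀ v, (x : ℂ) ^ ((-δ : ℝ) + t * I : ℂ) *
      (deriv riemannZeta ((-δ : ℝ) + t * I) / riemannZeta ((-δ : ℝ) + t * I)) =
      ((x ^ (-δ) : ℝ) : ℂ) * (Complex.exp (I * (Real.log x : ℝ) * t) * g t +
        ∑' n, c n * Complex.exp (I * ℓ n * t)) := by
    intro t ht
    rw [Set.uIcc_of_le hv] at ht
    have := ht.1
    rw [logDeriv_riemannZeta_eq_reflection (by simpa) (by simp; linarith),
      cpow_add_ofReal_mul_I hx0]
    have e : (1 - (((-δ : ℝ) : ℂ) + t * I)) = ((1 + δ : ℝ) : ℂ) + ((-t : ℝ) : ℂ) * I := by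
      push_cast; ring
    rw [e, logDeriv_riemannZeta_eq_neg_tsum (by linarith), sub_neg_eq_add, mul_assoc, mul_add,
      ← tsum_mul_left]
    congr 2
    refine tsum_congr fun n => ?_
    rw [mul_left_comm, ← Complex.exp_add]
    congr 2
    simp only [hℓ]
    push_cast
    ring
  rw [intervalIntegral.integral_congr hpt, intervalIntegral.integral_const_mul]
  have hgcont : ContinuousOn g (Set.Icc t₀ v) := fun t ht =>
    (hdg t ht).continuousAt.continuousWithinAt
  have hcsum : Continuous fun t : ℝ => ∑' n, c n * Complex.exp (I * ℓ n * t) :=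
    continuous_tsum (fun n => (continuous_exp_I_mul_mul (ℓ n)).const_mul (c n)) hcs fun n t => by
      rw [norm_mul, norm_exp_I_mul_mul, mul_one]
  rw [intervalIntegral.integral_add
    (ContinuousOn.intervalIntegrable (by
      rw [Set.uIcc_of_le hv]
      exact (continuous_exp_I_mul_mul _).continuousOn.mul hgcont))
    (hcsum.intervalIntegrable _ _), ← hsum.tsum_eq, norm_mul, norm_real,
    Real.norm_of_nonneg (by positivity)]
  have hx1 : x ^ (-δ) ≤ 1 := Real.rpow_le_one_of_one_le_of_nonpos hx.le (by linarith)
  have hterm : ∀ n, ‖c n * ∫ t in t₀..v, Complex.exp (I * ℓ n * t)‖ ≤ 2 / Real.log 2 *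
      (ArithmeticFunction.vonMangoldt n / (n : ℝ) ^ (1 + δ)) := by
    intro n
    rw [norm_mul, hcn, mul_comm]
    rcases lt_or_ge n 2 with hn | hn
    · interval_cases n <;> simp
    · have h2 : Real.log 2 ≤ ℓ n := by
        have : Real.log 2 ≤ Real.log n := Real.log_le_log (by norm_num) (by exact_mod_cast hn)
        simp only [hℓ]; linarith
      have hp : 0 < ℓ n := by linarith
      refine mul_le_mul_of_nonneg_right ?_ (hcnn n)
      refine (norm_integral_exp_I_mul_le hp.ne' t₀ v).trans ?_
      rw [abs_of_pos hp]
      gcongr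
  have hD : ‖∑' n, c n * ∫ t in t₀..v, Complex.exp (I * ℓ n * t)‖ ≤ 2 / Real.log 2 * S := by
    have := tsum_of_norm_bounded (hSs.mul_left (2 / Real.log 2)).hasSum hterm
    rwa [tsum_mul_left] at this
  have hm0 : 0 ≤ min (v * Real.log v) (Real.log v / Real.log x) :=
    le_min (mul_nonneg (by linarith) (by linarith)) (by positivity)
  have hmin : min (v * (‖g t₀‖ + 9 * Real.log v)) ((‖g t₀‖ + 9 * Real.log v) / Real.log x) ≤
      (‖g t₀‖ + 9) * min (v * Real.log v) (Real.log v / Real.log x) := by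
    rw [mul_min_of_nonneg _ _ (by positivity : 0 ≤ ‖g t₀‖ + 9)]
    have hk : ‖g t₀‖ + 9 * Real.log v ≤ (‖g t₀‖ + 9) * Real.log v := by
      nlinarith [norm_nonneg (g t₀)]
    refine min_le_min ?_ ?_
    · rw [mul_left_comm]
      exact mul_le_mul_of_nonneg_left hk (by linarith)
    · rw [← mul_div_assoc]
      gcongr
  calc _ ≤ 1 * (3 * ((‖g t₀‖ + 9) * min (v * Real.log v) (Real.log v / Real.log x)) +
        2 / Real.log 2 * S) := by
        refine mul_le_mul hx1 ((norm_add_le _ _).trans (add_le_add (hmain.trans ?_) hD))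
          (norm_nonneg _) zero_le_one
        gcongr
    _ ≤ _ := by
        have : 0 ≤ 2 / Real.log 2 * S := by positivity
        nlinarith [norm_nonneg (g t₀)]

theorem abs_sub_div_add_le_abs_log_sub_log {a b : ℝ} (ha : 0 < a) (hb : 0 < b) :
    |a - b| / (a + b) ≤ |Real.log a - Real.log b| := by
  wlog h : b ≤ a generalizing a b
  · rw [abs_sub_comm, add_comm, abs_sub_comm (Real.log a)]
    exact this hb ha (not_le.1 h).le
  · have h1 : 1 - b / a ≤ Real.log a - Real.log b := by
      have := Real.one_sub_inv_le_log_of_pos (div_pos ha hb)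
      rwa [inv_div, Real.log_div ha.ne' hb.ne'] at this
    rw [abs_of_nonneg (sub_nonneg.2 h)]
    refine le_trans ?_ (h1.trans (le_abs_self _))
    rw [div_le_iff₀ (by linarith), show (1 - b / a) * (a + b) = (a - b) + b * (a - b) / a by
      field_simp]
    have : 0 ≤ b * (a - b) / a := div_nonneg (mul_nonneg hb.le (by linarith)) ha.le
    linarith

theorem abs_natCast_sub_le_two_mul {x : ℝ} {nx n : ℕ} (h : |x - nx| ≤ 1 / 2) (hn : n ≠ nx) :
    |(n : ℝ) - nx| ≤ 2 * |x - n| := by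
  have h1 : (1 : ℝ) ≤ |(n : ℝ) - nx| := by
    have : (1 : ℤ) ≤ |(n : ℤ) - nx| := Int.one_le_abs (sub_ne_zero.2 (by exact_mod_cast hn))
    exact_mod_cast this
  have h2 : |(n : ℝ) - nx| ≤ |x - n| + |x - nx| := by
    rw [abs_sub_comm x n]
    have := abs_add_le ((n : ℝ) - x) (x - nx)
    rwa [sub_add_sub_cancel] at this
  linarith

theorem two_div_abs_log_sub_log_le {x : ℝ} {nx n : ℕ} (hx : 0 < x) (h : |x - nx| ≤ 1 / 2)
    (hn0 : 0 < n) (hn : n ≠ nx) :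
    Real.log x - Real.log n ≠ 0 ∧
      2 / |Real.log x - Real.log n| ≤ 4 * (x + n) / |(n : ℝ) - nx| := by
  have hnp : (0 : ℝ) < n := by exact_mod_cast hn0
  have h1 := abs_natCast_sub_le_two_mul h hn
  have h2 := abs_sub_div_add_le_abs_log_sub_log hx hnp
  have h0 : 0 < |(n : ℝ) - nx| := abs_pos.2 (sub_ne_zero.2 (by exact_mod_cast hn))
  have h3 : |(n : ℝ) - nx| / (2 * (x + n)) ≤ |Real.log x - Real.log n| := by
    refine le_trans ?_ h2
    rw [div_le_div_iff₀ (by positivity) (by positivity)]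
    nlinarith
  have h4 : 0 < |(n : ℝ) - nx| / (2 * (x + n)) := by positivity
  refine ⟨abs_pos.1 (h4.trans_le h3), ?_⟩
  calc 2 / |Real.log x - Real.log n| ≤ 2 / (|(n : ℝ) - nx| / (2 * (x + n))) := by gcongr
    _ = _ := by field_simp; ring

/-- The weight of the `n`-th off-diagonal term splits into a convergent Dirichlet series part and
a part decaying with the distance of `n` to the nearest integer of `x`. -/
theorem vonMangoldt_mul_div_abs_sub_le {x δ : ℝ} {nx n : ℕ} (hx : 1 < x) (hδ : 0 < δ)
    (h : |x - nx| ≤ 1 / 2) (hn : n ≠ nx) :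
    ArithmeticFunction.vonMangoldt n / (n : ℝ) ^ (1 + δ) * (4 * (x + n) / |(n : ℝ) - nx|) ≤
      16 * (ArithmeticFunction.vonMangoldt n / (n : ℝ) ^ (1 + δ)) +
        16 / δ * (2 * x) ^ δ * (1 / |(n : ℝ) - nx| ^ (1 + δ)) := by
  have hL : 0 ≤ ArithmeticFunction.vonMangoldt n / (n : ℝ) ^ (1 + δ) :=
    div_nonneg ArithmeticFunction.vonMangoldt_nonneg (by positivity)
  have hR : 0 ≤ 16 / δ * (2 * x) ^ δ * (1 / |(n : ℝ) - nx| ^ (1 + δ)) := by positivity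
  rcases Nat.eq_zero_or_pos n with rfl | hn0
  · simp only [ArithmeticFunction.map_zero, zero_div, zero_mul, mul_zero, zero_add]
    exact hR
  have hnp : (1 : ℝ) ≤ n := by exact_mod_cast hn0
  have hd : 0 < |(n : ℝ) - nx| := abs_pos.2 (sub_ne_zero.2 (by exact_mod_cast hn))
  have hx1 := abs_le.1 h
  have hnx1 : 1 ≤ nx := by
    by_contra hc
    have : nx = 0 := by omega
    subst this
    norm_num at hx1
    linarith
  have hnx : (1 : ℝ) ≤ nx := by exact_mod_cast hnx1
  by_cases hfar : x + n ≤ 4 * |(n : ℝ) - nx|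
  · have h4 : 4 * (x + n) / |(n : ℝ) - nx| ≤ 16 := by
      rw [div_le_iff₀ hd]; linarith
    have := mul_le_mul_of_nonneg_left h4 hL
    linarith
  · rw [not_le] at hfar
    have hn4 : (nx : ℝ) ≤ 2 * n ∧ |(n : ℝ) - nx| ≤ 2 * x ∧ x + n ≤ 4 * n := by
      rcases abs_cases ((n : ℝ) - nx) with ⟨e, h0⟩ | ⟨e, h0⟩ <;> rw [e] at hfar ⊢
      · have : (nx : ℝ) + 1 ≤ n := by
          have : nx < n := lt_of_le_of_ne (by exact_mod_cast (sub_nonneg.1 h0)) (Ne.symm hn)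
          exact_mod_cast this
        refine ⟨by linarith, by linarith, by linarith⟩
      · refine ⟨by linarith, by linarith, by linarith⟩
    obtain ⟨h1, h2, h3⟩ := hn4
    have hΛ : ArithmeticFunction.vonMangoldt n ≤ (n : ℝ) ^ δ / δ :=
      ArithmeticFunction.vonMangoldt_le_log.trans (Real.log_le_rpow_div (by linarith) hδ)
    have hn1 : (n : ℝ) ^ (1 + δ) = n * (n : ℝ) ^ δ := by
      rw [Real.rpow_add (by linarith), Real.rpow_one]
    have hd1 : |(n : ℝ) - nx| ^ (1 + δ) = |(n : ℝ) - nx| * |(n : ℝ) - nx| ^ δ := by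
      rw [Real.rpow_add hd, Real.rpow_one]
    have hΛ' : ArithmeticFunction.vonMangoldt n / (n : ℝ) ^ (1 + δ) ≤ 1 / (δ * n) := by
      rw [div_le_div_iff₀ (by positivity) (by positivity), hn1]
      rw [le_div_iff₀ hδ] at hΛ
      nlinarith
    have hA : 4 * (x + n) / |(n : ℝ) - nx| ≤ 16 * n / |(n : ℝ) - nx| := by
      exact div_le_div_of_nonneg_right (by linarith) hd.le
    have hB : |(n : ℝ) - nx| ^ δ ≤ (2 * x) ^ δ := Real.rpow_le_rpow hd.le h2 hδ.le
    have hC : 1 / |(n : ℝ) - nx| ≤ (2 * x) ^ δ * (1 / |(n : ℝ) - nx| ^ (1 + δ)) := by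
      rw [hd1, mul_one_div, div_le_div_iff₀ hd (by positivity)]
      nlinarith
    calc _ ≤ 1 / (δ * n) * (16 * n / |(n : ℝ) - nx|) := by gcongr
      _ = 16 / δ * (1 / |(n : ℝ) - nx|) := by field_simp
      _ ≤ 16 / δ * ((2 * x) ^ δ * (1 / |(n : ℝ) - nx| ^ (1 + δ))) := by
        gcongr
      _ ≤ _ := by rw [← mul_assoc]; linarith

theorem tsum_one_div_abs_sub_rpow_le {s : ℝ} (hs : 1 < s) (m : ℕ) :
    Summable (fun n : ℕ => 1 / |(n : ℝ) - m| ^ s) ∧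
      ∑' n : ℕ, 1 / |(n : ℝ) - m| ^ s ≤ ∑' k : ℤ, 1 / |(k : ℝ)| ^ s := by
  have h : Summable fun k : ℤ => 1 / |(k : ℝ)| ^ s := by
    have := (Real.summable_one_div_int_add_rpow 0 s).2 hs
    simpa using this
  have hi : Function.Injective fun n : ℕ => (n : ℤ) - m := fun a b hab => by
    simpa using hab
  have e : (fun n : ℕ => 1 / |(n : ℝ) - m| ^ s) =
      (fun k : ℤ => 1 / |(k : ℝ)| ^ s) ∘ fun n : ℕ => (n : ℤ) - m := by
    ext n; simp
  rw [e]
  exact ⟨h.comp_injective hi, tsum_comp_le_tsum_of_inj h (fun k => by positivity) hi⟩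

theorem landauFactor_eq_integral {x : ℝ} {nx : ℕ} (hx : 0 < x) (hnx : 0 < nx) (v : ℝ) :
    landauFactor x v nx =
      ∫ t in (0 : ℝ)..v, Complex.exp (I * (Real.log x - Real.log nx : ℝ) * t) := by
  have hn : (0 : ℝ) < nx := by exact_mod_cast hnx
  rw [landauFactor]
  split_ifs with h
  · simp [h]
  · have hne : Real.log x - Real.log nx ≠ 0 := sub_ne_zero.2 fun hh =>
      h (Real.log_injOn_pos (Set.mem_Ioi.2 hx) (Set.mem_Ioi.2 hn) hh)
    rw [integral_exp_mul_complex (mul_ne_zero I_ne_zero (ofReal_ne_zero.2 hne)),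
      Real.log_div hx.ne' hn.ne']
    simp only [ofReal_zero, mul_zero, Complex.exp_zero]
    congr 3
    ring

theorem one_le_of_abs_sub_natCast_le {x : ℝ} {nx : ℕ} (hx : 1 < x) (h : |x - nx| ≤ 1 / 2) :
    1 ≤ nx := by
  by_contra hc
  have h0 : nx = 0 := by omega
  subst h0
  have := (abs_le.1 h).2
  norm_num at this
  linarith

theorem vonMangoldt_le_log_two_mul {x : ℝ} {nx : ℕ} (hx : 1 < x) (h : |x - nx| ≤ 1 / 2) :
    ArithmeticFunction.vonMangoldt nx ≤ Real.log (2 * x) := by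
  have h1 : (1 : ℝ) ≤ nx := by exact_mod_cast one_le_of_abs_sub_natCast_le hx h
  have := (abs_le.1 h).1
  exact ArithmeticFunction.vonMangoldt_le_log.trans
    (Real.log_le_log (by linarith) (by linarith))

theorem abs_log_sub_log_le_half {x : ℝ} {nx : ℕ} (hx : 1 < x) (h : |x - nx| ≤ 1 / 2) :
    |Real.log x - Real.log nx| ≤ 1 / 2 := by
  have h1 : (1 : ℝ) ≤ nx := by exact_mod_cast one_le_of_abs_sub_natCast_le hx h
  have h0 := abs_le.1 h
  rw [abs_le]
  constructor
  · have := Real.log_le_sub_one_of_pos (show (0 : ℝ) < nx / x by positivity)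
    rw [Real.log_div (by linarith) (by linarith)] at this
    have h2 : (nx : ℝ) / x ≤ 3 / 2 := by
      rw [div_le_iff₀ (by linarith)]; linarith
    linarith
  · have := Real.log_le_sub_one_of_pos (show (0 : ℝ) < x / nx by positivity)
    rw [Real.log_div (by linarith) (by linarith)] at this
    have h2 : x / nx ≤ 3 / 2 := by
      rw [div_le_iff₀ (by linarith)]; linarith
    linarith

/-- The term of the Dirichlet series at the nearest integer produces the main term. -/
theorem norm_diagonal_sub_landauFactor_le {x δ t₀ v : ℝ} {nx : ℕ} (hx : 1 < x) (hδ : 0 < δ)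
    (hδ1 : δ ≤ 1) (ht₀ : 0 ≤ t₀) (h : |x - nx| ≤ 1 / 2) :
    ‖((x ^ (1 + δ) * (ArithmeticFunction.vonMangoldt nx / (nx : ℝ) ^ (1 + δ)) : ℝ) : ℂ) *
        (∫ t in t₀..v, Complex.exp (I * (Real.log x - Real.log nx : ℝ) * t)) -
      ArithmeticFunction.vonMangoldt nx * landauFactor x v nx‖ ≤
      (8 + t₀) * Real.log (2 * x) := by
  have hx0 : 0 < x := by linarith
  have hnx := one_le_of_abs_sub_natCast_le hx h
  have hn : (0 : ℝ) < nx := by exact_mod_cast hnx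
  set u := Real.log x - Real.log nx with hu
  set Λ := ArithmeticFunction.vonMangoldt nx with hΛ
  have hΛ0 : 0 ≤ Λ := ArithmeticFunction.vonMangoldt_nonneg
  have hΛl : Λ ≤ Real.log (2 * x) := vonMangoldt_le_log_two_mul hx h
  set J : ℂ := ∫ t in t₀..v, Complex.exp (I * u * t) with hJ
  set J₀ : ℂ := ∫ t in (0 : ℝ)..t₀, Complex.exp (I * u * t) with hJ0
  have hLF : landauFactor x v nx = J₀ + J := by
    rw [landauFactor_eq_integral hx0 hnx, hJ, hJ0]
    exact (intervalIntegral.integral_add_adjacent_intervals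
      ((continuous_exp_I_mul_mul u).intervalIntegrable _ _)
      ((continuous_exp_I_mul_mul u).intervalIntegrable _ _)).symm
  have hJ0' : ‖J₀‖ ≤ t₀ := by simpa using norm_integral_exp_I_mul_le_sub u ht₀
  have hr : x ^ (1 + δ) * (Λ / (nx : ℝ) ^ (1 + δ)) = Λ * Real.exp ((1 + δ) * u) := by
    rw [mul_div_left_comm, ← Real.div_rpow hx0.le hn.le, Real.rpow_def_of_pos (by positivity),
      Real.log_div hx0.ne' hn.ne', mul_comm (1 + δ)]
  have hEJ : ‖((Real.exp ((1 + δ) * u) - 1 : ℝ) : ℂ) * J‖ ≤ 8 := by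
    rcases eq_or_ne u 0 with h0 | h0
    · simp [h0]
    · have h1 := abs_log_sub_log_le_half hx h
      have h2 : |(1 + δ) * u| ≤ 2 * |u| := by
        rw [abs_mul, abs_of_pos (by linarith : 0 < 1 + δ)]
        gcongr; linarith
      have h3 := Real.abs_exp_sub_one_le (x := (1 + δ) * u) (by linarith)
      rw [norm_mul, norm_real, Real.norm_eq_abs]
      calc _ ≤ (2 * (2 * |u|)) * (2 / |u|) :=
            mul_le_mul (by linarith) (norm_integral_exp_I_mul_le h0 t₀ v) (norm_nonneg _)
              (by positivity)
        _ = 8 := by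
            have : |u| ≠ 0 := abs_ne_zero.2 h0
            field_simp
            norm_num
  have e : ((x ^ (1 + δ) * (Λ / (nx : ℝ) ^ (1 + δ)) : ℝ) : ℂ) * J - Λ * landauFactor x v nx =
      Λ * (((Real.exp ((1 + δ) * u) - 1 : ℝ) : ℂ) * J - J₀) := by
    rw [hr, hLF]; push_cast; ring
  rw [e, norm_mul, norm_real, Real.norm_of_nonneg hΛ0, mul_comm]
  exact mul_le_mul ((norm_sub_le _ _).trans (add_le_add hEJ hJ0')) hΛl hΛ0 (by linarith)

theorem exists_norm_integral_right_add_le {δ t₀ : ℝ} (hδ : 0 < δ) (hδ1 : δ ≤ 1) (ht₀ : 0 ≤ t₀) :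
    ∃ C, 0 < C ∧ ∀ x v : ℝ, 1 < x → t₀ ≤ v → ∀ nx : ℕ, |x - nx| ≤ 1 / 2 →
      ‖(∫ t : ℝ in t₀..v, (x : ℂ) ^ ((1 + δ : ℝ) + t * I : ℂ) *
        (deriv riemannZeta ((1 + δ : ℝ) + t * I) / riemannZeta ((1 + δ : ℝ) + t * I))) +
        ArithmeticFunction.vonMangoldt nx * landauFactor x v nx‖ ≤
      C * (x ^ (1 + 2 * δ) * Real.log (2 * x)) := by
  set S : ℝ := ∑' n : ℕ, ArithmeticFunction.vonMangoldt n / (n : ℝ) ^ (1 + δ) with hS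
  set Z : ℝ := ∑' k : ℤ, 1 / |(k : ℝ)| ^ (1 + δ) with hZ
  have hSs := summable_vonMangoldt_div_rpow (b := 1 + δ) (by linarith)
  have hcnn : ∀ n : ℕ, 0 ≤ ArithmeticFunction.vonMangoldt n / (n : ℝ) ^ (1 + δ) := fun n =>
    div_nonneg ArithmeticFunction.vonMangoldt_nonneg (by positivity)
  have hS0 : 0 ≤ S := tsum_nonneg hcnn
  have hZ0 : 0 ≤ Z := tsum_nonneg fun k => by positivity
  have hl2 : 0 < Real.log 2 := Real.log_pos (by norm_num)
  set K : ℝ := 16 * S + 16 / δ * 2 ^ δ * Z with hK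
  have hK0 : 0 ≤ K := by positivity
  refine ⟨K / Real.log 2 + (8 + t₀), by positivity, fun x v hx hv nx h => ?_⟩
  have hx0 : 0 < x := by linarith
  set c : ℕ → ℂ := fun n =>
    ((x ^ (1 + δ) * (ArithmeticFunction.vonMangoldt n / (n : ℝ) ^ (1 + δ)) : ℝ) : ℂ) with hc
  have hcn : ∀ n, ‖c n‖ = x ^ (1 + δ) *
      (ArithmeticFunction.vonMangoldt n / (n : ℝ) ^ (1 + δ)) := fun n => by
    rw [hc]; simp only [norm_real]
    rw [Real.norm_of_nonneg (mul_nonneg (by positivity) (hcnn n))]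
  have hcs : Summable fun n => ‖c n‖ := by simp_rw [hcn]; exact hSs.mul_left _
  set ℓ : ℕ → ℝ := fun n => Real.log x - Real.log n with hℓ
  have hsum := hasSum_integral_exp hcs ℓ t₀ v
  have hpt : ∀ t ∈ Set.uIcc t₀ v, (x : ℂ) ^ ((1 + δ : ℝ) + t * I : ℂ) *
      (deriv riemannZeta ((1 + δ : ℝ) + t * I) / riemannZeta ((1 + δ : ℝ) + t * I)) =
      -∑' n, c n * Complex.exp (I * ℓ n * t) := by
    intro t _
    rw [cpow_add_ofReal_mul_I hx0, logDeriv_riemannZeta_eq_neg_tsum (by linarith), mul_neg,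
      ← tsum_mul_left]
    congr 1
    refine tsum_congr fun n => ?_
    simp only [hc, hℓ]
    rw [mul_mul_mul_comm, ← Complex.exp_add, ← ofReal_mul]
    congr 2
    push_cast
    ring
  rw [intervalIntegral.integral_congr hpt, intervalIntegral.integral_neg, ← hsum.tsum_eq,
    hsum.summable.tsum_eq_add_tsum_ite nx]
  set F : ℕ → ℂ := fun n => c n * ∫ t in t₀..v, Complex.exp (I * ℓ n * t) with hF
  have hdiag := norm_diagonal_sub_landauFactor_le (v := v) hx hδ hδ1 ht₀ h
  have hoff : ‖∑' n, if n = nx then 0 else F n‖ ≤ K * x ^ (1 + 2 * δ) := by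
    obtain ⟨hs1, hs2⟩ := tsum_one_div_abs_sub_rpow_le (s := 1 + δ) (by linarith) nx
    have hb : ∀ n, ‖if n = nx then 0 else F n‖ ≤ x ^ (1 + δ) *
        (16 * (ArithmeticFunction.vonMangoldt n / (n : ℝ) ^ (1 + δ)) +
        16 / δ * (2 * x) ^ δ * (1 / |(n : ℝ) - nx| ^ (1 + δ))) := by
      intro n
      split_ifs with hn
      · rw [norm_zero]
        have := hcnn n
        positivity
      · rw [hF]
        simp only [norm_mul, hcn, mul_assoc (x ^ (1 + δ))]
        refine mul_le_mul_of_nonneg_left ?_ (by positivity)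
        rcases Nat.eq_zero_or_pos n with rfl | hn0
        · simp only [ArithmeticFunction.map_zero, zero_div, zero_mul, mul_zero, zero_add]
          positivity
        obtain ⟨h1, h2⟩ := two_div_abs_log_sub_log_le hx0 h hn0 hn
        refine le_trans ?_ (vonMangoldt_mul_div_abs_sub_le hx hδ h hn)
        exact mul_le_mul_of_nonneg_left ((norm_integral_exp_I_mul_le h1 t₀ v).trans h2) (hcnn n)
    have := tsum_of_norm_bounded
      (((hSs.mul_left 16).add (hs1.mul_left (16 / δ * (2 * x) ^ δ))).mul_left
        (x ^ (1 + δ))).hasSum hb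
    rw [tsum_mul_left, (hSs.mul_left 16).tsum_add (hs1.mul_left _), tsum_mul_left,
      tsum_mul_left] at this
    refine this.trans ?_
    have hxδ : 1 ≤ x ^ δ := Real.one_le_rpow hx.le hδ.le
    have e1 : x ^ (1 + 2 * δ) = x ^ (1 + δ) * x ^ δ := by
      rw [← Real.rpow_add hx0]; ring_nf
    have e2 : (2 * x) ^ δ = 2 ^ δ * x ^ δ := Real.mul_rpow (by norm_num) hx0.le
    rw [e1, e2, mul_left_comm K, hK]
    refine mul_le_mul_of_nonneg_left ?_ (by positivity)
    calc _ ≤ 16 * S * x ^ δ + 16 / δ * (2 ^ δ * x ^ δ) * Z := by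
          have h16 : 16 * S ≤ 16 * S * x ^ δ := le_mul_of_one_le_right (by positivity) hxδ
          have hZs : 16 / δ * (2 ^ δ * x ^ δ) * (∑' n : ℕ, 1 / |(n : ℝ) - nx| ^ (1 + δ)) ≤
              16 / δ * (2 ^ δ * x ^ δ) * Z := by gcongr
          exact add_le_add h16 hZs
      _ = _ := by ring
  have hlog : Real.log 2 ≤ Real.log (2 * x) := Real.log_le_log (by norm_num) (by linarith)
  have hp1 : 1 ≤ x ^ (1 + 2 * δ) := Real.one_le_rpow hx.le (by linarith)
  have e : -(F nx + ∑' n, if n = nx then 0 else F n) +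
      ArithmeticFunction.vonMangoldt nx * landauFactor x v nx =
      -(F nx - ArithmeticFunction.vonMangoldt nx * landauFactor x v nx) -
        ∑' n, if n = nx then 0 else F n := by ring
  change ‖-(F nx + ∑' n, if n = nx then 0 else F n) +
      ArithmeticFunction.vonMangoldt nx * landauFactor x v nx‖ ≤ _
  rw [e]
  refine (norm_sub_le _ _).trans ?_
  rw [norm_neg]
  have a1 : K * x ^ (1 + 2 * δ) ≤ K / Real.log 2 * (x ^ (1 + 2 * δ) * Real.log (2 * x)) := by
    rw [div_mul_eq_mul_div, le_div_iff₀ hl2, ← mul_assoc]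
    gcongr
  have a2 : (8 + t₀) * Real.log (2 * x) ≤
      (8 + t₀) * (x ^ (1 + 2 * δ) * Real.log (2 * x)) := by
    gcongr
    exact le_mul_of_one_le_left (by linarith) hp1
  rw [add_mul]
  linarith [hdiag, hoff]

theorem finite_riemannZeta_zeros (A : ℝ) :
    {ρ : ℂ | riemannZeta ρ = 0 ∧ 0 < ρ.im ∧ ρ.im ≤ A}.Finite := by
  have hc : IsCompact (Set.Icc (0 : ℝ) 1 ×ℂ Set.Icc (0 : ℝ) A) := isCompact_Icc.reProdIm isCompact_Icc
  refine hc.inter_riemannZetaZeros_finite.subset fun ρ hρ => ?_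
  obtain ⟨h0, h1, h2⟩ := hρ
  exact ⟨⟨⟨(re_pos_of_riemannZeta_eq_zero h0 h1.ne').le, (re_lt_one_of_riemannZeta_eq_zero h0).le⟩,
    h1.le, h2⟩, mem_riemannZetaZeros.2 h0⟩

/-- The zeros of `ζ` with ordinate in `(0, A]`, as a finite set. -/
noncomputable def zetaZerosUpTo (A : ℝ) : Finset ℂ := (finite_riemannZeta_zeros A).toFinset

theorem mem_zetaZerosUpTo {A : ℝ} {ρ : ℂ} :
    ρ ∈ zetaZerosUpTo A ↔ riemannZeta ρ = 0 ∧ 0 < ρ.im ∧ ρ.im ≤ A := by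
  simp [zetaZerosUpTo]

theorem ne_one_of_im_pos {ρ : ℂ} (h : 0 < ρ.im) : ρ ≠ 1 := by
  rintro rfl
  simp at h

theorem zetaZeroPowerSum_eq_sum (x T : ℝ) :
    zetaZeroPowerSum x T =
      ∑ ρ ∈ zetaZerosUpTo T, (analyticOrderNatAt riemannZeta ρ : ℂ) * (x : ℂ) ^ ρ := by
  have hm : ∀ ρ : ℂ, 0 < ρ.im → zeroMult riemannZeta ρ = analyticOrderNatAt riemannZeta ρ :=
    fun ρ h => zeroMult_eq_analyticOrderNatAt (analyticAt_riemannZeta (ne_one_of_im_pos h))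
      (analyticOrderAt_riemannZeta_ne_top (ne_one_of_im_pos h))
  rw [zetaZeroPowerSum, tsum_eq_sum (s := zetaZerosUpTo T)]
  · refine Finset.sum_congr rfl fun ρ hρ => ?_
    obtain ⟨h0, h1, h2⟩ := mem_zetaZerosUpTo.1 hρ
    rw [if_pos ⟨re_pos_of_riemannZeta_eq_zero h0 h1.ne', re_lt_one_of_riemannZeta_eq_zero h0,
      h1, h2⟩, hm ρ h1]
  · intro ρ hρ
    split_ifs with hb
    · obtain ⟨-, -, h1, h2⟩ := hb
      have h0 : riemannZeta ρ ≠ 0 := fun h0 => hρ (mem_zetaZerosUpTo.2 ⟨h0, h1, h2⟩)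
      have : analyticOrderNatAt riemannZeta ρ = 0 := by
        rw [analyticOrderNatAt, (analyticAt_riemannZeta
          (ne_one_of_im_pos h1)).analyticOrderAt_eq_zero.2 h0]
        rfl
      rw [hm ρ h1, this]
      simp
    · rfl

theorem exists_height_forall_lt_im {T : ℝ} (hT : 0 ≤ T) :
    ∃ T' ∈ Set.Ioc T (T + 1), ∀ ρ, riemannZeta ρ = 0 → T < ρ.im → T' < ρ.im := by
  have hfin : (Complex.im '' {ρ : ℂ | riemannZeta ρ = 0 ∧ 0 < ρ.im ∧ ρ.im ≤ T + 1} \ {T}).Finite :=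
    ((finite_riemannZeta_zeros (T + 1)).image _).sdiff
  obtain ⟨r, hr, hball⟩ := Metric.isOpen_iff.1 hfin.isClosed.isOpen_compl T (by simp)
  refine ⟨T + min r 1 / 2, ⟨by have := lt_min hr one_pos; linarith, by
    have := min_le_right r 1; linarith⟩, fun ρ h0 h1 => ?_⟩
  by_contra hc
  rw [not_lt] at hc
  have hm1 := min_le_right r 1
  have hm2 := min_le_left r 1
  refine hball (a := ρ.im) ?_ ⟨⟨ρ, ⟨h0, by linarith, by linarith⟩, rfl⟩, h1.ne'⟩
  rw [Metric.mem_ball, Real.dist_eq, abs_of_pos (by linarith)]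
  linarith

theorem norm_sum_zetaZerosUpTo_le {x : ℝ} (hx : 1 < x) {s : Finset ℂ} {A : ℝ}
    (hs : s ⊆ zetaZerosUpTo A) :
    ‖∑ ρ ∈ s, (analyticOrderNatAt riemannZeta ρ : ℂ) * (x : ℂ) ^ ρ‖ ≤
      (∑ ρ ∈ zetaZerosUpTo A, (analyticOrderNatAt riemannZeta ρ : ℝ)) * x := by
  have h1 : (∑ ρ ∈ s, (analyticOrderNatAt riemannZeta ρ : ℝ)) ≤
      ∑ ρ ∈ zetaZerosUpTo A, (analyticOrderNatAt riemannZeta ρ : ℝ) :=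
    Finset.sum_le_sum_of_subset_of_nonneg hs fun _ _ _ => Nat.cast_nonneg _
  refine le_trans ?_ (mul_le_mul_of_nonneg_right h1 (by linarith))
  rw [Finset.sum_mul]
  refine norm_sum_le_of_le _ fun ρ hρ => ?_
  obtain ⟨h0, h1, -⟩ := mem_zetaZerosUpTo.1 (hs hρ)
  rw [norm_mul, Complex.norm_natCast, norm_cpow_eq_rpow_re_of_pos (by linarith)]
  gcongr
  exact (Real.rpow_le_rpow_of_exponent_le hx.le
    (re_lt_one_of_riemannZeta_eq_zero h0).le).trans_eq (Real.rpow_one x)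

/-- The contour integral of `x ^ s ζ' / ζ` over a rectangle, estimated by its edges. -/
theorem norm_two_pi_mul_sum_sub_integral_le {x δ t₀ T T' : ℝ} (hx : 1 < x) (hδ : 0 < δ)
    (ht₀ : 0 < t₀) (hT : t₀ ≤ T) (hTT' : T < T') (hz₀ : ∀ ρ, riemannZeta ρ = 0 → ρ.im ≠ t₀)
    (hz : ∀ ρ, riemannZeta ρ = 0 → T < ρ.im → T' < ρ.im) :
    ‖2 * Real.pi * ∑ ρ ∈ zetaZerosUpTo T \ zetaZerosUpTo t₀,
        (analyticOrderNatAt riemannZeta ρ : ℂ) * (x : ℂ) ^ ρ -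
      ∫ t : ℝ in t₀..T', (x : ℂ) ^ ((1 + δ : ℝ) + t * I : ℂ) *
        (deriv riemannZeta ((1 + δ : ℝ) + t * I) / riemannZeta ((1 + δ : ℝ) + t * I))‖ ≤
      ‖∫ σ : ℝ in (-δ)..(1 + δ), (x : ℂ) ^ (σ + t₀ * I : ℂ) *
        (deriv riemannZeta (σ + t₀ * I) / riemannZeta (σ + t₀ * I))‖ +
      ‖∫ σ : ℝ in (-δ)..(1 + δ), (x : ℂ) ^ (σ + T' * I : ℂ) *
        (deriv riemannZeta (σ + T' * I) / riemannZeta (σ + T' * I))‖ +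
      ‖∫ t : ℝ in t₀..T', (x : ℂ) ^ ((-δ : ℝ) + t * I : ℂ) *
        (deriv riemannZeta ((-δ : ℝ) + t * I) / riemannZeta ((-δ : ℝ) + t * I))‖ := by
  have hxc : (x : ℂ) ≠ 0 := ofReal_ne_zero.2 (by linarith)
  have hne : ∀ ρ ∈ Set.Icc (-δ) (1 + δ) ×ℂ Set.Icc t₀ T', ρ ≠ 1 := fun ρ hρ =>
    ne_one_of_im_pos (ht₀.trans_le hρ.2.1)
  have hmem : ∀ ρ, ρ ∈ zetaZerosUpTo T \ zetaZerosUpTo t₀ ↔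
      riemannZeta ρ = 0 ∧ t₀ < ρ.im ∧ ρ.im ≤ T := by
    intro ρ
    rw [Finset.mem_sdiff, mem_zetaZerosUpTo, mem_zetaZerosUpTo]
    constructor
    · rintro ⟨⟨h0, h1, h2⟩, h3⟩
      exact ⟨h0, not_le.1 fun h4 => h3 ⟨h0, h1, h4⟩, h2⟩
    · rintro ⟨h0, h1, h2⟩
      exact ⟨⟨h0, ht₀.trans h1, h2⟩, fun h3 => absurd h3.2.2 (not_le.2 h1)⟩
  have key := rectIntegral_mul_logDeriv (a := -δ) (b := 1 + δ) (u := t₀) (v := T')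
    (g := fun s => (x : ℂ) ^ s) (f := riemannZeta) (Z := zetaZerosUpTo T \ zetaZerosUpTo t₀)
    (by linarith) (by linarith) (differentiable_id.const_cpow (Or.inl hxc))
    (fun ρ hρ => analyticAt_riemannZeta (hne ρ hρ))
    (fun ρ => by
      rw [hmem]
      constructor
      · rintro ⟨h0, h1, h2⟩
        have him : ρ.im ≠ 0 := (ht₀.trans h1).ne'
        have := re_pos_of_riemannZeta_eq_zero h0 him
        have := re_lt_one_of_riemannZeta_eq_zero h0
        exact ⟨⟨⟨by linarith, by linarith⟩, h1.le, by linarith⟩, h0⟩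
      · rintro ⟨⟨-, h1⟩, h0⟩
        refine ⟨h0, lt_of_le_of_ne h1.1 (hz₀ ρ h0).symm, not_lt.1 fun h2 => ?_⟩
        exact absurd h1.2 (not_le.2 (hz ρ h0 h2)))
    (fun ρ hρ => by
      obtain ⟨h0, h1, h2⟩ := (hmem ρ).1 hρ
      have him : ρ.im ≠ 0 := (ht₀.trans h1).ne'
      have := re_pos_of_riemannZeta_eq_zero h0 him
      have := re_lt_one_of_riemannZeta_eq_zero h0
      exact ⟨⟨by linarith, by linarith⟩, h1, by linarith⟩)
    (fun ρ hρ => analyticOrderAt_riemannZeta_ne_top (ne_one_of_im_pos (ht₀.trans ((hmem ρ).1 hρ).2.1)))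
  rw [rectIntegral] at key
  set H₀ : ℂ := ∫ σ : ℝ in (-δ)..(1 + δ), (x : ℂ) ^ (σ + t₀ * I : ℂ) *
        (deriv riemannZeta (σ + t₀ * I) / riemannZeta (σ + t₀ * I))
  set H : ℂ := ∫ σ : ℝ in (-δ)..(1 + δ), (x : ℂ) ^ (σ + T' * I : ℂ) *
        (deriv riemannZeta (σ + T' * I) / riemannZeta (σ + T' * I))
  set L : ℂ := ∫ t : ℝ in t₀..T', (x : ℂ) ^ ((-δ : ℝ) + t * I : ℂ) *
        (deriv riemannZeta ((-δ : ℝ) + t * I) / riemannZeta ((-δ : ℝ) + t * I))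
  set R : ℂ := ∫ t : ℝ in t₀..T', (x : ℂ) ^ ((1 + δ : ℝ) + t * I : ℂ) *
        (deriv riemannZeta ((1 + δ : ℝ) + t * I) / riemannZeta ((1 + δ : ℝ) + t * I))
  set S : ℂ := ∑ ρ ∈ zetaZerosUpTo T \ zetaZerosUpTo t₀,
        (analyticOrderNatAt riemannZeta ρ : ℂ) * (x : ℂ) ^ ρ
  have e : 2 * Real.pi * S - R = -I * H₀ + I * H - L := by
    linear_combination I * key + (2 * Real.pi * S - R + L) * I_sq
  rw [e]
  refine (norm_sub_le _ _).trans (add_le_add ((norm_add_le _ _).trans ?_) le_rfl)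
  simp

theorem norm_landauFactor_le {x v : ℝ} {nx : ℕ} (hx : 0 < x) (hnx : 0 < nx) (hv : 0 ≤ v) :
    ‖landauFactor x v nx‖ ≤ v := by
  rw [landauFactor_eq_integral hx hnx]
  simpa using norm_integral_exp_I_mul_le_sub (Real.log x - Real.log nx) hv

theorem norm_landauFactor_sub_le {x u v : ℝ} {nx : ℕ} (hx : 0 < x) (hnx : 0 < nx) (huv : u ≤ v) :
    ‖landauFactor x v nx - landauFactor x u nx‖ ≤ v - u := by
  rw [landauFactor_eq_integral hx hnx, landauFactor_eq_integral hx hnx,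
    intervalIntegral.integral_interval_sub_left
      ((continuous_exp_I_mul_mul _).intervalIntegrable _ _)
      ((continuous_exp_I_mul_mul _).intervalIntegrable _ _)]
  exact norm_integral_exp_I_mul_le_sub _ huv

theorem log_le_two_mul_log {T T' : ℝ} (hT : 2 ≤ T) (hT' : 0 < T') (h : T' ≤ T + 1) :
    Real.log T' ≤ 2 * Real.log T := by
  have := Real.log_le_log hT' (show T' ≤ T ^ 2 by nlinarith)
  rwa [Real.log_pow] at this

/-- Landau's formula for heights beyond a fixed zero-free height `t₀`, restricted to the zeros
above `t₀`. -/
theorem exists_norm_two_pi_mul_sum_add_le {ε t₀ : ℝ} (hε : 0 < ε) (ht₀ : 5 ≤ t₀)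
    (hz₀ : ∀ ρ, riemannZeta ρ = 0 → ρ.im ≠ t₀) :
    ∃ C : ℝ, 0 < C ∧ ∀ x T : ℝ, 1 < x → t₀ ≤ T → ∀ nx : ℕ, |x - (nx : ℝ)| ≤ 1 / 2 →
      ‖2 * Real.pi * ∑ ρ ∈ zetaZerosUpTo T \ zetaZerosUpTo t₀,
          (analyticOrderNatAt riemannZeta ρ : ℂ) * (x : ℂ) ^ ρ +
          ArithmeticFunction.vonMangoldt nx * landauFactor x T nx‖ ≤
        C * (x ^ (1 + ε) * Real.log (2 * x) + x ^ (1 + ε) * Real.log T +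
          min (T * Real.log T) (Real.log T / Real.log x)) := by
  obtain ⟨δ, hδ, hδ10, hδε⟩ : ∃ δ : ℝ, 0 < δ ∧ δ ≤ 1 / 10 ∧ 2 * δ ≤ ε :=
    ⟨min (1 / 10) (ε / 2), lt_min (by norm_num) (by linarith), min_le_left _ _, by
      have := min_le_right (1 / 10) (ε / 2); linarith⟩
  obtain ⟨CH, hCH, hH⟩ := exists_norm_integral_horizontal_le hδ hδ10
  obtain ⟨CL, hCL, hL⟩ := exists_norm_integral_left_le hδ ht₀
  obtain ⟨CR, hCR, hR⟩ := exists_norm_integral_right_add_le (t₀ := t₀) hδ (by linarith)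
    (by linarith)
  have hl2 : 0 < Real.log 2 := Real.log_pos (by norm_num)
  refine ⟨3 * CH + 4 * CL + CL / Real.log 2 + CR + 1, by positivity, fun x T hx hT nx h => ?_⟩
  have hx0 : 0 < x := by linarith
  have hT2 : 2 ≤ T := by linarith
  have hnx := one_le_of_abs_sub_natCast_le hx h
  obtain ⟨T', ⟨hT1, hT1'⟩, hz⟩ := exists_height_forall_lt_im (show 0 ≤ T by linarith)
  have hzT' : ∀ ρ, riemannZeta ρ = 0 → ρ.im ≠ T' := fun ρ h0 h1 =>
    absurd (hz ρ h0 (h1 ▸ hT1)) (by rw [h1]; exact lt_irrefl _)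
  have hrect := norm_two_pi_mul_sum_sub_integral_le hx hδ (by linarith) hT hT1 hz₀ hz
  have b1 := hH x t₀ hx ht₀ hz₀
  have b2 := hH x T' hx (by linarith) hzT'
  have b3 := hL x T' hx (by linarith)
  have b4 := hR x T' hx (by linarith) nx h
  set R : ℂ := ∫ t : ℝ in t₀..T', (x : ℂ) ^ ((1 + δ : ℝ) + t * I : ℂ) *
        (deriv riemannZeta ((1 + δ : ℝ) + t * I) / riemannZeta ((1 + δ : ℝ) + t * I))
  set S : ℂ := ∑ ρ ∈ zetaZerosUpTo T \ zetaZerosUpTo t₀,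
        (analyticOrderNatAt riemannZeta ρ : ℂ) * (x : ℂ) ^ ρ
  have hlx : 0 < Real.log x := Real.log_pos hx
  have hlT : 0 < Real.log T := Real.log_pos (by linarith)
  have hlT' : Real.log T' ≤ 2 * Real.log T := log_le_two_mul_log hT2 (by linarith) hT1'
  have hlt₀ : Real.log t₀ ≤ Real.log T := Real.log_le_log (by linarith) hT
  have hl2x : Real.log 2 ≤ Real.log (2 * x) := Real.log_le_log (by norm_num) (by linarith)
  have hXX : x ^ (1 + 2 * δ) ≤ x ^ (1 + ε) :=
    Real.rpow_le_rpow_of_exponent_le hx.le (by linarith)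
  have hX1 : 1 ≤ x ^ (1 + ε) := Real.one_le_rpow hx.le (by linarith)
  set X := x ^ (1 + ε)
  set m := min (T * Real.log T) (Real.log T / Real.log x)
  have hm : min (T' * Real.log T') (Real.log T' / Real.log x) ≤ 4 * m := by
    rw [mul_min_of_nonneg _ _ (by norm_num : (0 : ℝ) ≤ 4)]
    refine min_le_min ?_ ?_
    · nlinarith
    · rw [← mul_div_assoc]
      gcongr
      linarith
  have hm0 : 0 ≤ m := le_min (by positivity) (by positivity)
  have hlt₀0 : 0 ≤ Real.log t₀ := Real.log_nonneg (by linarith)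
  have hlT'0 : 0 ≤ Real.log T' := Real.log_nonneg (by linarith)
  have hl2x0 : 0 ≤ Real.log (2 * x) := by linarith
  have c1 : CH * (x ^ (1 + 2 * δ) * Real.log t₀) ≤ CH * (X * Real.log T) := by gcongr
  have c2 : CH * (x ^ (1 + 2 * δ) * Real.log T') ≤ CH * (X * (2 * Real.log T)) := by gcongr
  have c3 : CL * (min (T' * Real.log T') (Real.log T' / Real.log x) + 1) ≤
      CL * (4 * m + X * Real.log (2 * x) / Real.log 2) := by
    gcongr
    rw [one_le_div hl2]
    nlinarith
  have c4 : CR * (x ^ (1 + 2 * δ) * Real.log (2 * x)) ≤ CR * (X * Real.log (2 * x)) := by gcongr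
  have hΛ : ‖(ArithmeticFunction.vonMangoldt nx : ℂ) *
      (landauFactor x T' nx - landauFactor x T nx)‖ ≤ X * Real.log (2 * x) := by
    rw [norm_mul, norm_real, Real.norm_of_nonneg ArithmeticFunction.vonMangoldt_nonneg]
    have d1 := norm_landauFactor_sub_le hx0 hnx hT1.le
    have d2 := vonMangoldt_le_log_two_mul hx h
    calc _ ≤ Real.log (2 * x) * 1 :=
          mul_le_mul d2 (by linarith) (norm_nonneg _) (by linarith)
      _ ≤ _ := by nlinarith
  have e : 2 * Real.pi * S + ArithmeticFunction.vonMangoldt nx * landauFactor x T nx =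
      (2 * Real.pi * S - R) + (R + ArithmeticFunction.vonMangoldt nx * landauFactor x T' nx) -
      ArithmeticFunction.vonMangoldt nx * (landauFactor x T' nx - landauFactor x T nx) := by ring
  rw [e]
  refine (norm_sub_le _ _).trans ((add_le_add (norm_add_le _ _) le_rfl).trans ?_)
  have hP : 0 ≤ X * Real.log (2 * x) := by
    have : 0 ≤ Real.log (2 * x) := by linarith
    positivity
  have hQ : 0 ≤ X * Real.log T := by positivity
  have hCL2 : 0 < CL / Real.log 2 := by positivity
  have e3 : CL * (4 * m + X * Real.log (2 * x) / Real.log 2) =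
      4 * CL * m + CL / Real.log 2 * (X * Real.log (2 * x)) := by ring
  rw [e3] at c3
  have q1 : 0 ≤ (3 * CH + 4 * CL) * (X * Real.log (2 * x)) := by positivity
  have q2 : 0 ≤ (4 * CL + CL / Real.log 2 + CR + 1) * (X * Real.log T) := by positivity
  have q3 : 0 ≤ (3 * CH + CL / Real.log 2 + CR + 1) * m := by positivity
  linarith

/-- Uniform version of Landau's theorem: for `x > 1`, `T ≥ 2`, `n_x` a nearest integer to `x`
and any `ε > 0`,
`∑_{0<γ≤T} x^ρ = -(Λ(n_x)/2π)·(e^{iT log(x/n_x)}-1)/(i log(x/n_x))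
  + O_ε(x^{1+ε} log(2x) + x^{1+ε} log T + min(T log T, log T / log x))`. -/
theorem landau_uniform (ε : ℝ) (hε : 0 < ε) :
    ∃ C : ℝ, ∀ x T : ℝ, 1 < x → 2 ≤ T → ∀ nx : ℕ, |x - (nx : ℝ)| ≤ 1 / 2 →
      ‖zetaZeroPowerSum x T -
          (-(ArithmeticFunction.vonMangoldt nx : ℂ) / (2 * Real.pi) * landauFactor x T nx)‖ ≤
        C * (x ^ (1 + ε) * Real.log (2 * x) + x ^ (1 + ε) * Real.log T +
          min (T * Real.log T) (Real.log T / Real.log x)) := by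
  obtain ⟨t₀, ⟨ht₀, -⟩, hz⟩ := exists_height_forall_lt_im (show (0 : ℝ) ≤ 5 by norm_num)
  have hz₀ : ∀ ρ, riemannZeta ρ = 0 → ρ.im ≠ t₀ := fun ρ h0 h1 =>
    absurd (hz ρ h0 (h1 ▸ ht₀)) (by rw [h1]; exact lt_irrefl _)
  obtain ⟨C, hC, hmain⟩ := exists_norm_two_pi_mul_sum_add_le hε ht₀.le hz₀
  set M : ℝ := ∑ ρ ∈ zetaZerosUpTo t₀, (analyticOrderNatAt riemannZeta ρ : ℝ) with hM
  have hM0 : 0 ≤ M := Finset.sum_nonneg fun _ _ => Nat.cast_nonneg _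
  have hl2 : 0 < Real.log 2 := Real.log_pos (by norm_num)
  refine ⟨M / Real.log 2 + t₀ + C, fun x T hx hT nx h => ?_⟩
  have hx0 : 0 < x := by linarith
  have hnx := one_le_of_abs_sub_natCast_le hx h
  have hlx : 0 < Real.log x := Real.log_pos hx
  have hlT : 0 < Real.log T := Real.log_pos (by linarith)
  have hl2x : Real.log 2 ≤ Real.log (2 * x) := Real.log_le_log (by norm_num) (by linarith)
  have hX1 : 1 ≤ x ^ (1 + ε) := Real.one_le_rpow hx.le (by linarith)
  have hxX : x ≤ x ^ (1 + ε) := by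
    simpa using Real.rpow_le_rpow_of_exponent_le hx.le (show (1 : ℝ) ≤ 1 + ε by linarith)
  have hpi : 1 ≤ 2 * Real.pi := by have := Real.pi_gt_three; linarith
  have hpic : (2 * Real.pi : ℂ) ≠ 0 := by
    exact_mod_cast (by linarith : (0 : ℝ) < 2 * Real.pi).ne'
  set E := x ^ (1 + ε) * Real.log (2 * x) + x ^ (1 + ε) * Real.log T +
    min (T * Real.log T) (Real.log T / Real.log x) with hE
  have hPE : x ^ (1 + ε) * Real.log (2 * x) ≤ E := by
    have : 0 ≤ min (T * Real.log T) (Real.log T / Real.log x) :=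
      le_min (by positivity) (by positivity)
    have : 0 ≤ x ^ (1 + ε) * Real.log T := by positivity
    linarith
  have hxE : M * x ≤ M / Real.log 2 * E := by
    rw [div_mul_eq_mul_div, le_div_iff₀ hl2, mul_assoc]
    refine mul_le_mul_of_nonneg_left (le_trans ?_ hPE) hM0
    exact mul_le_mul hxX hl2x hl2.le (by linarith)
  have hE0 : 0 ≤ E := (mul_nonneg (by linarith) (by linarith)).trans hPE
  have hdiv : ∀ w : ℂ, ‖w / (2 * Real.pi)‖ ≤ ‖w‖ := fun w => by
    rw [norm_div]
    refine div_le_self (norm_nonneg _) ?_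
    rw [← ofReal_ofNat, ← ofReal_mul, norm_real, Real.norm_of_nonneg (by linarith)]
    exact hpi
  rw [zetaZeroPowerSum_eq_sum]
  rcases lt_or_ge T t₀ with hlt | hge
  · have hsub : zetaZerosUpTo T ⊆ zetaZerosUpTo t₀ := fun ρ hρ => by
      obtain ⟨h0, h1, h2⟩ := mem_zetaZerosUpTo.1 hρ
      exact mem_zetaZerosUpTo.2 ⟨h0, h1, by linarith⟩
    have h1 := norm_sum_zetaZerosUpTo_le hx hsub
    have h2 : ‖-(ArithmeticFunction.vonMangoldt nx : ℂ) / (2 * Real.pi) * landauFactor x T nx‖ ≤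
        t₀ * E := by
      rw [norm_mul, mul_comm]
      refine mul_le_mul ((norm_landauFactor_le hx0 hnx (by linarith)).trans hlt.le)
        ((hdiv _).trans ?_) (norm_nonneg _) (by linarith)
      rw [norm_neg, norm_real, Real.norm_of_nonneg ArithmeticFunction.vonMangoldt_nonneg]
      refine (vonMangoldt_le_log_two_mul hx h).trans (le_trans ?_ hPE)
      exact le_mul_of_one_le_left (by linarith) hX1
    refine (norm_sub_le _ _).trans ((add_le_add (h1.trans hxE) h2).trans ?_)
    have : 0 ≤ C * E := by positivity
    linarith
  · have hsub : zetaZerosUpTo t₀ ⊆ zetaZerosUpTo T := fun ρ hρ => by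
      obtain ⟨h0, h1, h2⟩ := mem_zetaZerosUpTo.1 hρ
      exact mem_zetaZerosUpTo.2 ⟨h0, h1, by linarith⟩
    have h1 := norm_sum_zetaZerosUpTo_le hx (Finset.Subset.refl (zetaZerosUpTo t₀))
    have h2 := hmain x T hx hge nx h
    rw [← Finset.sum_sdiff hsub]
    set S : ℂ := ∑ ρ ∈ zetaZerosUpTo T \ zetaZerosUpTo t₀,
      (analyticOrderNatAt riemannZeta ρ : ℂ) * (x : ℂ) ^ ρ
    set S₀ : ℂ := ∑ ρ ∈ zetaZerosUpTo t₀, (analyticOrderNatAt riemannZeta ρ : ℂ) * (x : ℂ) ^ ρ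
    have e : S + S₀ - -(ArithmeticFunction.vonMangoldt nx : ℂ) / (2 * Real.pi) *
        landauFactor x T nx = (2 * Real.pi * S +
          ArithmeticFunction.vonMangoldt nx * landauFactor x T nx) / (2 * Real.pi) + S₀ := by
      have : (Real.pi : ℂ) ≠ 0 := ofReal_ne_zero.2 Real.pi_ne_zero
      field_simp
      ring
    rw [e]
    refine (norm_add_le _ _).trans
      ((add_le_add ((hdiv _).trans h2) (h1.trans hxE)).trans ?_)
    have : 0 ≤ t₀ * E := mul_nonneg (by linarith) hE0
    linarith
end

section
/- For all T ≥ 2 and all real K ≥ 1, ∑_{0<γ,γ'≤T} min( K, 1/|γ − γ'| ) ≪ T·(K + log T)·(log T)², where γ, γ' run over the imaginary parts of the nontrivial zeros of the Riemann zeta function in (0,T], each zero counted with its multiplicity, and the summand is taken to be K when γ = γ'. The implied constant is absolute. -/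
open Complex
open scoped Classical

/-- `∑_{0<γ,γ'≤T} min(K, 1/|γ-γ'|)`, over imaginary parts of nontrivial zeros of `ζ` counted
with multiplicity, the summand being `K` when `γ = γ'`. -/
noncomputable def zetaZeroMinSum (T K : ℝ) : ℝ :=
  ∑' p : ℂ × ℂ,
    if inZeroBox p.1 T ∧ inZeroBox p.2 T then
      ((zeroMult riemannZeta p.1 * zeroMult riemannZeta p.2 : ℕ) : ℝ) *
        (if p.1.im = p.2.im then K else min K (1 / |p.1.im - p.2.im|))
    else 0

open Filter Topology Set MeasureTheory

/-- The fractional part on `(1, ∞)`, extended by zero. -/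
noncomputable def fractTail : ℝ → ℂ := (Ioi (1 : ℝ)).indicator fun t ↦ ((Int.fract t : ℝ) : ℂ)

lemma norm_fractTail_le (t : ℝ) : ‖fractTail t‖ ≤ 1 := by
  refine (norm_indicator_le_norm_self _ _).trans ?_
  rw [Complex.norm_real, Real.norm_of_nonneg (Int.fract_nonneg t)]
  exact (Int.fract_lt_one t).le

lemma measurable_fractTail : Measurable fractTail :=
  (Complex.measurable_ofReal.comp measurable_fract).indicator measurableSet_Ioi

lemma differentiableAt_mellin_fractTail {s : ℂ} (hs : s.re < 0) :
    DifferentiableAt ℂ (mellin fractTail) s := by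
  refine mellin_differentiableAt_of_isBigO_rpow (a := 0) (b := s.re - 1) ?_ ?_ hs ?_ (by linarith)
  · refine LocallyIntegrable.locallyIntegrableOn ?_ _
    exact (locallyIntegrable_const (1 : ℝ)).mono measurable_fractTail.aestronglyMeasurable
      (.of_forall fun t ↦ by simpa using norm_fractTail_le t)
  · refine Asymptotics.isBigO_iff.2 ⟨1, .of_forall fun t ↦ ?_⟩
    simpa using norm_fractTail_le t
  · refine Asymptotics.isBigO_iff.2 ⟨0, ?_⟩
    filter_upwards [mem_nhdsWithin_of_mem_nhds (Iio_mem_nhds (zero_lt_one (α := ℝ)))] with t ht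
    simp [fractTail, indicator_of_notMem (show t ∉ Ioi (1 : ℝ) by simpa using ht.le)]

lemma mellin_fractTail_eq (s : ℂ) :
    mellin fractTail s = ∫ t in Ioi (1 : ℝ), (t : ℂ) ^ (s - 1) * Int.fract t := by
  have h : (fun t : ℝ ↦ (t : ℂ) ^ (s - 1) • fractTail t) =
      (Ioi (1 : ℝ)).indicator fun t ↦ (t : ℂ) ^ (s - 1) * Int.fract t := by
    ext t
    by_cases ht : t ∈ Ioi (1 : ℝ) <;> simp [fractTail, ht]
  rw [mellin, h, setIntegral_indicator measurableSet_Ioi, Ioi_inter_Ioi]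
  simp

lemma norm_mellin_fractTail_le {s : ℂ} (hs : s.re < 0) :
    ‖mellin fractTail s‖ ≤ 1 / -s.re := by
  rw [mellin_fractTail_eq]
  have hint := integrableOn_Ioi_rpow_of_lt (a := s.re - 1) (by linarith) (zero_lt_one (α := ℝ))
  refine (norm_integral_le_of_norm_le (g := fun t : ℝ ↦ t ^ (s.re - 1)) hint ?_).trans_eq ?_
  · filter_upwards [ae_restrict_mem measurableSet_Ioi] with t ht
    have ht0 : 0 < t := zero_lt_one.trans ht
    rw [norm_mul, Complex.norm_cpow_eq_rpow_re_of_pos ht0, Complex.norm_real,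
      Real.norm_of_nonneg (Int.fract_nonneg t), sub_re, one_re]
    exact mul_le_of_le_one_right (Real.rpow_nonneg ht0.le _) (Int.fract_lt_one t).le
  · rw [integral_Ioi_rpow_of_lt (by linarith) zero_lt_one]
    simp [neg_div, div_neg]

lemma riemannZeta_eq_mul_integral_floor {s : ℂ} (hs : 1 < s.re) :
    riemannZeta s = s * ∫ t in Ioi (1 : ℝ), (⌊t⌋₊ : ℂ) * (t : ℂ) ^ (-(s + 1)) := by
  have h := LSeries_eq_mul_integral_of_nonneg (fun _ ↦ 1) zero_le_one hs
    (by simpa using Asymptotics.isBigO_refl _ _) (fun _ ↦ zero_le_one)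
  simp only [Finset.sum_const, Nat.card_Icc, Nat.add_sub_cancel, nsmul_eq_mul, ofReal_one,
    mul_one] at h
  rw [← h]
  exact (LSeries_one_eq_riemannZeta hs).symm

lemma riemannZeta₁_eq_sub_mul {s : ℂ} (hs : s ≠ 1) :
    riemannZeta₁ s = (s - 1) * riemannZeta s := by
  have : s - 1 ≠ 0 := sub_ne_zero.2 hs
  rw [riemannZeta_eq_inv_sub_mul hs]
  field_simp

lemma riemannZeta₁_eq_of_one_lt_re {s : ℂ} (hs : 1 < s.re) :
    riemannZeta₁ s = s - s * (s - 1) * mellin fractTail (-s) := by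
  have hs1 : s ≠ 1 := by rintro rfl; simp at hs
  have hs1' : s - 1 ≠ 0 := sub_ne_zero.2 hs1
  have h1 : IntegrableOn (fun t : ℝ ↦ (t : ℂ) ^ (-s)) (Ioi 1) :=
    integrableOn_Ioi_cpow_of_lt (by simpa using hs) zero_lt_one
  have h2 : IntegrableOn (fun t : ℝ ↦ (t : ℂ) ^ (-s - 1) * Int.fract t) (Ioi 1) := by
    have h3 : IntegrableOn (fun t : ℝ ↦ (t : ℂ) ^ (-s - 1)) (Ioi 1) :=
      integrableOn_Ioi_cpow_of_lt (by simp; linarith) zero_lt_one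
    refine h3.mul_bdd (c := 1)
      (Complex.measurable_ofReal.comp measurable_fract).aestronglyMeasurable
      (.of_forall fun t ↦ ?_)
    rw [Complex.norm_real, Real.norm_of_nonneg (Int.fract_nonneg t)]
    exact (Int.fract_lt_one t).le
  have h4 : ∫ t in Ioi (1 : ℝ), (⌊t⌋₊ : ℂ) * (t : ℂ) ^ (-(s + 1)) =
      (∫ t in Ioi (1 : ℝ), (t : ℂ) ^ (-s)) -
        ∫ t in Ioi (1 : ℝ), (t : ℂ) ^ (-s - 1) * Int.fract t := by
    rw [← integral_sub h1 h2]
    refine setIntegral_congr_fun measurableSet_Ioi fun t ht ↦ ?_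
    have ht0 : (0 : ℝ) < t := zero_lt_one.trans ht
    have htc : (t : ℂ) ≠ 0 := by exact_mod_cast ht0.ne'
    have hfl : (⌊t⌋₊ : ℂ) = t - Int.fract t := by
      have : (⌊t⌋₊ : ℝ) = t - Int.fract t := by
        rw [natCast_floor_eq_intCast_floor ht0.le, Int.self_sub_fract]
      exact_mod_cast congrArg (fun x : ℝ ↦ (x : ℂ)) this
    have hp : (t : ℂ) ^ (-s) = t * (t : ℂ) ^ (-s - 1) := by
      rw [cpow_sub _ _ htc, cpow_one]; field_simp
    simp only [hfl, hp, neg_add']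
    ring
  rw [riemannZeta₁_eq_sub_mul hs1, riemannZeta_eq_mul_integral_floor hs, h4, mellin_fractTail_eq,
    integral_Ioi_cpow_of_lt (by simpa using hs) zero_lt_one]
  have h5 : -s + 1 ≠ 0 := fun h ↦ hs1' (by linear_combination -h)
  simp only [ofReal_one, one_cpow]
  field_simp
  ring

lemma riemannZeta₁_eq {s : ℂ} (hs : 0 < s.re) :
    riemannZeta₁ s = s - s * (s - 1) * mellin fractTail (-s) := by
  have hopen : IsOpen {z : ℂ | 0 < z.re} := isOpen_lt continuous_const Complex.continuous_re
  have hf : AnalyticOnNhd ℂ riemannZeta₁ {z : ℂ | 0 < z.re} := fun z _ ↦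
    differentiable_riemannZeta₁.analyticAt z
  have hg : AnalyticOnNhd ℂ (fun s ↦ s - s * (s - 1) * mellin fractTail (-s))
      {z : ℂ | 0 < z.re} := by
    refine DifferentiableOn.analyticOnNhd (fun z hz ↦ ?_) hopen
    have : DifferentiableAt ℂ (fun s ↦ mellin fractTail (-s)) z :=
      (differentiableAt_mellin_fractTail (by simpa using hz)).comp z differentiableAt_id.neg
    exact (by fun_prop : DifferentiableAt ℂ _ z).differentiableWithinAt
  refine hf.eqOn_of_preconnected_of_eventuallyEq hg (convex_halfSpace_re_gt 0).isPreconnected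
    (z₀ := 2) (by simp) ?_ hs
  filter_upwards [(isOpen_lt continuous_const Complex.continuous_re).mem_nhds
    (show (1 : ℝ) < (2 : ℂ).re by simp)] with z hz
  exact riemannZeta₁_eq_of_one_lt_re hz

lemma norm_riemannZeta₁_le {s : ℂ} (hs : 1 / 4 ≤ s.re) :
    ‖riemannZeta₁ s‖ ≤ 5 * (1 + ‖s‖) ^ 2 := by
  rw [riemannZeta₁_eq (by linarith)]
  have hm : ‖mellin fractTail (-s)‖ ≤ 4 := by
    refine (norm_mellin_fractTail_le (by simp; linarith)).trans ?_
    rw [neg_re, neg_neg, div_le_iff₀ (by linarith)]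
    linarith
  have h1 : ‖s - 1‖ ≤ 1 + ‖s‖ := by simpa [add_comm] using norm_sub_le s 1
  have h2 : ‖s * (s - 1) * mellin fractTail (-s)‖ ≤ ‖s‖ * (1 + ‖s‖) * 4 := by
    rw [norm_mul, norm_mul]; gcongr
  refine (norm_sub_le _ _).trans ?_
  nlinarith [norm_nonneg s]

lemma norm_riemannZeta_sub_one_le (t : ℝ) : ‖riemannZeta (2 + t * I) - 1‖ ≤ 2 / 3 := by
  have hre : (2 + t * I : ℂ).re = 2 := by simp
  have hz := zeta_eq_tsum_one_div_nat_add_one_cpow (s := 2 + t * I) (by simp)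
  have hn (n : ℕ) : ‖1 / ((n : ℂ) + 1) ^ (2 + t * I : ℂ)‖ = 1 / ((n : ℝ) + 1) ^ 2 := by
    have : ((n : ℂ) + 1) = ((n + 1 : ℕ) : ℂ) := by push_cast; rfl
    rw [this, norm_div, norm_one, Complex.norm_natCast_cpow_of_pos n.succ_pos, hre]
    norm_num
  have hsum : HasSum (fun n : ℕ ↦ 1 / ((n : ℝ) + 1) ^ 2) (Real.pi ^ 2 / 6) := by
    have := (hasSum_nat_add_iff' 1).2 hasSum_zeta_two
    simpa using this
  have hsum' := (hasSum_nat_add_iff' 1).2 hsum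
  have hc : Summable fun n : ℕ ↦ 1 / ((n : ℂ) + 1) ^ (2 + t * I : ℂ) :=
    .of_norm (by simpa only [hn] using hsum.summable)
  rw [hz, hc.tsum_eq_zero_add]
  simp only [CharP.cast_eq_zero, zero_add, one_cpow, div_one, add_sub_cancel_left]
  refine (tsum_of_norm_bounded hsum' fun n ↦ ?_).trans ?_
  · exact (hn (n + 1)).le
  · have := Real.pi_lt_d2
    have := Real.pi_pos
    norm_num
    nlinarith

lemma one_third_le_norm_riemannZeta₁ (t : ℝ) : 1 / 3 ≤ ‖riemannZeta₁ (2 + t * I)‖ := by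
  have hne : (2 + t * I : ℂ) ≠ 1 := fun h ↦ by simpa using congrArg re h
  have h1 : riemannZeta₁ (2 + t * I) = (1 + t * I) * riemannZeta (2 + t * I) := by
    rw [riemannZeta₁_eq_sub_mul hne]
    ring
  have h2 : 1 ≤ ‖(1 + t * I : ℂ)‖ := by simpa using Complex.abs_re_le_norm (1 + t * I)
  have h3 : 1 - 2 / 3 ≤ ‖riemannZeta (2 + t * I)‖ := by
    have := norm_sub_norm_le (1 : ℂ) (1 - riemannZeta (2 + t * I))
    rw [norm_sub_rev 1, sub_sub_cancel, norm_one] at this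
    linarith [norm_riemannZeta_sub_one_le t]
  rw [h1, norm_mul]
  nlinarith

lemma analyticOrderAt_riemannZeta₁_ne_top (z : ℂ) : analyticOrderAt riemannZeta₁ z ≠ ⊤ := by
  have han : AnalyticOnNhd ℂ riemannZeta₁ univ := fun z _ ↦
    differentiable_riemannZeta₁.analyticAt z
  have := (han.exists_analyticOrderAt_ne_top_iff_forall isConnected_univ).1
    ⟨⟨1, mem_univ _⟩, by
      rw [(han 1 (mem_univ _)).analyticOrderAt_eq_zero.2 (by simp)]; simp⟩
  exact this ⟨z, mem_univ _⟩

open MeromorphicOn Metric in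
/-- Zeros of `riemannZeta₁` near height `t`, counted with multiplicity. -/
lemma exists_sum_analyticOrderNatAt_le : ∃ C : ℝ, 0 ≤ C ∧ ∀ (t : ℝ) (S : Finset ℂ),
    (∀ z ∈ S, ‖z - (2 + t * I)‖ ≤ 8 / 5) →
      ∑ z ∈ S, (analyticOrderNatAt riemannZeta₁ z : ℝ) ≤ C * Real.log (5 + |t|) := by
  have hlog : 0 < Real.log ((7 / 4) / (8 / 5)) := Real.log_pos (by norm_num)
  refine ⟨5 / Real.log ((7 / 4) / (8 / 5)), by positivity, fun t S hS ↦ ?_⟩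
  set c : ℂ := 2 + t * I with hc
  have han (U : Set ℂ) : AnalyticOnNhd ℂ riemannZeta₁ U := fun z _ ↦
    differentiable_riemannZeta₁.analyticAt z
  have hlow := one_third_le_norm_riemannZeta₁ t
  have hcn : ‖c‖ ≤ 2 + |t| := (norm_add_le _ _).trans (by simp)
  have ht := abs_nonneg t
  have hJ := AnalyticOnNhd.sum_divisor_le (c := c) (r := 8 / 5) (R := 7 / 4)
    (M := 5 * (5 + |t|) ^ 2) (f := riemannZeta₁) (by norm_num) (by norm_num [abs_of_pos])
    (by nlinarith) (han _) (fun h ↦ by rw [← hc, h] at hlow; norm_num at hlow) (fun z hz ↦ by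
      have hz' : ‖z - c‖ = 7 / 4 := by simpa [abs_of_pos, dist_eq_norm] using hz
      have h1 : |z.re - 2| ≤ 7 / 4 := by
        have := Complex.abs_re_le_norm (z - c); rw [hz'] at this; simpa [hc] using this
      have h2 : ‖z‖ ≤ 4 + |t| := by
        have := norm_add_le (z - c) c; rw [sub_add_cancel] at this; linarith
      refine (norm_riemannZeta₁_le (by linarith [(abs_le.1 h1).1])).trans ?_
      refine mul_le_mul_of_nonneg_left (pow_le_pow_left₀ (by positivity) ?_ 2) (by norm_num)
      linarith)
  set D := divisor riemannZeta₁ (closedBall c |8 / 5|) with hD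
  have hDf : (Function.support D).Finite := D.finiteSupport (isCompact_closedBall c _)
  have hsum : ∑ z ∈ S, (analyticOrderNatAt riemannZeta₁ z : ℤ) ≤ ∑ᶠ u, D u := by
    rw [finsum_eq_sum_of_support_subset (s := S ∪ hDf.toFinset) _ (by
      intro x hx; simpa using Or.inr hx)]
    refine (Finset.sum_le_sum fun z hz ↦ ?_).trans
      (Finset.sum_le_sum_of_subset_of_nonneg Finset.subset_union_left
        fun z _ _ ↦ AnalyticOnNhd.divisor_nonneg (han _) z)
    rw [hD, AnalyticOnNhd.divisor_apply (han _) (by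
      simpa [abs_of_pos, dist_eq_norm] using hS z hz), ← Nat.cast_analyticOrderNatAt (analyticOrderAt_riemannZeta₁_ne_top z)]
    simp
  have hsum' : ∑ z ∈ S, (analyticOrderNatAt riemannZeta₁ z : ℝ) ≤ ((∑ᶠ u, D u : ℤ) : ℝ) := by
    exact_mod_cast hsum
  refine hsum'.trans (hJ.trans ?_)
  rw [div_mul_eq_mul_div]
  gcongr
  have hpos : 0 < ‖riemannZeta₁ c‖ := by linarith
  rw [show 5 * Real.log (5 + |t|) = Real.log ((5 + |t|) ^ 5) by rw [Real.log_pow]; norm_num]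
  refine Real.log_le_log (by positivity) ?_
  rw [div_le_iff₀ hpos]
  have h5 : 5 ≤ 5 + |t| := by linarith
  have h6 : (15 : ℝ) ≤ (5 + |t|) ^ 3 := by nlinarith [pow_le_pow_left₀ (by norm_num) h5 3]
  nlinarith [pow_pos (show 0 < 5 + |t| by linarith) 2, pow_pos (show 0 < 5 + |t| by linarith) 5,
    mul_le_mul_of_nonneg_left h6 (pow_pos (show 0 < 5 + |t| by linarith) 2).le]

/-- A factor `(z - ρ) ^ n` of `f` near `ρ` that always transfers to a factor `(z - w) ^ n` of `F`
near `w` bounds the multiplicity of `f` at `ρ` by the order of `F` at `w`. -/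
lemma zeroMult_le_of_factor {f F : ℂ → ℂ} {ρ w : ℂ} (hF : AnalyticAt ℂ F w)
    (hF' : analyticOrderAt F w ≠ ⊤)
    (h : ∀ (n : ℕ) (g : ℂ → ℂ), AnalyticAt ℂ g ρ → (∀ᶠ z in 𝓝 ρ, f z = (z - ρ) ^ n * g z) →
      ∃ g' : ℂ → ℂ, AnalyticAt ℂ g' w ∧ ∀ᶠ z in 𝓝 w, F z = (z - w) ^ n * g' z) :
    zeroMult f ρ ≤ analyticOrderNatAt F w := by
  refine csSup_le' ?_
  rintro n ⟨g, hg, hfg⟩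
  have := (natCast_le_analyticOrderAt hF).2 (h n g hg hfg)
  rw [← Nat.cast_analyticOrderNatAt hF'] at this
  exact_mod_cast this

lemma zeroMult_riemannZeta_le {ρ : ℂ} (hρ : ρ ≠ 1) :
    zeroMult riemannZeta ρ ≤ analyticOrderNatAt riemannZeta₁ ρ := by
  refine zeroMult_le_of_factor (differentiable_riemannZeta₁.analyticAt ρ)
    (analyticOrderAt_riemannZeta₁_ne_top ρ) fun n g hg hfg ↦
      ⟨fun z ↦ (z - 1) * g z, by fun_prop, ?_⟩
  filter_upwards [hfg, eventually_ne_nhds hρ] with z hz hz1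
  rw [riemannZeta₁_eq_sub_mul hz1, hz]
  ring

lemma zeroMult_riemannZeta_le_one_sub {ρ : ℂ} (hρ : ρ.im ≠ 0) :
    zeroMult riemannZeta ρ ≤ analyticOrderNatAt riemannZeta₁ (1 - ρ) := by
  have him : ∀ᶠ w in 𝓝 (1 - ρ), w.im ≠ 0 :=
    (Complex.continuous_im.continuousAt (x := 1 - ρ)).eventually_ne (by simpa using hρ)
  have hA {w : ℂ} (hw : w.im ≠ 0) (n : ℕ) : 1 - w ≠ -n := fun h ↦ hw (by
    simpa using congrArg im h)
  have hB {w : ℂ} (hw : w.im ≠ 0) : 1 - w ≠ 1 := fun h ↦ hw (by simpa using congrArg im h)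
  have hsub : AnalyticAt ℂ (fun w : ℂ ↦ 1 - w) (1 - ρ) := by fun_prop
  refine zeroMult_le_of_factor (differentiable_riemannZeta₁.analyticAt _)
    (analyticOrderAt_riemannZeta₁_ne_top _) fun n g hg hfg ↦
      ⟨fun w ↦ (w - 1) * (2 * (2 * Real.pi) ^ (-(1 - w)) * Gamma (1 - w) *
        cos (Real.pi * (1 - w) / 2)) * ((-1) ^ n * g (1 - w)), ?_, ?_⟩
  · have hg' : AnalyticAt ℂ (fun w ↦ g (1 - w)) (1 - ρ) :=
      AnalyticAt.fun_comp (by simpa using hg) hsub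
    have h2 : AnalyticAt ℂ (fun w ↦ (w - 1) * (2 * (2 * Real.pi) ^ (-(1 - w)) * Gamma (1 - w) *
        cos (Real.pi * (1 - w) / 2))) (1 - ρ) := by
      refine analyticAt_iff_eventually_differentiableAt.2 ?_
      filter_upwards [him] with w hw
      have hG : DifferentiableAt ℂ (fun w ↦ Gamma (1 - w)) w :=
        (differentiableAt_Gamma _ (hA hw)).comp w (by fun_prop : DifferentiableAt ℂ (1 - ·) w)
      have hP : DifferentiableAt ℂ (fun w : ℂ ↦ (2 * Real.pi : ℂ) ^ (-(1 - w))) w :=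
        DifferentiableAt.const_cpow (by fun_prop) (.inl (by simp [Real.pi_ne_zero]))
      fun_prop
    exact h2.mul (analyticAt_const.mul hg')
  · have hfg' : ∀ᶠ w in 𝓝 (1 - ρ), riemannZeta (1 - w) = (1 - w - ρ) ^ n * g (1 - w) := by
      have : Tendsto (fun w : ℂ ↦ 1 - w) (𝓝 (1 - ρ)) (𝓝 ρ) := by
        simpa using hsub.continuousAt.tendsto
      exact this.eventually hfg
    filter_upwards [hfg', him] with w hw hw0
    have h1 : w ≠ 1 := by rintro rfl; simp at hw0
    have h3 := riemannZeta_one_sub (hA hw0) (hB hw0)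
    rw [sub_sub_cancel] at h3
    rw [riemannZeta₁_eq_sub_mul h1, h3, hw,
      show 1 - w - ρ = (-1) * (w - (1 - ρ)) by ring, mul_pow]
    ring

/-- There are `O(log (6 + t))` nontrivial zeros of `ζ` with height in `(t, t + 1]`. -/
lemma exists_sum_zeroMult_window_le : ∃ C : ℝ, 0 ≤ C ∧ ∀ (t : ℝ) (S : Finset ℂ),
    0 ≤ t → (∀ z ∈ S, 0 < z.re ∧ z.re < 1 ∧ t < z.im ∧ z.im ≤ t + 1) →
      ∑ z ∈ S, (zeroMult riemannZeta z : ℝ) ≤ C * Real.log (6 + t) := by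
  obtain ⟨C, hC, h⟩ := exists_sum_analyticOrderNatAt_le
  refine ⟨2 * C, by positivity, fun t S ht hS ↦ ?_⟩
  have hclose {z : ℂ} {u : ℝ} (h1 : 1 / 2 ≤ z.re) (h2 : z.re < 1) (h3 : |z.im - u| ≤ 1 / 2) :
      ‖z - (2 + u * I)‖ ≤ 8 / 5 := by
    rw [← abs_of_nonneg (show (0 : ℝ) ≤ 8 / 5 by norm_num), ← sq_le_sq₀ (norm_nonneg _)
      (abs_nonneg _), sq_abs, Complex.sq_norm, normSq_apply]
    have := sq_le_sq' (by linarith [abs_nonneg (z.im - u)]) h3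
    rw [sq_abs] at this
    simp
    nlinarith
  have hlog (u : ℝ) (hu : |u| = t + 1 / 2) : Real.log (5 + |u|) ≤ Real.log (6 + t) :=
    Real.log_le_log (by positivity) (by linarith)
  rw [← Finset.sum_filter_add_sum_filter_not S (fun z ↦ 1 / 2 ≤ z.re), two_mul, add_mul]
  refine add_le_add ?_ ?_
  · refine (Finset.sum_le_sum fun z hz ↦ ?_).trans
      ((h (t + 1 / 2) (S.filter fun z ↦ 1 / 2 ≤ z.re) fun z hz ↦ ?_).trans
        (mul_le_mul_of_nonneg_left (hlog _ (abs_of_nonneg (by linarith))) hC))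
    · obtain ⟨h0, h1, h2, h3⟩ := hS z (Finset.mem_filter.1 hz).1
      exact_mod_cast zeroMult_riemannZeta_le (fun h ↦ by simp [h] at h1)
    · obtain ⟨hzS, hz⟩ := Finset.mem_filter.1 hz
      obtain ⟨h0, h1, h2, h3⟩ := hS z hzS
      exact hclose hz h1 (abs_le.2 ⟨by linarith, by linarith⟩)
  · set S' := S.filter fun z ↦ ¬ 1 / 2 ≤ z.re with hS'
    have hinj : Function.Injective fun z : ℂ ↦ 1 - z := sub_right_injective
    calc ∑ z ∈ S', (zeroMult riemannZeta z : ℝ)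
        ≤ ∑ z ∈ S', (analyticOrderNatAt riemannZeta₁ (1 - z) : ℝ) := by
          refine Finset.sum_le_sum fun z hz ↦ ?_
          obtain ⟨h0, h1, h2, h3⟩ := hS z (Finset.mem_filter.1 hz).1
          exact_mod_cast zeroMult_riemannZeta_le_one_sub (by linarith : 0 < z.im).ne'
      _ = ∑ w ∈ S'.image fun z ↦ 1 - z, (analyticOrderNatAt riemannZeta₁ w : ℝ) := by
          rw [Finset.sum_image hinj.injOn]
      _ ≤ C * Real.log (5 + |(-(t + 1 / 2))|) := by
          refine h (-(t + 1 / 2)) _ fun w hw ↦ ?_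
          obtain ⟨z, hz, rfl⟩ := Finset.mem_image.1 hw
          obtain ⟨hzS, hz⟩ := Finset.mem_filter.1 hz
          obtain ⟨h0, h1, h2, h3⟩ := hS z hzS
          refine hclose ?_ ?_ (abs_le.2 ⟨?_, ?_⟩) <;> simp at hz ⊢ <;> linarith
      _ ≤ C * Real.log (6 + t) := mul_le_mul_of_nonneg_left
          (hlog _ (by rw [abs_neg, abs_of_nonneg (by linarith)])) hC

/-- A majorant for the pair weight depending only on the integer parts of the heights. -/
noncomputable def windowWeight (K : ℝ) (d : ℕ) : ℝ := if d ≤ 1 then K else 2 / d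

lemma min_le_windowWeight {K x y : ℝ} (hx : 0 < x) (hy : 0 < y) :
    (if x = y then K else min K (1 / |x - y|)) ≤ windowWeight K (Nat.dist ⌈x⌉₊ ⌈y⌉₊) := by
  unfold windowWeight
  split_ifs with h1 h2 h2
  · exact le_rfl
  · simp [h1, Nat.dist_self] at h2
  · exact min_le_left _ _
  · refine (min_le_right _ _).trans ?_
    push Not at h2
    have hd : (2 : ℝ) ≤ Nat.dist ⌈x⌉₊ ⌈y⌉₊ := by exact_mod_cast h2
    have hd' : (Nat.dist ⌈x⌉₊ ⌈y⌉₊ : ℝ) = |(⌈x⌉₊ : ℝ) - ⌈y⌉₊| := by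
      rcases le_total ⌈x⌉₊ ⌈y⌉₊ with h | h
      · rw [Nat.dist_eq_sub_of_le h, Nat.cast_sub h, abs_sub_comm,
          abs_of_nonneg (sub_nonneg.2 (by exact_mod_cast h))]
      · rw [Nat.dist_eq_sub_of_le_right h, Nat.cast_sub h,
          abs_of_nonneg (sub_nonneg.2 (by exact_mod_cast h))]
    have hle : (Nat.dist ⌈x⌉₊ ⌈y⌉₊ : ℝ) ≤ |x - y| + 1 := by
      rw [hd']
      have a1 := Nat.le_ceil x
      have a2 := Nat.ceil_lt_add_one hx.le
      have b1 := Nat.le_ceil y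
      have b2 := Nat.ceil_lt_add_one hy.le
      have c1 := le_abs_self (x - y)
      have c2 := neg_le_abs (x - y)
      rw [abs_le]
      constructor <;> linarith
    rw [div_le_div_iff₀ (by linarith) (by linarith)]
    linarith

lemma sum_windowWeight_le {K : ℝ} (hK : 1 ≤ K) (N j : ℕ) (hj : j ∈ Finset.Icc 1 N) :
    ∑ k ∈ Finset.Icc 1 N, windowWeight K (Nat.dist j k) ≤ 4 * K + 4 * (1 + Real.log N) := by
  have hw (d : ℕ) : 0 ≤ windowWeight K d := by
    unfold windowWeight; split_ifs <;> positivity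
  have hsum : ∑ d ∈ Finset.range (N + 1), windowWeight K d ≤ 2 * K + 2 * (1 + Real.log N) := by
    have h1 : ∀ d ∈ Finset.range (N + 1),
        windowWeight K d ≤ (if d ∈ Finset.range 2 then K else 0) + 2 * (d : ℝ)⁻¹ := by
      intro d _
      by_cases hd : d ≤ 1
      · have : d ∈ Finset.range 2 := Finset.mem_range.2 (by omega)
        simp [windowWeight, hd, this]
      · have : d ∉ Finset.range 2 := by simpa using hd
        simp [windowWeight, hd, this, div_eq_mul_inv]
    refine (Finset.sum_le_sum h1).trans ?_
    rw [Finset.sum_add_distrib, ← Finset.mul_sum]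
    gcongr
    · rw [← Finset.sum_filter, Finset.sum_const, nsmul_eq_mul]
      gcongr
      have : (Finset.range (N + 1)).filter (· ∈ Finset.range 2) ⊆ Finset.range 2 := fun x hx ↦
        (Finset.mem_filter.1 hx).2
      exact_mod_cast Finset.card_le_card this
    · have := harmonic_le_one_add_log N
      rw [harmonic_eq_sum_Icc] at this
      rw [Finset.range_eq_Ico, Finset.sum_eq_sum_Ico_succ_bot (by omega)]
      push_cast at this
      simpa [show Finset.Ico 1 (N + 1) = Finset.Icc 1 N by ext; simp] using this
  have hsplit : ∑ k ∈ Finset.Icc 1 N, windowWeight K (Nat.dist j k) ≤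
      ∑ k ∈ Finset.Icc 1 j, windowWeight K (j - k) +
        ∑ k ∈ Finset.Icc j N, windowWeight K (k - j) := by
    rw [← Finset.sum_filter_add_sum_filter_not _ (fun k ↦ k ≤ j)]
    refine add_le_add ?_ ?_
    · refine (Finset.sum_congr rfl fun k hk ↦ ?_).trans_le
        (Finset.sum_le_sum_of_subset_of_nonneg (f := fun k ↦ windowWeight K (j - k)) ?_
          fun _ _ _ ↦ hw _)
      · rw [Nat.dist_eq_sub_of_le_right (Finset.mem_filter.1 hk).2]
      · intro k hk; simp at hk ⊢; omega
    · refine (Finset.sum_congr rfl fun k hk ↦ ?_).trans_le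
        (Finset.sum_le_sum_of_subset_of_nonneg (f := fun k ↦ windowWeight K (k - j)) ?_
          fun _ _ _ ↦ hw _)
      · rw [Nat.dist_eq_sub_of_le (not_le.1 (Finset.mem_filter.1 hk).2).le]
      · intro k hk; simp at hk ⊢; omega
  have hj' := Finset.mem_Icc.1 hj
  have hA : ∑ k ∈ Finset.Icc 1 j, windowWeight K (j - k) ≤
      ∑ d ∈ Finset.range (N + 1), windowWeight K d := by
    rw [← Finset.sum_image (s := Finset.Icc 1 j) (g := fun k ↦ j - k) (f := windowWeight K)
      (by intro a ha b hb hab; simp at ha hb hab; omega)]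
    refine Finset.sum_le_sum_of_subset_of_nonneg ?_ fun _ _ _ ↦ hw _
    intro d hd; simp at hd ⊢; omega
  have hB : ∑ k ∈ Finset.Icc j N, windowWeight K (k - j) ≤
      ∑ d ∈ Finset.range (N + 1), windowWeight K d := by
    rw [← Finset.sum_image (s := Finset.Icc j N) (g := fun k ↦ k - j) (f := windowWeight K)
      (by intro a ha b hb hab; simp at ha hb hab; omega)]
    refine Finset.sum_le_sum_of_subset_of_nonneg ?_ fun _ _ _ ↦ hw _
    intro d hd; simp at hd ⊢; omega
  linarith

/-- Double sums over points grouped into windows. -/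
lemma sum_sum_mul_le_of_window {S : Finset ℂ} {m : ℂ → ℝ} {i : ℂ → ℕ} {N : ℕ} {A B : ℝ}
    {W : ℕ → ℕ → ℝ} (hm : ∀ z, 0 ≤ m z) (hA0 : 0 ≤ A) (hi : ∀ z ∈ S, i z ∈ Finset.Icc 1 N)
    (hW : ∀ j k, 0 ≤ W j k)
    (hA : ∀ j ∈ Finset.Icc 1 N, ∑ z ∈ S with i z = j, m z ≤ A)
    (hB : ∀ j ∈ Finset.Icc 1 N, ∑ k ∈ Finset.Icc 1 N, W j k ≤ B) :
    ∑ z ∈ S, ∑ w ∈ S, m z * m w * W (i z) (i w) ≤ N * A ^ 2 * B := by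
  calc ∑ z ∈ S, ∑ w ∈ S, m z * m w * W (i z) (i w)
      = ∑ j ∈ Finset.Icc 1 N, ∑ k ∈ Finset.Icc 1 N,
          (∑ z ∈ S with i z = j, m z) * (∑ w ∈ S with i w = k, m w) * W j k := by
        rw [← Finset.sum_fiberwise_of_maps_to hi]
        refine Finset.sum_congr rfl fun j _ ↦ ?_
        have h1 (z : ℂ) : ∑ w ∈ S, m z * m w * W (i z) (i w) =
            ∑ k ∈ Finset.Icc 1 N, ∑ w ∈ S with i w = k, m z * m w * W (i z) k := by
          rw [← Finset.sum_fiberwise_of_maps_to hi]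
          exact Finset.sum_congr rfl fun k _ ↦ Finset.sum_congr rfl fun w hw ↦ by
            rw [(Finset.mem_filter.1 hw).2]
        simp_rw [h1]
        rw [Finset.sum_comm]
        refine Finset.sum_congr rfl fun k _ ↦ ?_
        rw [Finset.sum_mul_sum, Finset.sum_mul]
        refine Finset.sum_congr rfl fun z hz ↦ ?_
        rw [(Finset.mem_filter.1 hz).2, Finset.sum_mul]
    _ ≤ ∑ j ∈ Finset.Icc 1 N, ∑ k ∈ Finset.Icc 1 N, A * A * W j k := by
        refine Finset.sum_le_sum fun j hj ↦ Finset.sum_le_sum fun k hk ↦ ?_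
        exact mul_le_mul_of_nonneg_right (mul_le_mul (hA j hj) (hA k hk)
          (Finset.sum_nonneg fun z _ ↦ hm z) hA0) (hW j k)
    _ ≤ ∑ j ∈ Finset.Icc 1 N, A * A * B := by
        refine Finset.sum_le_sum fun j hj ↦ ?_
        rw [← Finset.mul_sum]
        exact mul_le_mul_of_nonneg_left (hB j hj) (by positivity)
    _ = N * A ^ 2 * B := by
        rw [Finset.sum_const, Nat.card_Icc, Nat.add_sub_cancel, nsmul_eq_mul]
        ring

/-- For `T ≥ 2` and `K ≥ 1`,
`∑_{0<γ,γ'≤T} min(K, 1/|γ-γ'|) ≪ T (K + log T)(log T)²` with an absolute constant. -/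
theorem zetaZeroMinSum_bound :
    ∃ C : ℝ, ∀ T K : ℝ, 2 ≤ T → 1 ≤ K →
      zetaZeroMinSum T K ≤ C * (T * (K + Real.log T) * Real.log T ^ 2) := by
  obtain ⟨C, hC, hwin⟩ := exists_sum_zeroMult_window_le
  refine ⟨288 * C ^ 2, fun T K hT hK ↦ ?_⟩
  set N := ⌈T⌉₊ with hN
  set A := C * Real.log (6 + T) with hA
  have hlogT : 1 / 2 < Real.log T := by
    have := Real.log_two_gt_d9
    have := Real.log_le_log (by norm_num) hT
    linarith
  have hA0 : 0 ≤ A := mul_nonneg hC (Real.log_nonneg (by linarith))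
  have hNT : (N : ℝ) ≤ T + 1 := (Nat.ceil_lt_add_one (by linarith)).le
  have hTN : T ≤ N := Nat.le_ceil T
  have hA' : A ≤ C * (3 * Real.log T) := by
    refine mul_le_mul_of_nonneg_left ?_ hC
    rw [show 3 * Real.log T = Real.log (T ^ 3) by rw [Real.log_pow]; norm_num]
    exact Real.log_le_log (by linarith) (by nlinarith [mul_nonneg (sub_nonneg.2 hT) (sq_nonneg T)])
  have hlogN : Real.log N ≤ 2 * Real.log T := by
    rw [show 2 * Real.log T = Real.log (T ^ 2) by rw [Real.log_pow]; norm_num]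
    exact Real.log_le_log (by linarith) (by nlinarith)
  have hmain : N * A ^ 2 * (4 * K + 4 * (1 + Real.log N)) ≤
      288 * C ^ 2 * (T * (K + Real.log T) * Real.log T ^ 2) := by
    have h1 : 4 * K + 4 * (1 + Real.log N) ≤ 16 * (K + Real.log T) := by linarith
    have h0 : 0 ≤ Real.log N := Real.log_nonneg (by linarith)
    calc N * A ^ 2 * (4 * K + 4 * (1 + Real.log N))
        ≤ (2 * T) * (C * (3 * Real.log T)) ^ 2 * (16 * (K + Real.log T)) := by
          gcongr
          linarith
      _ = _ := by ring
  refine le_trans ?_ hmain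
  have hnn (x y : ℝ) : 0 ≤ if x = y then K else min K (1 / |x - y|) := by
    split_ifs <;> positivity
  refine Real.tsum_le_of_sum_le (fun p ↦ ?_) fun s ↦ ?_
  · split_ifs with h h' <;> positivity
  set S := (s.image Prod.fst ∪ s.image Prod.snd).filter (inZeroBox · T) with hS
  have hSbox {z : ℂ} (hz : z ∈ S) : inZeroBox z T := (Finset.mem_filter.1 hz).2
  rw [← Finset.sum_filter]
  have hsub : s.filter (fun p ↦ inZeroBox p.1 T ∧ inZeroBox p.2 T) ⊆ S ×ˢ S := by
    intro p hp
    obtain ⟨hp, h1, h2⟩ := Finset.mem_filter.1 hp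
    simp only [hS, Finset.mem_product, Finset.mem_filter, Finset.mem_union]
    exact ⟨⟨.inl (Finset.mem_image_of_mem _ hp), h1⟩, ⟨.inr (Finset.mem_image_of_mem _ hp), h2⟩⟩
  have hceil {z : ℂ} (hz : z ∈ S) : ⌈z.im⌉₊ ∈ Finset.Icc 1 N := by
    obtain ⟨_, _, h3, h4⟩ := hSbox hz
    exact Finset.mem_Icc.2 ⟨Nat.ceil_pos.2 h3, Nat.ceil_mono h4⟩
  refine (Finset.sum_le_sum_of_subset_of_nonneg hsub fun p _ _ ↦
    mul_nonneg (Nat.cast_nonneg _) (hnn _ _)).trans ?_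
  rw [Finset.sum_product]
  refine le_trans (Finset.sum_le_sum fun z hz ↦ Finset.sum_le_sum fun w hw ↦ ?_)
    (sum_sum_mul_le_of_window (S := S) (m := fun z ↦ (zeroMult riemannZeta z : ℝ))
      (i := fun z ↦ ⌈z.im⌉₊) (W := fun j k ↦ windowWeight K (Nat.dist j k))
      (fun _ ↦ Nat.cast_nonneg _) hA0 (fun z hz ↦ hceil hz)
      (fun j k ↦ by simp only [windowWeight]; split_ifs <;> positivity) (fun j hj ↦ ?_)
      (fun j hj ↦ sum_windowWeight_le hK N j hj))
  · push_cast
    exact mul_le_mul_of_nonneg_left (min_le_windowWeight (hSbox hz).2.2.1 (hSbox hw).2.2.1)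
      (by positivity)
  · have hj1 : (1 : ℝ) ≤ j := by exact_mod_cast (Finset.mem_Icc.1 hj).1
    have hjN : (j : ℝ) ≤ N := by exact_mod_cast (Finset.mem_Icc.1 hj).2
    refine (hwin (j - 1) _ (by linarith) fun z hz ↦ ?_).trans
      (mul_le_mul_of_nonneg_left (Real.log_le_log (by linarith) (by linarith)) hC)
    obtain ⟨hzS, rfl⟩ := Finset.mem_filter.1 hz
    obtain ⟨h1, h2, h3, _⟩ := hSbox hzS
    have := Nat.ceil_lt_add_one h3.le
    exact ⟨h1, h2, by linarith, by linarith [Nat.le_ceil z.im]⟩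
end
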